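/- arXiv:2111.14410 — 2 statements merged into one kernel-verified Lean document; each statement's English description precedes it below -/
import Mathlib

section
/- Let n and k be natural numbers with 1 ≤ k ≤ n − 3 and suppose (n : ℝ) ≥ 2k + 3/2 + √(2k² + 2k + 1/4). Let h ∈ ℂ[X₀,…,Xₙ] be an irreducible homogeneous polynomial of degree n − k defining a totally invariant hypersurface X = {h = 0} ⊂ ℙⁿ(ℂ). Then X is not normal; in particular its singular locus has dimension n − 2, i.e. the Jacobian ring J(h) has Krull dimension ≥ n − 1. -/
open MvPolynomial

/-- `F` is an endomorphism of `ℙ^{N-1}(ℂ)` of algebraic degree `q`: a tuple of `N`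
homogeneous polynomials of degree `q` in `N` variables whose only common zero in `ℂ^N`
is the origin. -/
def IsEndo (N q : ℕ) (F : Fin N → MvPolynomial (Fin N) ℂ) : Prop :=
  (∀ i, (F i).IsHomogeneous q) ∧
    ∀ x : Fin N → ℂ, (∀ i, eval x (F i) = 0) → x = 0

/-- The hypersurface `{h = 0} ⊂ ℙ^{N-1}(ℂ)` is totally invariant: there is a non-trivial
endomorphism `F` (of algebraic degree `q ≥ 2`) and `λ ≠ 0` with `h(F₀,…,F_{N-1}) = λ·h^q`. -/
def IsTotallyInvariant (N : ℕ) (h : MvPolynomial (Fin N) ℂ) : Prop :=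
  ∃ q, 2 ≤ q ∧ ∃ F : Fin N → MvPolynomial (Fin N) ℂ, IsEndo N q F ∧
    ∃ lam : ℂ, lam ≠ 0 ∧ aeval F h = C lam * h ^ q

/-- The Jacobian ideal `(h, ∂h/∂X₀, …, ∂h/∂X_{N-1})`. -/
noncomputable def jacobianIdeal (N : ℕ) (h : MvPolynomial (Fin N) ℂ) : Ideal (MvPolynomial (Fin N) ℂ) :=
  Ideal.span (insert h (Set.range fun i => pderiv i h))


/-- homogeneous component of a product with a homogeneous factor -/
lemma aux_hc_mul {N : ℕ} {e m : ℕ} {w : MvPolynomial (Fin N) ℂ} (hw : w.IsHomogeneous e)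
    (c : MvPolynomial (Fin N) ℂ) :
    homogeneousComponent (m + e) (c * w) = homogeneousComponent m c * w := by
  have key : ∀ k, homogeneousComponent (m + e) (homogeneousComponent k c * w) =
      if k = m then homogeneousComponent m c * w else 0 := by
    intro k
    rw [homogeneousComponent_of_mem (m := m + e) (n := k + e)
      ((homogeneousComponent_isHomogeneous k c).mul hw)]
    by_cases hk : k = m
    · subst hk; simp
    · rw [if_neg (by omega), if_neg hk]
  conv_lhs => rw [← sum_homogeneousComponent c, Finset.sum_mul, map_sum]
  simp_rw [key]
  rw [Finset.sum_ite_eq']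
  split_ifs with hm
  · rfl
  · rw [homogeneousComponent_eq_zero m c (by simpa using hm), zero_mul]

lemma aux_mem_pow_vars {N j b : ℕ} (hbj : b ≤ j) {f : MvPolynomial (Fin N) ℂ}
    (hf : f.IsHomogeneous j) : f ∈ idealOfVars (Fin N) ℂ ^ b := by
  rw [mem_pow_idealOfVars_iff]
  intro x hx
  have := hf.degree_eq_sum_deg_support hx
  rw [Finsupp.degree_apply, ← this]; exact hbj

lemma aux_vars_pow_le {N : ℕ} {ι : Type*} (w : ι → MvPolynomial (Fin N) ℂ)
    (hz : ∀ x : Fin N → ℂ, (∀ i, eval x (w i) = 0) → x = 0) :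
    ∃ b, idealOfVars (Fin N) ℂ ^ b ≤ Ideal.span (Set.range w) := by
  apply Ideal.exists_pow_le_of_le_radical_of_fg
  · rw [← vanishingIdeal_zeroLocus_eq_radical (K := ℂ), idealOfVars, Ideal.span_le]
    rintro _ ⟨i, rfl⟩
    rw [SetLike.mem_coe, mem_vanishingIdeal_iff]
    intro x hx
    have hx0 : x = 0 := hz x (fun i => by
      have := (mem_zeroLocus_iff.1 hx) (w i) (Ideal.subset_span ⟨i, rfl⟩)
      simpa using this)
    simp [hx0]
  · exact idealOfVars_fg ..

/-- in large degree every form is a homogeneous combination -/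
lemma aux_hspan {N e : ℕ} {ι : Type*} [Fintype ι] (w : ι → MvPolynomial (Fin N) ℂ)
    (hw : ∀ i, (w i).IsHomogeneous e) {b : ℕ}
    (hb : idealOfVars (Fin N) ℂ ^ b ≤ Ideal.span (Set.range w)) {m : ℕ} (hm : b ≤ m + e)
    {f : MvPolynomial (Fin N) ℂ} (hf : f.IsHomogeneous (m + e)) :
    ∃ c : ι → MvPolynomial (Fin N) ℂ, (∀ i, (c i).IsHomogeneous m) ∧ f = ∑ i, c i * w i := by
  have hmem := hb (aux_mem_pow_vars hm hf)
  rw [Ideal.span, Submodule.mem_span_range_iff_exists_fun] at hmem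
  obtain ⟨c, hc⟩ := hmem
  refine ⟨fun i => homogeneousComponent m (c i), fun i => homogeneousComponent_isHomogeneous _ _, ?_⟩
  have : homogeneousComponent (m + e) f = f := homogeneousComponent_eq_self hf
  rw [← this, ← hc, map_sum]
  exact Finset.sum_congr rfl fun i _ => by rw [smul_eq_mul, aux_hc_mul (hw i)]

/-- a finite family of primes, none containing all the `w i`, is avoided by some combination -/
lemma aux_avoid {N : ℕ} {M : ℕ} (w : Fin M → MvPolynomial (Fin N) ℂ)
    (U : Submodule ℂ (Fin M → ℂ))
    (s : Set (Ideal (MvPolynomial (Fin N) ℂ))) (hs : s.Finite)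
    (h : ∀ p ∈ s, ∃ a ∈ U, ∑ i, C (a i) * w i ∉ p) (i0 : Fin M) (hi0 : ∃ a ∈ U, a i0 ≠ 0) :
    ∃ a ∈ U, a i0 ≠ 0 ∧ ∀ p ∈ s, ∑ i, C (a i) * w i ∉ p := by
  classical
  let L : (Fin M → ℂ) →ₗ[ℂ] MvPolynomial (Fin N) ℂ :=
    Fintype.linearCombination ℂ w
  have hL : ∀ a, L a = ∑ i, C (a i) * w i := fun a => by
    simp [L, Fintype.linearCombination_apply, MvPolynomial.smul_eq_C_mul]
  let T : Option s → Submodule ℂ U := fun o => match o with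
    | none => (LinearMap.ker (LinearMap.proj i0 : (Fin M → ℂ) →ₗ[ℂ] ℂ)).comap U.subtype
    | some p => ((p.1.restrictScalars ℂ).comap L).comap U.subtype
  have : Finite s := hs
  by_contra hcon
  push Not at hcon
  have hcov : ⋃ i, (T i : Set U) = Set.univ := by
    ext a
    simp only [Set.mem_iUnion, Set.mem_univ, iff_true]
    by_cases ha : a.1 i0 = 0
    · exact ⟨none, by simpa [T] using ha⟩
    · obtain ⟨p, hp, hpa⟩ := hcon a.1 a.2 ha
      refine ⟨some ⟨p, hp⟩, ?_⟩
      simp only [T, SetLike.mem_coe, Submodule.mem_comap, Submodule.restrictScalars_mem]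
      rw [Submodule.subtype_apply, hL]; exact hpa
  obtain ⟨o, ho⟩ := Subspace.exists_eq_top_of_iUnion_eq_univ hcov
  rcases o with _ | ⟨p, hp⟩
  · obtain ⟨a, haU, ha⟩ := hi0
    have : (⟨a, haU⟩ : U) ∈ T none := by rw [ho]; trivial
    apply ha; simpa [T] using this
  · obtain ⟨a, haU, ha⟩ := h p hp
    have : (⟨a, haU⟩ : U) ∈ T (some ⟨p, hp⟩) := by rw [ho]; trivial
    apply ha
    rw [← hL]
    simpa [T] using this

lemma aux_finrank (j : ℕ) :
    Module.finrank ℂ (homogeneousSubmodule (Fin 3) ℂ j) = (j + 2).choose 2 := by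
  rw [homogeneousSubmodule_eq_finsupp_supported]
  let s : Set (Fin 3 →₀ ℕ) := {d | d.degree = j}
  have hs : s = ((Finset.univ : Finset (Fin 3)).finsuppAntidiag j : Finset (Fin 3 →₀ ℕ)) := by
    ext d
    simp [s, Finset.mem_finsuppAntidiag, Finsupp.degree_eq_sum]
  have hc : Nat.card s = (j + 2).choose 2 := by
    rw [hs, Nat.card_coe_set_eq, Set.ncard_coe_finset, Finset.card_finsuppAntidiag_nat_eq_choose]
    simp only [Finset.card_univ, Fintype.card_fin]
    rw [show 3 + j - 1 = j + 2 by omega]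
    rw [← Nat.choose_symm_add]
  have hfin : Finite s := by rw [hs]; infer_instance
  have e := (AddMonoidAlgebra.supportedEquivFinsupp (S := ℂ) (R := ℂ) s)
  rw [← hc]
  have := Fintype.ofFinite s
  rw [Nat.card_eq_fintype_card]
  exact e.finrank_eq.trans (by rw [Module.finrank_finsupp_self])

instance aux_findim (N j : ℕ) : FiniteDimensional ℂ (homogeneousSubmodule (Fin N) ℂ j) :=
  Module.Finite.iff_fg.2 (homogeneousSubmodule_fg _ _ j)

/-- the limit lemma -/
lemma aux_limit {V W : Type*} [AddCommGroup V] [Module ℂ V] [FiniteDimensional ℂ V]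
    [AddCommGroup W] [Module ℂ W] [FiniteDimensional ℂ W] (T0 T1 : V →ₗ[ℂ] W)
    (K : Submodule ℂ W)
    (hK : ∀ (a : ℕ) (y : ℕ → V), (∀ i < a, T0 (y (i + 1)) + T1 (y i) = 0) → T0 (y 0) = 0 →
      T0 (y (a + 1)) + T1 (y a) ∈ K)
    (hK0 : ∀ y, T0 y ∈ K) :
    Module.finrank ℂ (LinearMap.range T1) ≤ Module.finrank ℂ K := by
  classical
  by_contra hlt
  push Not at hlt
  obtain ⟨V', hV'⟩ := Submodule.exists_isCompl (LinearMap.ker T1)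
  obtain ⟨W', hW'⟩ := Submodule.exists_isCompl K
  set r := Module.finrank ℂ (LinearMap.range T1) with hr
  have hV'r : Module.finrank ℂ V' = r := by
    have h1 := Submodule.finrank_add_eq_of_isCompl hV'
    have h2 := LinearMap.finrank_range_add_finrank_ker T1
    omega
  have hinj : ∀ y ∈ V', T1 y = 0 → y = 0 := fun y hy h =>
    (Submodule.disjoint_def.1 hV'.disjoint) y (by simpa using h) hy
  let π : W →ₗ[ℂ] K := K.projectionOnto W' hW'
  have hπ : ∀ x, π x = 0 → x ∈ K → x = 0 := by
    intro x hx hxK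
    have h1 : x ∈ W' := by
      rw [← Submodule.ker_projectionOnto hW']; exact hx
    exact (Submodule.disjoint_def.1 hW'.disjoint) x hxK h1
  -- unknowns
  let ext : (Fin (r + 1) → V') → ℕ → V := fun y i =>
    if h : i < r + 1 then (y ⟨i, h⟩ : V) else 0
  let Φ : (Fin (r + 1) → V') →ₗ[ℂ] (Fin (r + 2) → K) :=
    { toFun := fun y i => π (T0 (ext y i) + (if (i : ℕ) = 0 then 0 else T1 (ext y (i - 1))))
      map_add' := by
        intro y z
        funext i
        have : ∀ k, ext (y + z) k = ext y k + ext z k := by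
          intro k; simp only [ext]; split_ifs <;> simp
        simp only [this, Pi.add_apply]
        rw [← map_add]; congr 1
        split_ifs <;> simp <;> abel
      map_smul' := by
        intro c y
        funext i
        have : ∀ k, ext (c • y) k = c • ext y k := by
          intro k; simp only [ext]; split_ifs <;> simp
        simp only [this, Pi.smul_apply, RingHom.id_apply]
        rw [← map_smul]; congr 1
        split_ifs <;> simp }
  have hker : LinearMap.ker Φ ≠ ⊥ := by
    apply LinearMap.ker_ne_bot_of_finrank_lt
    rw [Module.finrank_pi_fintype, Module.finrank_pi_fintype]
    simp only [Finset.sum_const, Finset.card_univ, Fintype.card_fin, smul_eq_mul]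
    rw [hV'r]
    obtain ⟨c, hc⟩ : ∃ c, r = Module.finrank ℂ K + 1 + c := ⟨_, (Nat.add_sub_of_le hlt).symm⟩
    nlinarith
  obtain ⟨y, hy, hy0⟩ := (Submodule.ne_bot_iff _).1 hker
  have hy' : ∀ i : Fin (r + 2), π (T0 (ext y i) +
      (if (i : ℕ) = 0 then 0 else T1 (ext y (i - 1)))) = 0 := fun i => congrFun hy i
  have hz0 : T0 (ext y 0) = 0 := by
    apply hπ _ _ (hK0 _)
    simpa using hy' 0
  have hstep : ∀ i, i ≤ r → T0 (ext y (i + 1)) + T1 (ext y i) = 0 := by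
    intro i
    induction i using Nat.strong_induction_on with
    | _ i ih =>
      intro hi
      apply hπ
      · have := hy' ⟨i + 1, by omega⟩
        simpa using this
      · exact hK i (ext y) (fun k hk => ih k hk (by omega)) hz0
  have hall : ∀ k, k ≤ r → ext y (r - k) = 0 := by
    intro k
    induction k with
    | zero =>
      intro _
      have h1 := hstep r le_rfl
      have h2 : ext y (r + 1) = 0 := by simp [ext]
      rw [h2, map_zero, zero_add] at h1
      apply hinj _ _ h1
      simp [ext]
    | succ k ih =>
      intro hk
      have h1 := hstep (r - (k + 1)) (by omega)
      rw [show r - (k + 1) + 1 = r - k by omega, ih (by omega), map_zero, zero_add] at h1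
      apply hinj _ _ h1
      simp only [ext]
      split_ifs <;> simp
  apply hy0
  funext i
  have h1 := hall (r - i) (by omega)
  rw [show r - (r - (i : ℕ)) = i by omega] at h1
  simp only [ext, i.2, dif_pos] at h1
  ext
  simpa using h1

/-- the depth lemma -/
lemma aux_depth {a b f : MvPolynomial (Fin 3) ℂ} (ha : a ≠ 0) (hb : b ≠ 0)
    (hab : ∀ c d, c * a = d * b → ∃ k, c = k * b ∧ d = k * a)
    (hx : ∀ i, X i * f ∈ Ideal.span {a, b}) : f ∈ Ideal.span {a, b} := by
  have pX : ∀ i : Fin 3, Prime (X i : MvPolynomial (Fin 3) ℂ) := fun i => MvPolynomial.X_prime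
  have nd : ∀ i j : Fin 3, i ≠ j → ¬ (X i : MvPolynomial (Fin 3) ℂ) ∣ X j := by
    intro i j hij h
    rw [MvPolynomial.X_dvd_X] at h
    simp_all
  obtain ⟨α1, β1, h1⟩ := Ideal.mem_span_pair.1 (hx 0)
  obtain ⟨α2, β2, h2⟩ := Ideal.mem_span_pair.1 (hx 1)
  obtain ⟨α3, β3, h3⟩ := Ideal.mem_span_pair.1 (hx 2)
  obtain ⟨k12, e12, e12'⟩ := hab (X 1 * α1 - X 0 * α2) (X 0 * β2 - X 1 * β1)
    (by linear_combination X 1 * h1 - X 0 * h2)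
  obtain ⟨k13, e13, -⟩ := hab (X 2 * α1 - X 0 * α3) (X 0 * β3 - X 2 * β1)
    (by linear_combination X 2 * h1 - X 0 * h3)
  obtain ⟨k23, e23, -⟩ := hab (X 2 * α2 - X 1 * α3) (X 1 * β3 - X 2 * β2)
    (by linear_combination X 2 * h2 - X 1 * h3)
  have hk : X 2 * k12 - X 1 * k13 + X 0 * k23 = 0 := by
    apply mul_right_cancel₀ hb
    linear_combination -X 2 * e12 + X 1 * e13 - X 0 * e23
  have hk12 : k12 ∈ Ideal.span {(X 1 : MvPolynomial (Fin 3) ℂ), X 0} := by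
    have hset : ({(X 1 : MvPolynomial (Fin 3) ℂ), X 0} : Set (MvPolynomial (Fin 3) ℂ)) =
        X '' {1, 0} := by simp [Set.image_pair]
    have hm : X 2 * k12 ∈ Ideal.span {(X 1 : MvPolynomial (Fin 3) ℂ), X 0} :=
      Ideal.mem_span_pair.2 ⟨k13, -k23, by linear_combination -hk⟩
    rw [hset, MvPolynomial.mem_ideal_span_X_image] at hm ⊢
    intro m hmm
    obtain ⟨i, hi, hi'⟩ := hm (Finsupp.single 2 1 + m) (by
      rw [mem_support_iff, coeff_X_mul]; exact mem_support_iff.1 hmm)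
    refine ⟨i, hi, ?_⟩
    have h2i : (2 : Fin 3) ≠ i := by
      rcases hi with rfl | rfl <;> decide
    rw [Finsupp.add_apply, Finsupp.single_apply, if_neg h2i, zero_add] at hi'
    exact hi'
  obtain ⟨p, r, hpr⟩ := Ideal.mem_span_pair.1 hk12
  have hX0 : (X 0 : MvPolynomial (Fin 3) ℂ) ∣ α1 - p * b := by
    have : (X 0 : MvPolynomial (Fin 3) ℂ) ∣ X 1 * (α1 - p * b) :=
      ⟨α2 + r * b, by linear_combination e12 - b * hpr⟩
    exact ((pX 0).dvd_or_dvd this).resolve_left (nd 0 1 (by decide))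
  have hX0' : (X 0 : MvPolynomial (Fin 3) ℂ) ∣ β1 + p * a := by
    have : (X 0 : MvPolynomial (Fin 3) ℂ) ∣ X 1 * (β1 + p * a) :=
      ⟨β2 - r * a, by linear_combination -e12' + a * hpr⟩
    exact ((pX 0).dvd_or_dvd this).resolve_left (nd 0 1 (by decide))
  obtain ⟨τ, hτ⟩ := hX0
  obtain ⟨σ, hσ⟩ := hX0'
  refine Ideal.mem_span_pair.2 ⟨τ, σ, ?_⟩
  apply mul_left_cancel₀ (pX 0).ne_zero
  linear_combination h1 - a * hτ - b * hσ

/-- the matrix with first row `u` and then the rows `2, 3, …` of `A` -/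
def auxM {S : Type*} {m : ℕ} (A : Matrix (Fin (m + 2)) (Fin (m + 2)) S) (u : Fin (m + 2) → S) :
    Matrix (Fin (m + 1)) (Fin (m + 2)) S :=
  Matrix.of (Fin.cons u (fun k : Fin m => A k.succ.succ))

lemma aux_minor {S : Type*} [CommRing S] {m : ℕ} (M : Matrix (Fin (m + 1)) (Fin (m + 2)) S)
    (r : Fin (m + 2) → S) :
    ∑ l, r l * ((-1) ^ (l : ℕ) * (M.submatrix id l.succAbove).det) =
      Matrix.det (Matrix.of (Fin.cons r (fun k => M k) : Fin (m + 2) → Fin (m + 2) → S)) := by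
  rw [Matrix.det_succ_row_zero]
  apply Finset.sum_congr rfl
  intro l _
  have : (Matrix.of (Fin.cons r (fun k => M k) : Fin (m + 2) → Fin (m + 2) → S)).submatrix Fin.succ l.succAbove
      = M.submatrix id l.succAbove := by
    ext i j; rfl
  rw [this]
  change _ = (-1) ^ (l : ℕ) * r l * _
  ring

lemma aux_minor_zero {S : Type*} [CommRing S] {m : ℕ} (M : Matrix (Fin (m + 1)) (Fin (m + 2)) S) :
    M.mulVec (fun l : Fin (m + 2) => (-1) ^ (l : ℕ) * (M.submatrix id l.succAbove).det) = 0 := by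
  funext k
  have := aux_minor M (M k)
  simp only [Matrix.mulVec, dotProduct, Pi.zero_apply]
  rw [this]
  apply Matrix.det_zero_of_row_eq (i := 0) (j := k.succ)
  · exact (Fin.succ_ne_zero k).symm
  · rfl

lemma aux_seq {S : Type*} [CommRing S] {m : ℕ} (M D : Matrix (Fin (m + 1)) (Fin (m + 2)) S) :
    ∃ y : ℕ → Fin (m + 2) → S,
      (y 0 = fun l : Fin (m + 2) => (-1) ^ (l : ℕ) * (M.submatrix id l.succAbove).det) ∧
      ∀ i, M.mulVec (y (i + 1)) + D.mulVec (y i) = 0 := by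
  let Me : Matrix (Fin (m + 1)) (Fin (m + 2)) (Polynomial S) :=
    Matrix.of fun i j => Polynomial.C (M i j) + Polynomial.X * Polynomial.C (D i j)
  have hz := aux_minor_zero Me
  set me : Fin (m + 2) → Polynomial S :=
    fun l => (-1) ^ (l : ℕ) * (Me.submatrix id l.succAbove).det with hme
  refine ⟨fun i l => (me l).coeff i, ?_, ?_⟩
  · funext l
    simp only [hme]
    rw [Polynomial.coeff_zero_eq_eval_zero, ← Polynomial.coe_evalRingHom, map_mul, map_pow, map_neg,
      map_one, RingHom.map_det]
    congr 2
    ext i j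
    simp [Me]
  · intro i
    funext k
    have h1 := congrArg (fun p => Polynomial.coeff p (i + 1)) (congrFun hz k)
    simp only [Matrix.mulVec, dotProduct, Pi.zero_apply, Polynomial.finsetSum_coeff, Me,
      Matrix.of_apply, Polynomial.coeff_zero] at h1
    simp only [Matrix.mulVec, dotProduct, Pi.zero_apply, Pi.add_apply]
    rw [← Finset.sum_add_distrib, ← h1]
    apply Finset.sum_congr rfl
    intro l _
    rw [add_mul, Polynomial.coeff_add, Polynomial.coeff_C_mul, mul_assoc, Polynomial.coeff_X_mul,
      Polynomial.coeff_C_mul]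

lemma aux_obs {S : Type*} [CommRing S] [IsDomain S] {m : ℕ}
    (A : Matrix (Fin (m + 2)) (Fin (m + 2)) S) (u v : Fin (m + 2) → S) (H : S)
    (hA : ∀ j, ∑ i, v i * A i j = H * u j) (hdet : A.det ≠ 0) (hv1 : v 1 ≠ 0)
    (hcop : ∀ c d, c * v 0 = d * v 1 → ∃ k, c = k * v 1 ∧ d = k * v 0)
    (D : Matrix (Fin (m + 1)) (Fin (m + 2)) S) (a : ℕ) (y : ℕ → Fin (m + 2) → S)
    (hy : ∀ i < a, (auxM A u).mulVec (y (i + 1)) + D.mulVec (y i) = 0)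
    (hy0 : (auxM A u).mulVec (y 0) = 0) :
    ∃ z, A.det ^ (a + 1) • ((auxM A u).mulVec (y (a + 1)) + D.mulVec (y a)) =
      (auxM A u).mulVec z := by
  set M := auxM A u with hM
  have hMu : ∀ z, M.mulVec z = 0 → ∑ j, u j * z j = 0 := by
    intro z hz
    have := congrFun hz 0
    simpa [hM, auxM, Matrix.mulVec, dotProduct] using this
  have hMA : ∀ z, M.mulVec z = 0 → ∀ k : Fin m, A.mulVec z k.succ.succ = 0 := by
    intro z hz k
    have := congrFun hz k.succ
    simpa [hM, auxM, Matrix.mulVec, dotProduct] using this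
  have hker : ∀ z, M.mulVec z = 0 → ∃ κ, A.mulVec z 0 = κ * v 1 ∧ A.mulVec z 1 = - (κ * v 0) := by
    intro z hz
    have h1 : ∑ i, v i * A.mulVec z i = 0 := by
      calc ∑ i, v i * A.mulVec z i = ∑ j, (∑ i, v i * A i j) * z j := by
            simp only [Matrix.mulVec, dotProduct, Finset.mul_sum, Finset.sum_mul]
            rw [Finset.sum_comm]
            simp only [mul_assoc]
        _ = H * ∑ j, u j * z j := by
            rw [Finset.mul_sum]; simp only [hA, mul_assoc]
        _ = 0 := by rw [hMu z hz, mul_zero]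
    rw [Fin.sum_univ_succ, Fin.sum_univ_succ] at h1
    simp only [hMA z hz, mul_zero, Finset.sum_const_zero, add_zero] at h1
    obtain ⟨k, hk, hk'⟩ := hcop (A.mulVec z 0) (- A.mulVec z 1) (by
      simp only [Fin.succ_zero_eq_one] at h1
      linear_combination h1)
    exact ⟨k, hk, by rw [← hk', neg_neg]⟩
  have hprop : ∀ z z' κ κ', M.mulVec z = 0 → M.mulVec z' = 0 →
      A.mulVec z 0 = κ * v 1 → A.mulVec z 1 = - (κ * v 0) →
      A.mulVec z' 0 = κ' * v 1 → A.mulVec z' 1 = - (κ' * v 0) → κ' • z = κ • z' := by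
    intro z z' κ κ' hz hz' h0 h1 h0' h1'
    rw [← sub_eq_zero]
    apply Matrix.eq_zero_of_mulVec_eq_zero hdet
    rw [Matrix.mulVec_sub, Matrix.mulVec_smul, Matrix.mulVec_smul]
    funext i
    refine Fin.cases ?_ (fun i => Fin.cases ?_ (fun i => ?_) i) i
    · simp [h0, h0']; ring
    · simp [h1, h1']; ring
    · simp [hMA z hz, hMA z' hz']
  obtain ⟨mm, hm0, hmm⟩ := aux_seq M D
  have hMm : M.mulVec (mm 0) = 0 := by rw [hm0]; exact aux_minor_zero M
  obtain ⟨κ0, hκ0, hκ1⟩ := hker _ hMm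
  have hR : A.det = H * κ0 := by
    apply mul_left_cancel₀ hv1
    have e1 := Matrix.det_updateRow_sum A 1 v
    have e2 : (∑ k, v k • A k) = H • u := by
      funext j
      simpa [Finset.sum_apply] using hA j
    rw [e2, Matrix.det_updateRow_smul] at e1
    have e3 : (A.updateRow 1 u).det = κ0 * v 1 := by
      rw [← hκ0, hm0]
      have := aux_minor M (A 0)
      simp only [Matrix.mulVec, dotProduct]
      rw [this]
      congr 1
      ext i j
      refine Fin.cases ?_ (fun i => Fin.cases ?_ (fun i => ?_) i) i
      · rw [Matrix.updateRow_ne (by simp)]; simp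
      · rw [Fin.succ_zero_eq_one, Matrix.updateRow_self, ← Fin.succ_zero_eq_one]
        simp [hM, auxM]
      · rw [Matrix.updateRow_ne (by
          rw [← Fin.succ_zero_eq_one]; intro h
          exact Fin.succ_ne_zero i (Fin.succ_injective _ h))]
        simp [hM, auxM]
    rw [e3] at e1
    simp only [smul_eq_mul] at e1
    linear_combination -e1
  have key : ∀ (a : ℕ) (y : ℕ → Fin (m + 2) → S)
      (_ : ∀ i < a, M.mulVec (y (i + 1)) + D.mulVec (y i) = 0) (_ : M.mulVec (y 0) = 0),
      ∃ z, κ0 ^ (a + 1) • (M.mulVec (y (a + 1)) + D.mulVec (y a)) = M.mulVec z := by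
    intro a
    induction a with
    | zero =>
      intro y _ hy0
      obtain ⟨κ, hk0, hk1⟩ := hker _ hy0
      have hp := hprop _ _ κ κ0 hy0 hMm hk0 hk1 hκ0 hκ1
      refine ⟨κ0 • y 1 - κ • mm 1, ?_⟩
      have h2 := eq_neg_of_add_eq_zero_left (hmm 0)
      rw [Matrix.mulVec_sub, Matrix.mulVec_smul, Matrix.mulVec_smul, zero_add, pow_one, smul_add,
        ← Matrix.mulVec_smul D, hp, Matrix.mulVec_smul]
      rw [zero_add] at h2
      rw [h2]; simp
    | succ a ih =>
      intro y hy hy0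
      obtain ⟨κ, hk0, hk1⟩ := hker _ hy0
      have hp := hprop _ _ κ κ0 hy0 hMm hk0 hk1 hκ0 hκ1
      have hst : ∀ i, M.mulVec (κ0 • y (i + 1 + 1) - κ • mm (i + 1 + 1)) +
          D.mulVec (κ0 • y (i + 1) - κ • mm (i + 1)) =
          κ0 • (M.mulVec (y (i + 1 + 1)) + D.mulVec (y (i + 1))) := by
        intro i
        have h2 := hmm (i + 1)
        have : κ0 • (M.mulVec (y (i + 1 + 1)) + D.mulVec (y (i + 1))) =
          κ0 • (M.mulVec (y (i + 1 + 1)) + D.mulVec (y (i + 1))) -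
            κ • (M.mulVec (mm (i + 1 + 1)) + D.mulVec (mm (i + 1))) := by
          rw [h2]; simp
        rw [this]
        simp only [Matrix.mulVec_sub, Matrix.mulVec_smul, smul_add]
        abel
      obtain ⟨z, hz⟩ := ih (fun i => κ0 • y (i + 1) - κ • mm (i + 1)) (by
        intro i hi
        rw [hst, hy (i + 1) (by omega), smul_zero]) (by
        have h1 := eq_neg_of_add_eq_zero_left (hmm 0)
        have h2 := eq_neg_of_add_eq_zero_left (hy 0 (by omega))
        rw [Matrix.mulVec_sub, Matrix.mulVec_smul, Matrix.mulVec_smul, h1, h2, smul_neg, smul_neg,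
          ← Matrix.mulVec_smul, ← Matrix.mulVec_smul, hp, sub_self])
      refine ⟨z, ?_⟩
      rw [← hz, hst, smul_smul, pow_succ]
  obtain ⟨z, hz⟩ := key a y hy hy0
  refine ⟨H ^ (a + 1) • z, ?_⟩
  rw [Matrix.mulVec_smul, ← hz, smul_smul, hR, mul_pow]

/-- row degrees -/
def auxδ (m s t : ℕ) : Fin (m + 1) → ℕ := Fin.cons s (fun _ => t)

/-- The graded linear map of a matrix. -/
noncomputable def auxT {m j : ℕ} (δ : Fin (m + 1) → ℕ)
    (Q : Matrix (Fin (m + 1)) (Fin (m + 2)) (MvPolynomial (Fin 3) ℂ))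
    (hQ : ∀ k l, (Q k l).IsHomogeneous (δ k)) :
    (Fin (m + 2) → homogeneousSubmodule (Fin 3) ℂ j) →ₗ[ℂ]
      (∀ k, homogeneousSubmodule (Fin 3) ℂ (j + δ k)) where
  toFun y k := ⟨Q.mulVec (fun l => (y l : MvPolynomial (Fin 3) ℂ)) k, by
    rw [mem_homogeneousSubmodule]
    apply IsHomogeneous.sum
    intro l _
    have := (hQ k l).mul ((mem_homogeneousSubmodule _ _).1 (y l).2)
    rwa [add_comm] at this⟩
  map_add' y z := by
    funext k
    ext1
    simp [Matrix.mulVec, dotProduct, mul_add, Finset.sum_add_distrib]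
  map_smul' c y := by
    funext k
    ext1
    simp [Matrix.mulVec, dotProduct, Finset.smul_sum]

lemma auxT_apply {m j : ℕ} (δ : Fin (m + 1) → ℕ)
    (Q : Matrix (Fin (m + 1)) (Fin (m + 2)) (MvPolynomial (Fin 3) ℂ))
    (hQ : ∀ k l, (Q k l).IsHomogeneous (δ k))
    (y : Fin (m + 2) → homogeneousSubmodule (Fin 3) ℂ j) (k) :
    (auxT δ Q hQ y k : MvPolynomial (Fin 3) ℂ) =
      Q.mulVec (fun l => (y l : MvPolynomial (Fin 3) ℂ)) k := rfl

/-- the bidiagonal matrix -/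
noncomputable def auxD {m : ℕ} (δ : Fin (m + 1) → ℕ) :
    Matrix (Fin (m + 1)) (Fin (m + 2)) (MvPolynomial (Fin 3) ℂ) :=
  Matrix.of fun k l => if l = k.castSucc then X 0 ^ δ k else if l = k.succ then X 1 ^ δ k else 0

lemma auxD_hom {m : ℕ} (δ : Fin (m + 1) → ℕ) (k l) : (auxD δ k l).IsHomogeneous (δ k) := by
  simp only [auxD, Matrix.of_apply]
  split_ifs
  · exact isHomogeneous_X_pow _ _
  · exact isHomogeneous_X_pow _ _
  · exact isHomogeneous_zero _ _ _

lemma auxD_mulVec {m : ℕ} (δ : Fin (m + 1) → ℕ) (y : Fin (m + 2) → MvPolynomial (Fin 3) ℂ) (k) :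
    (auxD δ).mulVec y k = X 0 ^ δ k * y k.castSucc + X 1 ^ δ k * y k.succ := by
  have h : ∀ l, auxD δ k l * y l = (if l = k.castSucc then X 0 ^ δ k * y l else 0) +
      (if l = k.succ then X 1 ^ δ k * y l else 0) := by
    intro l
    simp only [auxD, Matrix.of_apply]
    by_cases h1 : l = k.castSucc
    · have h2 : l ≠ k.succ := by
        rintro rfl
        have := congrArg Fin.val h1
        simp at this
      simp [h1]
      intro h3; exact absurd (h1.trans h3) h2
    · simp [h1]
  simp only [Matrix.mulVec, dotProduct, h, Finset.sum_add_distrib, Finset.sum_ite_eq',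
    Finset.mem_univ, if_true]

lemma aux_kerD_rel {m s t : ℕ} (y : Fin (m + 2) → MvPolynomial (Fin 3) ℂ)
    (hy : (auxD (auxδ m s t)).mulVec y = 0) (l : Fin (m + 1)) :
      X 0 ^ (s + l * t) * y 0 = (-1) ^ ((l : ℕ) + 1) * X 1 ^ (s + l * t) * y l.succ := by
  have h : ∀ k, X 0 ^ auxδ m s t k * y k.castSucc + X 1 ^ auxδ m s t k * y k.succ = 0 := by
    intro k; rw [← auxD_mulVec, hy]; rfl
  induction l using Fin.induction with
  | zero =>
    have := h 0
    simp [auxδ] at this ⊢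
    linear_combination this
  | succ i ih =>
    have := h i.succ
    simp [auxδ] at this ih ⊢
    rw [show s + ((i : ℕ) + 1) * t = (s + i * t) + t by ring, pow_add, pow_add (X 1)]
    linear_combination X 0 ^ t * ih + (-1) ^ ((i : ℕ) + 1) * X 1 ^ (s + (i : ℕ) * t) * this

lemma aux_kerD {m s t j : ℕ} (hj : s + m * t ≤ j) :
    Module.finrank ℂ (LinearMap.ker (auxT (j := j) (auxδ m s t) (auxD (auxδ m s t)) (auxD_hom _))) ≤
      Module.finrank ℂ (homogeneousSubmodule (Fin 3) ℂ (j - (s + m * t))) := by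
  set T := auxT (j := j) (auxδ m s t) (auxD (auxδ m s t)) (auxD_hom _) with hT
  set e := s + m * t with he
  have hX : ∀ i : Fin 3, (X i : MvPolynomial (Fin 3) ℂ) ≠ 0 := fun i => X_ne_zero i
  have hker : ∀ y ∈ LinearMap.ker T,
      (auxD (auxδ m s t)).mulVec (fun l => (y l : MvPolynomial (Fin 3) ℂ)) = 0 := by
    intro y hy
    funext k
    have := congrFun (LinearMap.mem_ker.1 hy) k
    rw [← auxT_apply (auxδ m s t) _ (auxD_hom _) y k]
    rw [← hT, this]; rfl
  let P : LinearMap.ker T →ₗ[ℂ] MvPolynomial (Fin 3) ℂ :=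
    (Submodule.subtype _).comp ((LinearMap.proj 0).comp (Submodule.subtype _))
  have hPv : ∀ y, P y = (y.1 0 : MvPolynomial (Fin 3) ℂ) := fun y => rfl
  let Q : homogeneousSubmodule (Fin 3) ℂ (j - e) →ₗ[ℂ] MvPolynomial (Fin 3) ℂ :=
    (LinearMap.mulRight ℂ (X 1 ^ e)).comp (Submodule.subtype _)
  have hP0 : ∀ y, P y = 0 → y = 0 := by
    intro y hy
    rw [hPv] at hy
    ext1
    funext l
    ext1
    refine Fin.cases ?_ (fun l => ?_) l
    · simpa using hy
    · have h1 := aux_kerD_rel _ (hker y.1 y.2) l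
      simp only [hy, mul_zero] at h1
      have h2 : (-1 : MvPolynomial (Fin 3) ℂ) ^ ((l : ℕ) + 1) * X 1 ^ (s + (l : ℕ) * t) ≠ 0 :=
        mul_ne_zero (pow_ne_zero _ (neg_ne_zero.2 one_ne_zero)) (pow_ne_zero _ (hX 1))
      simpa using (mul_eq_zero.1 h1.symm).resolve_left h2
  have hPinj : Function.Injective P := by
    intro y z hyz
    have h1 : P (y - z) = P y - P z := rfl
    rw [hyz, sub_self] at h1
    exact sub_eq_zero.1 (hP0 _ h1)
  have hle : LinearMap.range P ≤ LinearMap.range Q := by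
    rintro _ ⟨y, rfl⟩
    rw [hPv]
    have h1 := aux_kerD_rel _ (hker y.1 y.2) (Fin.last m)
    have h2 : (X 1 : MvPolynomial (Fin 3) ℂ) ^ e ∣ y.1 0 := by
      apply Prime.pow_dvd_of_dvd_mul_left (MvPolynomial.X_prime) e (a := X 0 ^ e)
      · intro hd
        have := (MvPolynomial.X_prime (R := ℂ) (i := (1 : Fin 3))).dvd_of_dvd_pow hd
        rw [MvPolynomial.X_dvd_X] at this
        simp_all
      · refine ⟨(-1) ^ (m + 1) * y.1 (Fin.last m).succ, ?_⟩
        simp only [Fin.val_last] at h1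
        rw [h1]; ring
    obtain ⟨g, hg⟩ := h2
    refine ⟨⟨homogeneousComponent (j - e) g, ?_⟩, ?_⟩
    · rw [mem_homogeneousSubmodule]; exact homogeneousComponent_isHomogeneous _ _
    · change homogeneousComponent (j - e) g * X 1 ^ e = _
      rw [← aux_hc_mul (isHomogeneous_X_pow _ _), mul_comm, ← hg, Nat.sub_add_cancel hj]
      rw [homogeneousComponent_of_mem (y.1 0).2, if_pos rfl]
  calc Module.finrank ℂ (LinearMap.ker T) = Module.finrank ℂ (LinearMap.range P) :=
        (LinearMap.finrank_range_of_inj hPinj).symm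
    _ ≤ Module.finrank ℂ (LinearMap.range Q) := Submodule.finrank_mono hle
    _ ≤ _ := LinearMap.finrank_range_le Q


lemma aux_lin {E W Q : Type*} [AddCommGroup E] [Module ℂ E] [FiniteDimensional ℂ E]
    [AddCommGroup W] [Module ℂ W] [FiniteDimensional ℂ W] [AddCommGroup Q] [Module ℂ Q]
    (Θ : W →ₗ[ℂ] Q) (Λ : E →ₗ[ℂ] Q) (h : LinearMap.range Λ ≤ LinearMap.range Θ) :
    Module.finrank ℂ E + Module.finrank ℂ (LinearMap.ker Θ) ≤
      Module.finrank ℂ W + Module.finrank ℂ (LinearMap.ker Λ) := by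
  have h1 := LinearMap.finrank_range_add_finrank_ker Θ
  have h2 := LinearMap.finrank_range_add_finrank_ker Λ
  have h3 := Submodule.finrank_mono h
  omega

/-- the ideal `(a,b)` as a `ℂ`-subspace -/
noncomputable def auxI (a b : MvPolynomial (Fin 3) ℂ) : Submodule ℂ (MvPolynomial (Fin 3) ℂ) :=
  (Ideal.span {a, b}).restrictScalars ℂ

lemma aux_mem_auxI {a b x : MvPolynomial (Fin 3) ℂ} : x ∈ auxI a b ↔ x ∈ Ideal.span {a, b} :=
  Iff.rfl

lemma aux_IJ {w J : ℕ} {v0 v1 : MvPolynomial (Fin 3) ℂ} (h0 : v0.IsHomogeneous w)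
    (h1 : v1.IsHomogeneous w) (hv1 : v1 ≠ 0) (hJ : 2 * w ≤ J)
    (Λ : homogeneousSubmodule (Fin 3) ℂ J →ₗ[ℂ] (MvPolynomial (Fin 3) ℂ ⧸ auxI v0 v1))
    (hΛ : Λ = (auxI v0 v1).mkQ.comp (Submodule.subtype _)) :
    Module.finrank ℂ (LinearMap.ker Λ) +
      Module.finrank ℂ (homogeneousSubmodule (Fin 3) ℂ (J - 2 * w)) ≤
      2 * Module.finrank ℂ (homogeneousSubmodule (Fin 3) ℂ (J - w)) := by
  let E := homogeneousSubmodule (Fin 3) ℂ (J - w)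
  let Ψ : (E × E) →ₗ[ℂ] MvPolynomial (Fin 3) ℂ :=
    LinearMap.coprod ((LinearMap.mulRight ℂ v0).comp (Submodule.subtype _))
      ((LinearMap.mulRight ℂ v1).comp (Submodule.subtype _))
  have hΨ : ∀ p : E × E, Ψ p = (p.1 : MvPolynomial (Fin 3) ℂ) * v0 + p.2 * v1 := fun p => rfl
  have hrange : Module.finrank ℂ (LinearMap.ker Λ) ≤ Module.finrank ℂ (LinearMap.range Ψ) := by
    rw [← Submodule.finrank_map_subtype_eq]
    apply Submodule.finrank_mono
    rintro _ ⟨f, hf, rfl⟩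
    have hf' : Λ f = 0 := hf
    rw [hΛ] at hf'
    have hf2 : (f : MvPolynomial (Fin 3) ℂ) ∈ auxI v0 v1 := by
      simpa using hf'
    obtain ⟨c, d, hcd⟩ := Ideal.mem_span_pair.1 (aux_mem_auxI.1 hf2)
    refine ⟨(⟨homogeneousComponent (J - w) c, ?_⟩, ⟨homogeneousComponent (J - w) d, ?_⟩), ?_⟩
    · rw [mem_homogeneousSubmodule]; exact homogeneousComponent_isHomogeneous _ _
    · rw [mem_homogeneousSubmodule]; exact homogeneousComponent_isHomogeneous _ _
    · rw [hΨ]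
      change homogeneousComponent (J - w) c * v0 + homogeneousComponent (J - w) d * v1 = f
      rw [← aux_hc_mul h0, ← aux_hc_mul h1, ← map_add, hcd, Nat.sub_add_cancel (by omega)]
      rw [homogeneousComponent_of_mem f.2, if_pos rfl]
  let κ : homogeneousSubmodule (Fin 3) ℂ (J - 2 * w) →ₗ[ℂ] LinearMap.ker Ψ :=
    { toFun := fun g => ⟨(⟨g * v1, by
          have := ((mem_homogeneousSubmodule _ _).1 g.2).mul h1
          rw [mem_homogeneousSubmodule]
          rwa [show J - 2 * w + w = J - w by omega] at this⟩, ⟨- (g * v0), by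
          have := (((mem_homogeneousSubmodule _ _).1 g.2).mul h0).neg
          rw [mem_homogeneousSubmodule]
          rwa [show J - 2 * w + w = J - w by omega] at this⟩), by
            rw [LinearMap.mem_ker, hΨ]
            change (g : MvPolynomial (Fin 3) ℂ) * v1 * v0 + - (g * v0) * v1 = 0
            ring⟩
      map_add' := by
        intro x y
        ext1
        apply Prod.ext <;> ext1
        · simp [add_mul]
        · simp [add_mul]; ring
      map_smul' := by
        intro c x
        ext1
        apply Prod.ext <;> ext1 <;> simp }
  have hκ : Function.Injective κ := by
    intro x y hxy
    have h3 : (x : MvPolynomial (Fin 3) ℂ) * v1 = y * v1 :=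
      congrArg (fun z : LinearMap.ker Ψ => ((z : E × E).1 : MvPolynomial (Fin 3) ℂ)) hxy
    ext1
    exact mul_right_cancel₀ hv1 h3
  have h4 := LinearMap.finrank_le_finrank_of_injective hκ
  have h5 := LinearMap.finrank_range_add_finrank_ker Ψ
  rw [Module.finrank_prod] at h5
  change _ = Module.finrank ℂ (homogeneousSubmodule (Fin 3) ℂ (J - w)) + Module.finrank ℂ (homogeneousSubmodule (Fin 3) ℂ (J - w)) at h5
  omega

lemma aux_count {m s t w b : ℕ}
    (A : Matrix (Fin (m + 2)) (Fin (m + 2)) (MvPolynomial (Fin 3) ℂ))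
    (u v : Fin (m + 2) → MvPolynomial (Fin 3) ℂ) (H : MvPolynomial (Fin 3) ℂ)
    (hAh : ∀ i j, (A i j).IsHomogeneous t) (huh : ∀ i, (u i).IsHomogeneous s)
    (hvh : ∀ i, (v i).IsHomogeneous w)
    (hA : ∀ j, ∑ i, v i * A i j = H * u j) (hdet : A.det ≠ 0) (hv1 : v 1 ≠ 0)
    (hcop : ∀ c d, c * v 0 = d * v 1 → ∃ k, c = k * v 1 ∧ d = k * v 0)
    (hreg : ∀ x, A.det * x ∈ Ideal.span {v 0, v 1} → x ∈ Ideal.span {v 0, v 1})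
    (hb : idealOfVars (Fin 3) ℂ ^ b ≤ Ideal.span (Set.range v)) :
    2 * w ^ 2 ≤ 2 * s ^ 2 + 2 * (m * s * t) + m * (m + 1) * t ^ 2 := by
  obtain ⟨j, hj⟩ : ∃ j, j = b + (s + m * t) + 2 * w := ⟨_, rfl⟩
  set δ := auxδ m s t with hδ
  have hδ0 : δ 0 = s := rfl
  have hδs : ∀ k : Fin m, δ k.succ = t := fun k => rfl
  have hMh : ∀ k l, (auxM A u k l).IsHomogeneous (δ k) := by
    intro k l
    refine Fin.cases ?_ (fun k => ?_) k
    · exact huh l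
    · exact hAh _ _
  let φ : Fin (m + 1) → MvPolynomial (Fin 3) ℂ := Fin.cons H (fun k => - v k.succ.succ)
  let J := j + w + t
  let W := ∀ k, homogeneousSubmodule (Fin 3) ℂ (j + δ k)
  let Φ : W →ₗ[ℂ] MvPolynomial (Fin 3) ℂ :=
    { toFun := fun x => ∑ k, φ k * (x k : MvPolynomial (Fin 3) ℂ)
      map_add' := by
        intro x y
        have h : ∀ k, ((x + y) k : MvPolynomial (Fin 3) ℂ) = x k + y k := fun k => rfl
        simp only [h, mul_add, Finset.sum_add_distrib]
      map_smul' := by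
        intro c x
        have h : ∀ k, ((c • x) k : MvPolynomial (Fin 3) ℂ) = c • (x k : MvPolynomial (Fin 3) ℂ) :=
          fun k => rfl
        simp only [h, mul_smul_comm, Finset.smul_sum, RingHom.id_apply] }
  have hΦ : ∀ x : W, Φ x = ∑ k, φ k * (x k : MvPolynomial (Fin 3) ℂ) := fun x => rfl
  have hφM : ∀ z : Fin (m + 2) → MvPolynomial (Fin 3) ℂ,
      ∑ k, φ k * (auxM A u).mulVec z k ∈ Ideal.span {v 0, v 1} := by
    intro z
    rw [Ideal.mem_span_pair]
    refine ⟨A.mulVec z 0, A.mulVec z 1, ?_⟩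
    have h1 : ∑ i, v i * A.mulVec z i = H * ∑ j, u j * z j := by
      calc ∑ i, v i * A.mulVec z i = ∑ j, (∑ i, v i * A i j) * z j := by
            simp only [Matrix.mulVec, dotProduct, Finset.mul_sum, Finset.sum_mul]
            rw [Finset.sum_comm]
            simp only [mul_assoc]
        _ = H * ∑ j, u j * z j := by
            rw [Finset.mul_sum]; simp only [hA, mul_assoc]
    rw [Fin.sum_univ_succ, Fin.sum_univ_succ] at h1
    rw [Fin.sum_univ_succ]
    have h2 : (auxM A u).mulVec z 0 = ∑ j, u j * z j := rfl
    have h3 : ∀ k : Fin m, (auxM A u).mulVec z k.succ = A.mulVec z k.succ.succ := fun k => rfl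
    simp only [φ, Fin.cons_zero, Fin.cons_succ, h2, h3, neg_mul, Finset.sum_neg_distrib]
    simp only [Fin.succ_zero_eq_one] at h1
    linear_combination h1
  have hregp : ∀ (a : ℕ) x, A.det ^ a * x ∈ Ideal.span {v 0, v 1} → x ∈ Ideal.span {v 0, v 1} := by
    intro a
    induction a with
    | zero => intro x hx; simpa using hx
    | succ a ih =>
      intro x hx
      apply ih; apply hreg
      rwa [← mul_assoc, ← pow_succ']
  let Θ : W →ₗ[ℂ] (MvPolynomial (Fin 3) ℂ ⧸ auxI (v 0) (v 1)) := (auxI (v 0) (v 1)).mkQ.comp Φ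
  have hΘ : ∀ x, x ∈ LinearMap.ker Θ ↔ Φ x ∈ Ideal.span {v 0, v 1} := by
    intro x
    rw [LinearMap.mem_ker]
    simp only [Θ, LinearMap.comp_apply, Submodule.mkQ_apply, Submodule.Quotient.mk_eq_zero]
    rfl
  have hlim := aux_limit (auxT (j := j) δ (auxM A u) hMh) (auxT (j := j) δ (auxD δ) (auxD_hom δ))
    (LinearMap.ker Θ) (by
      intro a y hy hy0
      rw [hΘ, hΦ]
      obtain ⟨z, hz⟩ := aux_obs A u v H hA hdet hv1 hcop (auxD δ) a
        (fun i l => (y i l : MvPolynomial (Fin 3) ℂ))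
        (fun i hi => by
          funext k
          exact congrArg (fun x : W => (x k : MvPolynomial (Fin 3) ℂ)) (hy i hi))
        (by
          funext k
          exact congrArg (fun x : W => (x k : MvPolynomial (Fin 3) ℂ)) hy0)
      apply hregp (a + 1)
      have h1 := hφM z
      rw [← hz] at h1
      convert h1 using 1
      rw [Finset.mul_sum]
      apply Finset.sum_congr rfl
      intro k _
      simp only [Pi.smul_apply, smul_eq_mul, Pi.add_apply, Submodule.coe_add, auxT_apply]
      ring) (by
      intro y
      rw [hΘ, hΦ]
      exact hφM _)
  have hker := aux_kerD (m := m) (s := s) (t := t) (j := j) (by omega)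
  have hrn := LinearMap.finrank_range_add_finrank_ker (auxT (j := j) δ (auxD δ) (auxD_hom δ))
  let Λ : homogeneousSubmodule (Fin 3) ℂ J →ₗ[ℂ] (MvPolynomial (Fin 3) ℂ ⧸ auxI (v 0) (v 1)) :=
    (auxI (v 0) (v 1)).mkQ.comp (Submodule.subtype _)
  have hIJ := aux_IJ (hvh 0) (hvh 1) hv1 (J := J) (by omega) Λ rfl
  have hlin := aux_lin Θ Λ (by
    rintro _ ⟨f, rfl⟩
    obtain ⟨c, hc, hfc⟩ := aux_hspan (m := j + t) v hvh hb (by omega)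
      (f := (f : MvPolynomial (Fin 3) ℂ)) (by
        have := (mem_homogeneousSubmodule _ _).1 f.2
        have e : J = j + t + w := by omega
        rw [← e]
        exact this)
    let x : W := Fin.cons (α := fun k => homogeneousSubmodule (Fin 3) ℂ (j + δ k)) 0
      (fun k => ⟨- c k.succ.succ, (hc k.succ.succ).neg⟩)
    refine ⟨x, ?_⟩
    simp only [Θ, Λ, LinearMap.comp_apply, Submodule.mkQ_apply, Submodule.subtype_apply]
    rw [Submodule.Quotient.eq, aux_mem_auxI, Ideal.mem_span_pair]
    refine ⟨- c 0, - c 1, ?_⟩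
    rw [hΦ, hfc, Fin.sum_univ_succ, Fin.sum_univ_succ, Fin.sum_univ_succ]
    have h0 : (x 0 : MvPolynomial (Fin 3) ℂ) = 0 := rfl
    have h1 : ∀ k : Fin m, (x k.succ : MvPolynomial (Fin 3) ℂ) = - c k.succ.succ := fun k => rfl
    simp only [φ, Fin.cons_zero, Fin.cons_succ, h0, h1, neg_mul_neg, mul_zero, zero_add,
      Fin.succ_zero_eq_one]
    simp only [mul_comm (v _)]
    ring)
  have hW : Module.finrank ℂ W = (j + s + 2).choose 2 + m * (j + t + 2).choose 2 := by
    rw [Module.finrank_pi_fintype, Fin.sum_univ_succ]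
    simp only [aux_finrank, hδ0, hδs]
    simp
  rw [Module.finrank_pi_fintype] at hrn
  rw [hW] at hlin
  simp only [aux_finrank, Finset.sum_const, Finset.card_univ, Fintype.card_fin, smul_eq_mul] at *
  have hch : ∀ x : ℕ, 2 * ((x + 2).choose 2 : ℤ) = (x + 1) * (x + 2) := by
    intro x
    have := Nat.triangle_succ (x + 1)
    have h2 := Nat.choose_two_right (x + 2)
    have h3 : 2 ∣ (x + 2) * (x + 1) := by
      rw [mul_comm]; exact (Nat.even_mul_succ_self (x + 1)).two_dvd
    have h4 : 2 * (x + 2).choose 2 = (x + 2) * (x + 1) := by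
      rw [h2]; exact Nat.mul_div_cancel' h3
    have : (2 : ℤ) * ((x + 2).choose 2 : ℤ) = (x + 2) * (x + 1) := by exact_mod_cast h4
    rw [this]; ring
  have c1 := hch j
  have c2 := hch (j + s)
  have c3 := hch (j + t)
  have c4 := hch (j - (s + m * t))
  have c5 := hch J
  have c6 := hch (J - w)
  have c7 := hch (J - 2 * w)
  rw [Nat.cast_sub (by omega)] at c4
  rw [Nat.cast_sub (by omega)] at c6
  rw [Nat.cast_sub (by omega)] at c7
  push_cast [J] at c1 c2 c3 c4 c5 c6 c7
  zify at *
  push_cast [J] at *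
  nlinarith

lemma aux_X_mem {ι : Type*} {b : ℕ} {v : ι → MvPolynomial (Fin 3) ℂ}
    (hb : idealOfVars (Fin 3) ℂ ^ b ≤ Ideal.span (Set.range v))
    {p : Ideal (MvPolynomial (Fin 3) ℂ)} (hp : p.IsPrime) (h : ∀ i, v i ∈ p) (i : Fin 3) :
    X i ∈ p := by
  apply hp.mem_of_pow_mem b
  have h1 : Ideal.span (Set.range v) ≤ p := by
    rw [Ideal.span_le]; rintro _ ⟨j, rfl⟩; exact h j
  exact h1 (hb (aux_mem_pow_vars le_rfl (isHomogeneous_X_pow _ _)))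

lemma aux_not_all {ι : Type*} {b : ℕ} {v : ι → MvPolynomial (Fin 3) ℂ}
    (hb : idealOfVars (Fin 3) ℂ ^ b ≤ Ideal.span (Set.range v))
    {π : MvPolynomial (Fin 3) ℂ} (hp : Prime π) (h : ∀ i, v i ∈ Ideal.span {π}) : False := by
  have hp' : (Ideal.span {π}).IsPrime := (Ideal.span_singleton_prime hp.ne_zero).2 hp
  have h0 := Ideal.mem_span_singleton.1 (aux_X_mem hb hp' h 0)
  have h1 := Ideal.mem_span_singleton.1 (aux_X_mem hb hp' h 1)
  have h2 := (hp.irreducible.dvd_irreducible_iff_associated (X_prime.irreducible)).1 h0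
  have h3 : (X 0 : MvPolynomial (Fin 3) ℂ) ∣ X 1 := h2.symm.dvd.trans h1
  rw [X_dvd_X] at h3
  simp_all

lemma aux_relprime {f g : MvPolynomial (Fin 3) ℂ} (hf : f ≠ 0) (hg : g ≠ 0)
    (h : ∀ π ∈ UniqueFactorizationMonoid.factors g, f ∉ Ideal.span {π}) :
    ∀ c d, c * f = d * g → ∃ k, c = k * g ∧ d = k * f := by
  intro c d hcd
  have h1 : f ∣ d := by
    apply UniqueFactorizationMonoid.dvd_of_dvd_mul_left_of_no_prime_factors (c := g) hf
    · intro π hπf hπg hπ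
      obtain ⟨π', hπ', ha⟩ := UniqueFactorizationMonoid.exists_mem_factors_of_dvd hg
        hπ.irreducible hπg
      exact h π' hπ' (Ideal.mem_span_singleton.2 (ha.symm.dvd.trans hπf))
    · exact ⟨c, by rw [← hcd, mul_comm]⟩
  obtain ⟨k, hk⟩ := h1
  refine ⟨k, ?_, by rw [hk, mul_comm]⟩
  apply mul_right_cancel₀ hf
  rw [hcd, hk]; ring

lemma aux_core {m s t w b : ℕ}
    (A : Matrix (Fin (m + 2)) (Fin (m + 2)) (MvPolynomial (Fin 3) ℂ))
    (u v : Fin (m + 2) → MvPolynomial (Fin 3) ℂ) (H : MvPolynomial (Fin 3) ℂ)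
    (hAh : ∀ i j, (A i j).IsHomogeneous t) (huh : ∀ i, (u i).IsHomogeneous s)
    (hvh : ∀ i, (v i).IsHomogeneous w) (hw : 1 ≤ w)
    (hA : ∀ j, ∑ i, v i * A i j = H * u j) (hdet : A.det ≠ 0)
    (hb : idealOfVars (Fin 3) ℂ ^ b ≤ Ideal.span (Set.range v)) :
    2 * w ^ 2 ≤ 2 * s ^ 2 + 2 * (m * s * t) + m * (m + 1) * t ^ 2 := by
  classical
  set R := A.det with hR
  have hsingle : ∀ i : Fin (m + 2), ∑ j, C ((Pi.single i (1 : ℂ) : Fin (m + 2) → ℂ) j) * v j = v i := by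
    intro i
    rw [Finset.sum_eq_single i]
    · simp
    · intro j _ hj; simp [Pi.single_apply, hj]
    · simp
  -- first choice
  obtain ⟨a, -, ha0, ha⟩ := aux_avoid v ⊤
    ((fun π => Ideal.span {π}) '' {π | π ∈ UniqueFactorizationMonoid.factors R} ∪ {⊥})
    ((((UniqueFactorizationMonoid.factors R).toFinset.finite_toSet.subset
      (by intro π hπ; simpa using hπ)).image _).union (Set.finite_singleton _)) (by
      intro p hp
      by_contra hcon
      push Not at hcon
      have hall : ∀ i, v i ∈ p := fun i => by
        rw [← hsingle i]; exact hcon _ trivial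
      rcases hp with ⟨π, hπ, rfl⟩ | hp
      · exact aux_not_all hb (UniqueFactorizationMonoid.prime_of_factor π hπ) hall
      · have hp' : p = ⊥ := hp
        subst hp'
        have := aux_X_mem hb Ideal.isPrime_bot hall 0
        exact X_ne_zero (R := ℂ) (0 : Fin 3) (by simpa using this))
    0 ⟨Pi.single 0 1, trivial, by simp⟩
  set va := ∑ i, C (a i) * v i with hva
  have hva0 : va ≠ 0 := fun h => ha ⊥ (Or.inr rfl) (by rw [h]; exact Ideal.zero_mem _)
  have hcop1 := aux_relprime hva0 hdet (fun π hπ => ha _ (Or.inl ⟨π, hπ, rfl⟩))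
  -- second choice
  let U : Submodule ℂ (Fin (m + 2) → ℂ) := LinearMap.ker (LinearMap.proj 0)
  have hU : ∀ c, c ∈ U ↔ c 0 = 0 := fun c => Iff.rfl
  have hgen : ∀ p : Ideal (MvPolynomial (Fin 3) ℂ), va ∈ p →
      (∀ c ∈ U, ∑ i, C (c i) * v i ∈ p) → ∀ i, v i ∈ p := by
    intro p hp hc
    have h1 : ∀ i, i ≠ 0 → v i ∈ p := by
      intro i hi
      rw [← hsingle i]
      apply hc
      rw [hU]; simp [Pi.single_apply, hi.symm]
    have h0 : v 0 ∈ p := by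
      rw [hva, Fin.sum_univ_succ] at hp
      have h2 : ∑ i : Fin (m + 1), C (a i.succ) * v i.succ ∈ p :=
        Ideal.sum_mem _ fun i _ => Ideal.mul_mem_left _ _ (h1 _ (Fin.succ_ne_zero i))
      have h3 := (Ideal.add_mem_iff_left _ h2).1 hp
      have h4 := Ideal.mul_mem_left p (C (a 0)⁻¹) h3
      rwa [← mul_assoc, ← C_mul, inv_mul_cancel₀ ha0, C_1, one_mul] at h4
    intro i
    by_cases hi : i = 0
    · rw [hi]; exact h0
    · exact h1 i hi
  obtain ⟨c, hcU, hc1, hc⟩ := aux_avoid v U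
    ((fun π => Ideal.span {π}) '' {π | π ∈ UniqueFactorizationMonoid.factors va} ∪
      associatedPrimes (MvPolynomial (Fin 3) ℂ) (MvPolynomial (Fin 3) ℂ ⧸ Ideal.span {va, R}))
    ((((UniqueFactorizationMonoid.factors va).toFinset.finite_toSet.subset
      (by intro π hπ; simpa using hπ)).image _).union (associatedPrimes.finite _ _)) (by
      intro p hp
      by_contra hcon
      push Not at hcon
      rcases hp with ⟨π, hπ, rfl⟩ | hp
      · have hall := hgen _ (Ideal.mem_span_singleton.2
          (UniqueFactorizationMonoid.dvd_of_mem_factors hπ)) hcon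
        exact aux_not_all hb (UniqueFactorizationMonoid.prime_of_factor π hπ) hall
      · obtain ⟨hpp, x, hx⟩ := isAssociatedPrime_iff.1 hp
        obtain ⟨f, rfl⟩ := Ideal.Quotient.mk_surjective x
        have hmem : ∀ r, r ∈ p ↔ r * f ∈ Ideal.span {va, R} := by
          intro r
          rw [hx, Submodule.mem_colon]
          simp only [Set.mem_singleton_iff, forall_eq, Submodule.mem_bot]
          rw [← Ideal.Quotient.eq_zero_iff_mem, map_mul]
          rfl
        have hva' : va ∈ p := (hmem _).2 (Ideal.mul_mem_right _ _
          (Ideal.subset_span (by simp)))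
        have hall := hgen p hva' hcon
        have hX := aux_X_mem hb hpp hall
        have hf := aux_depth hva0 hdet hcop1 (fun i => (hmem _).1 (hX i))
        apply hpp.ne_top
        rw [Ideal.eq_top_iff_one, hmem, one_mul]
        exact hf)
    1 ⟨Pi.single 1 1, by rw [hU]; simp [Pi.single_apply], by simp⟩
  set vc := ∑ i, C (c i) * v i with hvc
  have hc0 : c 0 = 0 := (hU c).1 hcU
  have hvc0 : vc ≠ 0 := by
    intro h0
    by_cases hu : ∃ π, π ∈ UniqueFactorizationMonoid.factors va
    · obtain ⟨π, hπ⟩ := hu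
      exact hc _ (Or.inl ⟨π, hπ, rfl⟩) (by rw [h0]; exact Ideal.zero_mem _)
    · apply hu
      apply UniqueFactorizationMonoid.exists_mem_factors hva0
      intro hunit
      have hh : va.IsHomogeneous w := IsHomogeneous.sum _ _ _ fun k _ => by
        simpa using (isHomogeneous_C (Fin 3) (a k)).mul (hvh k)
      have h1 : constantCoeff va = 0 := by
        rw [constantCoeff_eq]
        apply hh.coeff_eq_zero
        simp; omega
      have h2 := hunit.map (constantCoeff (R := ℂ) (σ := Fin 3))
      rw [h1] at h2
      exact not_isUnit_zero h2
  have hcop : ∀ x y, x * va = y * vc → ∃ k, x = k * vc ∧ y = k * va := by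
    intro x y hxy
    obtain ⟨k, h1, h2⟩ := aux_relprime hvc0 hva0 (fun π hπ => hc _ (Or.inl ⟨π, hπ, rfl⟩)) y x hxy.symm
    exact ⟨k, h2, h1⟩
  have hreg0 : ∀ β, vc * β ∈ Ideal.span {va, R} → β ∈ Ideal.span {va, R} := by
    intro β hβ
    by_contra hn
    have h1 : vc ∈ {r | ∃ x : (MvPolynomial (Fin 3) ℂ ⧸ Ideal.span {va, R}), x ≠ 0 ∧ r • x = 0} := by
      refine ⟨Ideal.Quotient.mk _ β, ?_, ?_⟩
      · rwa [ne_eq, Ideal.Quotient.eq_zero_iff_mem]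
      · have := Ideal.Quotient.eq_zero_iff_mem.2 hβ
        rw [map_mul] at this
        exact this
    rw [← biUnion_associatedPrimes_eq_zero_divisors] at h1
    simp only [Set.mem_iUnion] at h1
    obtain ⟨p, hp, h2⟩ := h1
    exact hc p (Or.inr hp) h2
  have hreg : ∀ x, R * x ∈ Ideal.span {va, vc} → x ∈ Ideal.span {va, vc} := by
    intro x hx
    obtain ⟨α, β, h1⟩ := Ideal.mem_span_pair.1 hx
    obtain ⟨e, f, h2⟩ := Ideal.mem_span_pair.1 (hreg0 β
      (Ideal.mem_span_pair.2 ⟨-α, x, by linear_combination -h1⟩))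
    obtain ⟨k, h3, h4⟩ := hcop1 (α + e * vc) (x - f * vc) (by
      linear_combination h1 + vc * h2)
    exact Ideal.mem_span_pair.2 ⟨k, f, by linear_combination -h4⟩
  -- base change
  let B : Matrix (Fin (m + 2)) (Fin (m + 2)) ℂ :=
    Matrix.of fun i j => if i = 0 then a j else if i = 1 then c j else if i = j then 1 else 0
  have hBdet : IsUnit B.det := by
    rw [Matrix.det_of_isUpperTriangular (by
      intro i j hij
      have hij' : j < i := hij
      simp only [B, Matrix.of_apply]
      have hi0 : i ≠ 0 := by rintro rfl; exact absurd hij' (Fin.not_lt_zero _)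
      rw [if_neg hi0]
      split_ifs with h1 h2
      · subst h1
        have : j = 0 := by
          ext
          have := Fin.lt_def.1 hij'
          simp at this ⊢
          omega
        rw [this, hc0]
      · subst h2; exact absurd hij' (lt_irrefl _)
      · rfl)]
    rw [isUnit_iff_ne_zero, Finset.prod_ne_zero_iff]
    intro i _
    simp only [B, Matrix.of_apply, if_true]
    split_ifs with h1 h2
    · rw [h1]; exact ha0
    · rw [h2]; exact hc1
    · exact one_ne_zero
  let Bc : Matrix (Fin (m + 2)) (Fin (m + 2)) (MvPolynomial (Fin 3) ℂ) := B.map C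
  let Bi : Matrix (Fin (m + 2)) (Fin (m + 2)) (MvPolynomial (Fin 3) ℂ) := (B⁻¹).map C
  have hBB : Bi * Bc = 1 := by
    rw [← Matrix.map_mul, Matrix.nonsing_inv_mul _ hBdet]
    exact Matrix.map_one _ C_0 C_1
  have hBidet : Bi.det = C (B⁻¹).det := (RingHom.map_det C _).symm
  have hBi0 : (B⁻¹).det ≠ 0 := by
    rw [Matrix.det_nonsing_inv]
    simpa using hBdet.ne_zero
  have hv0' : Bc.mulVec v 0 = va := by
    simp [Bc, B, Matrix.mulVec, dotProduct, hva]
  have hv1' : Bc.mulVec v 1 = vc := by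
    simp [Bc, B, Matrix.mulVec, dotProduct, hvc]
  have hdet' : (Bi.transpose * A).det = C (B⁻¹).det * R := by
    rw [Matrix.det_mul, Matrix.det_transpose, hBidet]
  have hhomC : ∀ (z : ℂ) (f : MvPolynomial (Fin 3) ℂ) (k : ℕ), f.IsHomogeneous k →
      (C z * f).IsHomogeneous k := fun z f k hf => by
    simpa using (isHomogeneous_C (Fin 3) z).mul hf
  apply aux_count (b := b) (Bi.transpose * A) u (Bc.mulVec v) H
  · intro i j
    rw [Matrix.mul_apply]
    exact IsHomogeneous.sum _ _ _ fun k _ => hhomC _ _ _ (hAh _ _)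
  · exact huh
  · intro i
    exact IsHomogeneous.sum _ _ _ fun k _ => hhomC _ _ _ (hvh _)
  · intro j
    have h1 : ∑ i, Bc.mulVec v i * (Bi.transpose * A) i j =
        Matrix.vecMul (Bc.mulVec v) (Bi.transpose * A) j := rfl
    rw [h1, ← Matrix.vecMul_vecMul, Matrix.vecMul_transpose, Matrix.mulVec_mulVec, hBB,
      Matrix.one_mulVec]
    exact hA j
  · rw [hdet']
    exact mul_ne_zero (by simpa using hBi0) hdet
  · rw [hv1']; exact hvc0
  · rw [hv0', hv1']; exact hcop
  · rw [hv0', hv1', hdet']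
    intro x hx
    have h1 := hreg (C (B⁻¹).det * x) (by convert hx using 1; ring)
    have h2 := Ideal.mul_mem_left _ (C ((B⁻¹).det)⁻¹) h1
    rwa [← mul_assoc, ← C_mul, inv_mul_cancel₀ hBi0, C_1, one_mul] at h2
  · refine hb.trans ?_
    rw [Ideal.span_le]
    rintro _ ⟨i, rfl⟩
    have h1 : v i = Bi.mulVec (Bc.mulVec v) i := by
      rw [Matrix.mulVec_mulVec, hBB, Matrix.one_mulVec]
    rw [h1, SetLike.mem_coe]
    change ∑ k, Bi i k * Bc.mulVec v k ∈ _
    apply Ideal.sum_mem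
    intro k _
    apply Ideal.mul_mem_left
    apply Ideal.subset_span
    exact Set.mem_range_self k

lemma aux_chain {N : ℕ} (D : Derivation ℂ (MvPolynomial (Fin N) ℂ) (MvPolynomial (Fin N) ℂ))
    (F : Fin N → MvPolynomial (Fin N) ℂ) (g : MvPolynomial (Fin N) ℂ) :
    D (aeval F g) = ∑ i, aeval F (pderiv i g) * D (F i) := by
  induction g using MvPolynomial.induction_on with
  | C a =>
    simp [algebraMap_eq]
  | add p q hp hq => simp only [map_add, hp, hq, add_mul, Finset.sum_add_distrib]
  | mul_X p k hp =>
    simp only [map_mul, aeval_X, Derivation.leibniz, hp, smul_eq_mul, map_add, add_mul,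
      Finset.sum_add_distrib, pderiv_X]
    congr 1
    · rw [Finset.sum_eq_single k]
      · simp
      · intro b _ hb; simp [Pi.single_apply, hb]
      · simp
    · rw [Finset.mul_sum]
      apply Finset.sum_congr rfl
      intros; ring

lemma aux_integral {N q b : ℕ} (hq : 1 ≤ q) (F : Fin N → MvPolynomial (Fin N) ℂ)
    (hF : ∀ i, (F i).IsHomogeneous q)
    (hb : idealOfVars (Fin N) ℂ ^ b ≤ Ideal.span (Set.range F)) :
    Algebra.IsIntegral (aeval (R := ℂ) F).range (MvPolynomial (Fin N) ℂ) := by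
  let A0 := (aeval (R := ℂ) F).range
  let s : Set (MvPolynomial (Fin N) ℂ) := (fun d => monomial d 1) '' {d : Fin N →₀ ℕ | d.degree < b + q}
  have hs : s.Finite := by
    apply Set.Finite.image
    have : {d : Fin N →₀ ℕ | d.degree < b + q} ⊆
        ⋃ j ∈ Finset.range (b + q), ((Finset.univ : Finset (Fin N)).finsuppAntidiag j : Set (Fin N →₀ ℕ)) := by
      intro d hd
      simp only [Set.mem_iUnion]
      refine ⟨d.degree, by simpa using hd, ?_⟩
      simp [Finset.mem_finsuppAntidiag, Finsupp.degree_eq_sum]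
    exact (Set.Finite.biUnion (Finset.finite_toSet _) fun j _ => Finset.finite_toSet _).subset this
  let L : Submodule A0 (MvPolynomial (Fin N) ℂ) := Submodule.span A0 s
  have hC : ∀ (c : ℂ) (f : MvPolynomial (Fin N) ℂ), f ∈ L → C c * f ∈ L := by
    intro c f hf
    have : C c * f = (⟨C c, ⟨C c, by simp [algebraMap_eq]⟩⟩ : A0) • f := rfl
    rw [this]
    exact L.smul_mem _ hf
  have key : ∀ j (f : MvPolynomial (Fin N) ℂ), f.IsHomogeneous j → f ∈ L := by
    intro j
    induction j using Nat.strong_induction_on with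
    | _ j ih =>
      intro f hf
      by_cases hj : j < b + q
      · rw [f.as_sum]
        apply Submodule.sum_mem
        intro d hd
        have h1 : monomial d (coeff d f) = C (coeff d f) * monomial d 1 := by
          rw [C_mul_monomial, mul_one]
        rw [h1]
        apply hC
        apply Submodule.subset_span
        refine ⟨d, ?_, rfl⟩
        have h2 : d.degree = j := by
          by_contra hne
          exact mem_support_iff.1 hd (hf.coeff_eq_zero hne)
        change d.degree < b + q
        rw [h2]; exact hj
      · obtain ⟨c, hc, hfc⟩ := aux_hspan (m := j - q) F hF hb (by omega) (f := f) (by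
          rwa [Nat.sub_add_cancel (by omega)])
        rw [hfc]
        apply Submodule.sum_mem
        intro i _
        have : c i * F i = (⟨F i, ⟨X i, by simp⟩⟩ : A0) • c i := by
          rw [mul_comm]; rfl
        rw [this]
        exact L.smul_mem _ (ih (j - q) (by omega) _ (hc i))
  have htop : L = ⊤ := by
    rw [eq_top_iff]
    intro f _
    rw [← sum_homogeneousComponent f]
    exact Submodule.sum_mem _ fun i _ => key i _ (homogeneousComponent_isHomogeneous _ _)
  have hfin : Module.Finite A0 (MvPolynomial (Fin N) ℂ) := ⟨htop ▸ Submodule.fg_span hs⟩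
  exact Algebra.IsIntegral.of_finite _ _

lemma aux_integral' {N q b : ℕ} (hq : 1 ≤ q) (F : Fin N → MvPolynomial (Fin N) ℂ)
    (hF : ∀ i, (F i).IsHomogeneous q)
    (hb : idealOfVars (Fin N) ℂ ^ b ≤ Ideal.span (Set.range F)) :
    (aeval (R := ℂ) F : MvPolynomial (Fin N) ℂ →ₐ[ℂ] MvPolynomial (Fin N) ℂ).toRingHom.IsIntegral := by
  have h1 := aux_integral hq F hF hb
  have h2 : (algebraMap (aeval (R := ℂ) F).range (MvPolynomial (Fin N) ℂ)).IsIntegral :=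
    algebraMap_isIntegral_iff.2 h1
  exact RingHom.IsIntegral.trans (aeval (R := ℂ) F).rangeRestrict.toRingHom _
    (RingHom.IsIntegral.of_finite (RingHom.Finite.of_surjective _ (AlgHom.rangeRestrict_surjective _))) h2

lemma aux_der_zero {A0 P : Type*} [CommRing A0] [CommRing P] [IsDomain P] [Algebra A0 P] [IsDomain A0]
    [CharZero A0] (hinj : Function.Injective (algebraMap A0 P)) (D : Derivation A0 P P) (x : P)
    (hx : IsIntegral A0 x) : D x = 0 := by
  classical
  have hex : ∃ k, ∃ p : Polynomial A0, p ≠ 0 ∧ p.natDegree = k ∧ Polynomial.aeval x p = 0 := by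
    obtain ⟨p, hp, hpx⟩ := hx
    exact ⟨_, p, hp.ne_zero, rfl, hpx⟩
  obtain ⟨p, hp0, hpk, hpx⟩ := Nat.find_spec hex
  have hmin := fun k (hk : k < Nat.find hex) => Nat.find_min hex hk
  have h1 := D.map_aeval p x
  rw [hpx, map_zero] at h1
  rcases mul_eq_zero.1 h1.symm with h2 | h2
  · exfalso
    have hdeg : p.natDegree ≠ 0 := by
      intro h0
      rw [Polynomial.eq_C_of_natDegree_eq_zero h0, Polynomial.aeval_C] at hpx
      have := hinj (hpx.trans (map_zero _).symm)
      apply hp0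
      rw [Polynomial.eq_C_of_natDegree_eq_zero h0, this, map_zero]
    have hlt := Polynomial.natDegree_derivative_lt hdeg
    refine hmin _ (hpk ▸ hlt) ⟨_, ?_, rfl, h2⟩
    intro h3
    exact hdeg (Polynomial.derivative_eq_zero.1 h3)
  · exact h2

lemma aux_jac {N q b : ℕ} (hq : 1 ≤ q) (F : Fin N → MvPolynomial (Fin N) ℂ)
    (hF : ∀ i, (F i).IsHomogeneous q)
    (hb : idealOfVars (Fin N) ℂ ^ b ≤ Ideal.span (Set.range F)) :
    (Matrix.of fun i j => pderiv j (F i)).det ≠ 0 := by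
  intro hdet
  obtain ⟨w, hw, hw0⟩ := Matrix.exists_mulVec_eq_zero_iff.2 hdet
  let D := mkDerivation ℂ w
  have hD : ∀ f, D f = ∑ j, pderiv j f * w j := by
    intro f
    have h := aux_chain D X f
    simp only [aeval_X_left, AlgHom.id_apply, D, mkDerivation_X] at h
    exact h
  have hDF : ∀ i, D (F i) = 0 := by
    intro i
    rw [hD]; exact congrFun hw0 i
  have hint := aux_integral hq F hF hb
  let D' : Derivation (aeval (R := ℂ) F).range (MvPolynomial (Fin N) ℂ) (MvPolynomial (Fin N) ℂ) :=
    Derivation.mk'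
      { toFun := D
        map_add' := map_add D
        map_smul' := by
          rintro ⟨_, g, rfl⟩ f
          change D (aeval F g * f) = aeval F g * D f
          rw [Derivation.leibniz, aux_chain D F g]
          simp [hDF] }
      (fun a b => D.leibniz a b)
  apply hw
  funext i
  have h1 := aux_der_zero Subtype.val_injective D' (X i) (hint.isIntegral _)
  have h2 : D (X i) = 0 := h1
  rwa [mkDerivation_X] at h2

lemma aux_line {N d : ℕ} {B : Type*} [CommRing B] [Algebra ℂ B] {f : MvPolynomial (Fin N) ℂ}
    (hf : f.IsHomogeneous d) (p : Fin N → ℂ) (T : B) :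
    aeval (fun i => algebraMap ℂ B (p i) * T) f = algebraMap ℂ B (eval p f) * T ^ d := by
  rw [aeval_def, eval₂_eq', eval_eq', map_sum, Finset.sum_mul]
  apply Finset.sum_congr rfl
  intro e he
  have hdeg : ∑ i, e i = d := by
    rw [← Finsupp.degree_eq_sum]
    by_contra hne
    exact mem_support_iff.1 he (hf.coeff_eq_zero hne)
  simp only [mul_pow, Finset.prod_mul_distrib, map_mul, map_prod, map_pow]
  rw [Finset.prod_pow_eq_pow_sum, hdeg]
  ring

/-- every chain of primes above `I` has length at most `r` -/
def auxDimLe {P : Type*} [CommRing P] (I : Ideal P) (r : ℕ) : Prop :=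
  ∀ c : LTSeries (PrimeSpectrum P), I ≤ c.head.asIdeal → c.length ≤ r

lemma aux_dim_of {P : Type*} [CommRing P] (I : Ideal P) (r : ℕ)
    (h : ringKrullDim (P ⧸ I) < ((r + 1 : ℕ) : WithBot ℕ∞)) : auxDimLe I r := by
  intro c hc
  rw [ringKrullDim_quotient] at h
  let c' : LTSeries (PrimeSpectrum.zeroLocus (I : Set P)) :=
    { length := c.length
      toFun := fun i => ⟨c i, by
        rw [PrimeSpectrum.mem_zeroLocus]
        exact hc.trans (LTSeries.head_le c i)⟩
      step := fun i => c.step i }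
  have h1 := Order.LTSeries.length_le_krullDim c'
  have h2 := lt_of_le_of_lt h1 h
  have h3 : c'.length < r + 1 := by exact_mod_cast h2
  exact Nat.lt_succ_iff.1 h3

lemma aux_comap_strict {A B : Type*} [CommRing A] [CommRing B] (f : A →+* B) (hf : f.IsIntegral) :
    StrictMono (PrimeSpectrum.comap f) := by
  intro p q hpq
  letI := f.toAlgebra
  have hle : p.asIdeal ≤ q.asIdeal := hpq.le
  have hne : p.asIdeal ≠ q.asIdeal := fun h => hpq.ne (PrimeSpectrum.ext h)
  obtain ⟨x, hxq, hxp⟩ := SetLike.exists_of_lt (lt_of_le_of_ne hle hne)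
  exact Ideal.comap_lt_comap_of_integral_mem_sdiff hle ⟨hxq, hxp⟩ (hf x)

lemma aux_dim_map {A B : Type*} [CommRing A] [CommRing B] (f : A →+* B) (hf : f.IsIntegral)
    (I : Ideal A) (r : ℕ) (h : auxDimLe I r) : auxDimLe (I.map f) r := by
  intro c hc
  refine h (c.map _ (aux_comap_strict f hf)) ?_
  rw [LTSeries.head_map]
  exact Ideal.map_le_iff_le_comap.1 hc

/-- linear forms -/
noncomputable def auxL {N : ℕ} (a : Fin N → ℂ) : MvPolynomial (Fin N) ℂ := ∑ i, C (a i) * X i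

lemma aux_vars_of_line {N d : ℕ} {f : MvPolynomial (Fin N) ℂ} (hf : f.IsHomogeneous d)
    (p : Fin N → ℂ) (hfp : eval p f ≠ 0) (hp : p ≠ 0) (q : Ideal (MvPolynomial (Fin N) ℂ)) (hq : q.IsPrime)
    (hfq : f ∈ q) (h : ∀ a : Fin N → ℂ, ∑ i, a i * p i = 0 → auxL a ∈ q) (i : Fin N) : X i ∈ q := by
  classical
  obtain ⟨j, hj⟩ : ∃ j, p j ≠ 0 := by
    by_contra hcon; push Not at hcon; exact hp (funext hcon)
  have hX : ∀ i, X i - C (p i * (p j)⁻¹) * X j ∈ q := by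
    intro i
    have h1 := h (Pi.single i 1 - Pi.single j (p i * (p j)⁻¹)) (by
      simp only [Pi.sub_apply, sub_mul, Finset.sum_sub_distrib]
      simp only [Pi.single_apply, ite_mul, one_mul, zero_mul, Finset.sum_ite_eq', Finset.mem_univ, if_true]
      field_simp
      ring)
    convert h1 using 1
    simp only [auxL, Pi.sub_apply, map_sub, sub_mul, Finset.sum_sub_distrib]
    congr 1
    · rw [Finset.sum_eq_single i]
      · simp
      · intro b _ hb; simp [hb]
      · simp
    · rw [Finset.sum_eq_single j]
      · simp
      · intro b _ hb; simp [hb]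
      · simp
  let mk := Ideal.Quotient.mkₐ ℂ q
  have h1 : ∀ i, mk (X i) = algebraMap ℂ _ (p i) * mk (C (p j)⁻¹ * X j) := by
    intro i
    have h2 : mk (X i) = mk (C (p i * (p j)⁻¹) * X j) := (Ideal.Quotient.eq).2 (hX i)
    rw [h2, C_mul, mul_assoc, map_mul]
    congr 1
  have h2 : mk f = algebraMap ℂ _ (eval p f) * mk (C (p j)⁻¹ * X j) ^ d := by
    rw [← aux_line hf p]
    have : mk f = aeval (fun i => mk (X i)) f := by
      rw [← MvPolynomial.comp_aeval_apply, aeval_X_left]; rfl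
    rw [this]
    congr 2
    funext i; exact h1 i
  have h3 : mk f = 0 := Ideal.Quotient.eq_zero_iff_mem.2 hfq
  have : IsDomain (MvPolynomial (Fin N) ℂ ⧸ q) := Ideal.Quotient.isDomain q
  have h4 : mk (C (p j)⁻¹ * X j) = 0 := by
    rw [h3] at h2
    rcases mul_eq_zero.1 h2.symm with h5 | h5
    · exact absurd ((map_eq_zero_iff _ (algebraMap ℂ _).injective).1 h5) hfp
    · exact eq_zero_of_pow_eq_zero h5
  have h5 := h1 i
  rw [h4, mul_zero] at h5
  exact Ideal.Quotient.eq_zero_iff_mem.1 h5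

lemma aux_step {N d r : ℕ} {f : MvPolynomial (Fin N) ℂ} (hN : 2 ≤ N) (hf : f.IsHomogeneous d)
    (p : Fin N → ℂ) (hfp : eval p f ≠ 0) (hp : p ≠ 0) (I : Ideal (MvPolynomial (Fin N) ℂ))
    (hfI : f ∈ I) (hI : auxDimLe I (r + 1)) :
    ∃ a : Fin N → ℂ, ∑ i, a i * p i = 0 ∧ auxDimLe (I ⊔ Ideal.span {auxL a}) r := by
  classical
  let U : Submodule ℂ (Fin N → ℂ) := LinearMap.ker (∑ i, p i • LinearMap.proj (R := ℂ) (φ := fun _ : Fin N => ℂ) i)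
  have hU : ∀ a, a ∈ U ↔ ∑ i, a i * p i = 0 := by
    intro a
    simp [U, LinearMap.mem_ker, LinearMap.sum_apply, mul_comm]
  obtain ⟨j, hj⟩ : ∃ j, p j ≠ 0 := by
    by_contra hcon; push Not at hcon; exact hp (funext hcon)
  obtain ⟨i, hij⟩ : ∃ i : Fin N, i ≠ j := by
    have : Nontrivial (Fin N) := Fin.nontrivial_iff_two_le.2 hN
    exact exists_ne j
  obtain ⟨a, haU, -, ha⟩ := aux_avoid X U {q ∈ I.minimalPrimes | ∃ i, X i ∉ q}
    ((Ideal.finite_minimalPrimes_of_isNoetherianRing _ I).subset (fun q hq => hq.1)) (by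
      rintro q ⟨hq, i, hi⟩
      by_contra hcon
      push Not at hcon
      exact hi (aux_vars_of_line hf p hfp hp q hq.1.1 (hq.1.2 hfI)
        (fun a ha => hcon a ((hU a).2 ha)) i)) i
      ⟨Pi.single i 1 - Pi.single j (p i * (p j)⁻¹), by
        rw [hU]
        simp only [Pi.sub_apply, sub_mul, Finset.sum_sub_distrib]
        simp only [Pi.single_apply, ite_mul, one_mul, zero_mul, Finset.sum_ite_eq', Finset.mem_univ, if_true]
        field_simp
        ring, by simp [hij]⟩
  refine ⟨a, (hU a).1 haU, ?_⟩
  intro c hc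
  obtain ⟨q, hq, hqc⟩ := Ideal.exists_minimalPrimes_le (I := I) (J := c.head.asIdeal) (le_sup_left.trans hc)
  by_cases hqX : ∃ i, X i ∉ q
  · have hlt : (⟨q, hq.1.1⟩ : PrimeSpectrum (MvPolynomial (Fin N) ℂ)) < c.head := by
      refine lt_of_le_of_ne hqc ?_
      intro heq
      apply ha q ⟨hq, hqX⟩
      have h1 : auxL a ∈ c.head.asIdeal := hc (Ideal.mem_sup_right (Ideal.mem_span_singleton_self _))
      rw [← heq] at h1
      exact h1
    have := hI (c.cons _ hlt) (by simpa using hq.1.2)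
    simpa using this
  · push Not at hqX
    have hc0 : c.length = 0 := by
      by_contra hne
      have hlt : c.head < c ⟨1, by omega⟩ := by
        apply c.strictMono
        simp [Fin.lt_def]
      obtain ⟨g, hg1, hg0⟩ := SetLike.exists_of_lt (show c.head.asIdeal < (c ⟨1, by omega⟩).asIdeal from hlt)
      have hsub : ∀ g : MvPolynomial (Fin N) ℂ, g - C (constantCoeff g) ∈ c.head.asIdeal := by
        intro g
        have hle : idealOfVars (Fin N) ℂ ≤ c.head.asIdeal := by
          unfold idealOfVars
          rw [Ideal.span_le]
          rintro _ ⟨i, rfl⟩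
          exact hqc (hqX i)
        apply hle
        rw [← pow_one (idealOfVars (Fin N) ℂ), mem_pow_idealOfVars_iff']
        intro x hx
        have hx0 : x = 0 := by
          rw [← Finsupp.degree_eq_zero_iff]
          omega
        rw [hx0, coeff_sub, coeff_zero_C, constantCoeff_eq, sub_self]
      have h2 : C (constantCoeff g) ∈ (c ⟨1, by omega⟩).asIdeal := by
        have h3 : g - C (constantCoeff g) ∈ (c ⟨1, by omega⟩).asIdeal := hlt.le (hsub g)
        have := Ideal.sub_mem _ hg1 h3
        simpa using this
      by_cases hz : constantCoeff g = 0
      · have := hsub g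
        rw [hz, C_0, sub_zero] at this
        exact hg0 this
      · apply (c ⟨1, by omega⟩).isPrime.ne_top
        exact Ideal.eq_top_of_isUnit_mem _ h2 ((isUnit_iff_ne_zero.2 hz).map C)
    omega

lemma aux_steps {N d : ℕ} {f : MvPolynomial (Fin N) ℂ} (hN : 2 ≤ N) (hf : f.IsHomogeneous d)
    (p : Fin N → ℂ) (hfp : eval p f ≠ 0) (hp : p ≠ 0) (r : ℕ) : ∀ (I : Ideal (MvPolynomial (Fin N) ℂ))
    (_ : f ∈ I) (_ : auxDimLe I r),
    ∃ a : Fin r → Fin N → ℂ, (∀ k, ∑ i, a k i * p i = 0) ∧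
      auxDimLe (I ⊔ Ideal.span (Set.range fun k => auxL (a k))) 0 := by
  induction r with
  | zero =>
    intro I _ hI
    refine ⟨Fin.elim0, fun k => k.elim0, ?_⟩
    rw [Set.range_eq_empty, Ideal.span_empty, sup_bot_eq]
    exact hI
  | succ r ih =>
    intro I hfI hI
    obtain ⟨a, ha, haI⟩ := aux_step hN hf p hfp hp I hfI hI
    obtain ⟨a', ha', haI'⟩ := ih _ (Ideal.mem_sup_left hfI) haI
    refine ⟨Fin.cons a a', ?_, ?_⟩
    · intro k
      refine Fin.cases ?_ (fun k => ?_) k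
      · exact ha
      · exact ha' k
    · convert haI' using 1
      rw [sup_assoc, ← Ideal.span_union]
      congr 2
      ext x
      simp only [Set.mem_range, Set.singleton_union, Set.mem_insert_iff]
      constructor
      · rintro ⟨k, rfl⟩
        refine Fin.cases ?_ (fun k => ?_) k
        · left; rfl
        · right; exact ⟨k, rfl⟩
      · rintro (rfl | ⟨k, rfl⟩)
        · exact ⟨0, rfl⟩
        · exact ⟨k.succ, rfl⟩

lemma aux_slice {N w r : ℕ} {ι : Type*} (hN : 2 ≤ N) (v : ι → MvPolynomial (Fin N) ℂ)
    (hv : ∀ i, (v i).IsHomogeneous w) (hw : 1 ≤ w) (p : Fin N → ℂ) (hp : ∃ i, eval p (v i) ≠ 0)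
    (hp0 : p ≠ 0) (hd : auxDimLe (Ideal.span (Set.range v)) r) :
    ∃ a : Fin r → Fin N → ℂ, (∀ k, ∑ i, a k i * p i = 0) ∧
      ∀ x : Fin N → ℂ, (∀ i, eval x (v i) = 0) → (∀ k, ∑ i, a k i * x i = 0) → x = 0 := by
  obtain ⟨i0, hi0⟩ := hp
  obtain ⟨a, ha, hI⟩ := aux_steps hN (hv i0) p hi0 hp0 r _ (Ideal.subset_span (Set.mem_range_self i0)) hd
  refine ⟨a, ha, ?_⟩
  intro x hx hax
  by_contra hx0
  obtain ⟨j, hj⟩ : ∃ j, x j ≠ 0 := by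
    by_contra hcon; push Not at hcon; exact hx0 (funext hcon)
  let ψ : MvPolynomial (Fin N) ℂ →ₐ[ℂ] Polynomial ℂ :=
    aeval (fun i => algebraMap ℂ (Polynomial ℂ) (x i) * Polynomial.X)
  let ψ0 : MvPolynomial (Fin N) ℂ →ₐ[ℂ] ℂ := (Polynomial.aeval (0 : ℂ)).comp ψ
  let p0 : PrimeSpectrum (MvPolynomial (Fin N) ℂ) := ⟨RingHom.ker ψ, RingHom.ker_isPrime _⟩
  let p1 : PrimeSpectrum (MvPolynomial (Fin N) ℂ) := ⟨RingHom.ker ψ0, RingHom.ker_isPrime _⟩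
  have hψj : ψ (X j) = algebraMap ℂ (Polynomial ℂ) (x j) * Polynomial.X := by simp [ψ]
  have hlt : p0 < p1 := by
    refine lt_of_le_of_ne ?_ ?_
    · intro g hg
      have hg' : ψ g = 0 := hg
      change ψ0 g = 0
      simp [ψ0, hg']
    · intro heq
      have h1 : X j ∈ p1.asIdeal := by
        change ψ0 (X j) = 0
        simp [ψ0, hψj]
      rw [← heq] at h1
      have h2 : ψ (X j) = 0 := h1
      rw [hψj] at h2
      rcases mul_eq_zero.1 h2 with h3 | h3
      · exact hj ((map_eq_zero_iff _ (algebraMap ℂ _).injective).1 h3)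
      · exact Polynomial.X_ne_zero h3
  let c : LTSeries (PrimeSpectrum (MvPolynomial (Fin N) ℂ)) :=
    { length := 1
      toFun := ![p0, p1]
      step := by
        intro i
        fin_cases i
        exact hlt }
  have hcl : c.length = 1 := rfl
  have hch : c.head = p0 := rfl
  have := hI c (by
    rw [hch]
    refine sup_le ?_ ?_
    · rw [Ideal.span_le]
      rintro _ ⟨i, rfl⟩
      change ψ (v i) = 0
      simp only [ψ]
      rw [aux_line (hv i), hx, map_zero, zero_mul]
    · rw [Ideal.span_le]
      rintro _ ⟨k, rfl⟩
      change ψ (auxL (a k)) = 0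
      have h1 : (auxL (a k)).IsHomogeneous 1 := IsHomogeneous.sum _ _ _ fun i _ => by
        simpa using (isHomogeneous_C (Fin N) (a k i)).mul (isHomogeneous_X ℂ i)
      simp only [ψ]
      rw [aux_line h1]
      have : eval x (auxL (a k)) = 0 := by
        simp [auxL, hax k]
      rw [this, map_zero, zero_mul])
  omega

lemma aux_three {N r : ℕ} (hr : r + 3 ≤ N) (a : Fin r → Fin N → ℂ) (p : Fin N → ℂ) (hp0 : p ≠ 0)
    (hap : ∀ k, ∑ i, a k i * p i = 0) :
    ∃ β : Fin 3 → Fin N → ℂ, LinearIndependent ℂ β ∧ (∀ c k, ∑ i, a k i * β c i = 0) ∧ β 0 = p := by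
  let g : (Fin N → ℂ) →ₗ[ℂ] (Fin r → ℂ) := Matrix.mulVecLin (Matrix.of a)
  have hU : ∀ x, x ∈ LinearMap.ker g ↔ ∀ k, ∑ i, a k i * x i = 0 := by
    intro x
    rw [LinearMap.mem_ker, funext_iff]
    simp [g, Matrix.mulVec, dotProduct]
  have hfr : 3 ≤ Module.finrank ℂ (LinearMap.ker g) := by
    have h1 := LinearMap.finrank_range_add_finrank_ker g
    have h2 := Submodule.finrank_le (LinearMap.range g)
    simp only [Module.finrank_fin_fun] at h1 h2
    omega
  let p' : LinearMap.ker g := ⟨p, (hU p).2 hap⟩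
  have hp' : p' ≠ 0 := fun hh => hp0 (congrArg Subtype.val hh)
  have l1 : LinearIndependent ℂ ![p'] := LinearIndependent.of_subsingleton (0 : Fin 1) hp'
  obtain ⟨x, l2⟩ := exists_linearIndependent_cons_of_lt_finrank l1 (by omega)
  obtain ⟨y, l3⟩ := exists_linearIndependent_cons_of_lt_finrank l2 (by omega)
  have l4 := l3.comp ![2, 1, 0] (by decide)
  have l5 := l4.map' (LinearMap.ker g).subtype (Submodule.ker_subtype _)
  refine ⟨_, l5, ?_, ?_⟩
  · intro c
    rw [← hU]
    exact Subtype.prop _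
  · rfl

lemma aux_final_num (n k q : ℕ) (hkn : k + 3 ≤ n) (hq : 2 ≤ q)
    (hnk : (n : ℝ) ≥ 2 * k + 3 / 2 + Real.sqrt (2 * k ^ 2 + 2 * k + 1 / 4))
    (m s t : ℕ) (hm : n = m + 1) (hs : s = n - k - 1) (ht : t = q - 1)
    (hle : 2 * (q * s) ^ 2 ≤ 2 * s ^ 2 + 2 * (m * s * t) + m * (m + 1) * t ^ 2) : False := by
  have h1 : (0:ℝ) ≤ 2 * k ^ 2 + 2 * k + 1 / 4 := by positivity
  have h2 := Real.sq_sqrt h1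
  have h3 := Real.sqrt_nonneg (2 * (k:ℝ) ^ 2 + 2 * k + 1 / 4)
  obtain ⟨q', rfl⟩ : ∃ q', q = q' + 1 := ⟨q - 1, by omega⟩
  have hs' : (s : ℝ) = n - k - 1 := by
    have : n = s + k + 1 := by omega
    rw [this]; push_cast; ring
  have hm' : (n : ℝ) = m + 1 := by rw [hm]; push_cast; ring
  have h4 : (m : ℝ) * (m + 1) ≤ 2 * s ^ 2 := by
    have : (2 * (k:ℝ) ^ 2 + 2 * k + 1 / 4) ≤ (n - 2 * k - 3 / 2) ^ 2 := by
      rw [← h2]; gcongr; linarith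
    rw [hs']
    have hmm : (m : ℝ) = n - 1 := by linarith
    rw [hmm]
    nlinarith
  have h4' : m * (m + 1) ≤ 2 * s ^ 2 := by exact_mod_cast h4
  have ht' : t = q' := by omega
  subst ht'
  have hs2 : 2 ≤ s := by omega
  have h5 : 2 * s * t * (2 * s) ≤ 2 * s * t * m := by
    nlinarith [Nat.mul_le_mul_right (t ^ 2) h4']
  have h6 : 2 * s ≤ m := Nat.le_of_mul_le_mul_left h5 (by have : 1 ≤ t := by omega
                                                          positivity)
  nlinarith

lemma aux_rho {N : ℕ} (β : Fin 3 → Fin N → ℂ) :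
    ∃ ρ : MvPolynomial (Fin N) ℂ →ₐ[ℂ] MvPolynomial (Fin 3) ℂ,
      (∀ f d, f.IsHomogeneous d → (ρ f).IsHomogeneous d) ∧
      ∀ c f, eval c (ρ f) = eval (∑ l, c l • β l) f := by
  refine ⟨aeval (fun i => ∑ l, C (β l i) * X l), ?_, ?_⟩
  · intro f d hf
    have := hf.aeval (fun i => ∑ l, C (β l i) * X l : Fin N → MvPolynomial (Fin 3) ℂ) (n := 1)
      (fun i => IsHomogeneous.sum _ _ _ fun l _ => by
        simpa using (isHomogeneous_C (Fin 3) (β l i)).mul (isHomogeneous_X ℂ l))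
    simpa using this
  · intro c f
    have : (aeval c : MvPolynomial (Fin 3) ℂ →ₐ[ℂ] ℂ).comp (aeval (fun i => ∑ l, C (β l i) * X l))
        = (aeval (∑ l, c l • β l) : MvPolynomial (Fin N) ℂ →ₐ[ℂ] ℂ) := by
      apply algHom_ext
      intro i
      simp [Finset.sum_apply, mul_comm]
    have h2 := DFunLike.congr_fun this f
    simpa [coe_aeval_eq_eval] using h2

lemma aux_main (n k q : ℕ) (hkn : k + 3 ≤ n) (hq : 2 ≤ q)
    (h : MvPolynomial (Fin (n + 1)) ℂ) (h0 : h ≠ 0)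
    (hhom : h.IsHomogeneous (n - k)) (F : Fin (n + 1) → MvPolynomial (Fin (n + 1)) ℂ)
    (hF : ∀ i, (F i).IsHomogeneous q) (hF0 : ∀ x : Fin (n + 1) → ℂ, (∀ i, eval x (F i) = 0) → x = 0)
    (lam : ℂ) (hlam : lam ≠ 0) (hinv : aeval F h = C lam * h ^ q)
    (hdim : auxDimLe (Ideal.span (insert h (Set.range fun i => pderiv i h))) (n - 2))
    (m s t : ℕ) (hm : n = m + 1) (hs : s = n - k - 1) (ht : t = q - 1) :
    2 * (q * s) ^ 2 ≤ 2 * s ^ 2 + 2 * (m * s * t) + m * (m + 1) * t ^ 2 := by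
  subst hm
  obtain ⟨b, hb⟩ := aux_vars_pow_le F hF0
  have hR := aux_jac (by omega) F hF hb
  have hint := aux_integral' (by omega) F hF hb
  set A : Matrix (Fin (m + 1 + 1)) (Fin (m + 1 + 1)) (MvPolynomial (Fin (m + 1 + 1)) ℂ) :=
    Matrix.of fun i j => pderiv j (F i) with hA
  let u := fun j => pderiv j h
  let v := fun i => aeval F (pderiv i h)
  let H := C (lam * q) * h ^ (q - 1)
  have hu : ∀ j, (u j).IsHomogeneous s := fun j => by rw [hs]; exact hhom.pderiv
  have hv : ∀ j, (v j).IsHomogeneous (q * s) := fun j => (hu j).aeval F hF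
  have hrel : ∀ j, ∑ i, v i * A i j = H * u j := by
    intro j
    have h1 := aux_chain (pderiv j) F h
    rw [hinv] at h1
    rw [hA]
    simp only [Matrix.of_apply, v, H, u]
    rw [← h1, Derivation.leibniz, pderiv_C, Derivation.leibniz_pow]
    simp only [smul_eq_mul, mul_zero, add_zero, nsmul_eq_mul, map_mul, map_natCast]
    ring
  have heul : ∑ i, X i * pderiv i h = (m + 1 - k) • h := hhom.sum_X_mul_pderiv
  have hd : ((m + 1 - k : ℕ) : ℂ) ≠ 0 := Nat.cast_ne_zero.2 (by omega)
  have hmem : aeval F h ∈ Ideal.span (Set.range v) := by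
    have h1 := congrArg (aeval F) heul
    rw [map_sum, map_nsmul] at h1
    have h2 : aeval F h = C ((m + 1 - k : ℕ) : ℂ)⁻¹ * ∑ i, aeval F (X i * pderiv i h) := by
      rw [h1, nsmul_eq_mul, ← map_natCast (C : ℂ →+* MvPolynomial (Fin (m + 1 + 1)) ℂ), ← mul_assoc, ← C_mul, inv_mul_cancel₀ hd,
        C_1, one_mul]
    rw [h2]
    refine Ideal.mul_mem_left _ _ (Ideal.sum_mem _ fun i _ => ?_)
    rw [map_mul]
    exact Ideal.mul_mem_left _ _ (Ideal.subset_span (Set.mem_range_self i))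
  have hdv : auxDimLe (Ideal.span (Set.range v)) (m + 1 - 2) := by
    have h1 := aux_dim_map _ hint _ _ hdim
    intro c hc
    apply h1 c
    refine le_trans ?_ hc
    rw [Ideal.map_le_iff_le_comap, Ideal.span_le]
    rintro g (rfl | ⟨i, rfl⟩)
    · exact hmem
    · exact Ideal.subset_span (Set.mem_range_self i)
  obtain ⟨i0, hi0⟩ : ∃ i, v i ≠ 0 := by
    by_contra hcon
    push Not at hcon
    have hu0 : ∀ j, u j = 0 := by
      intro j
      have h1 := hrel j
      rw [Finset.sum_eq_zero (fun i _ => by rw [hcon i, zero_mul])] at h1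
      rcases mul_eq_zero.1 h1.symm with h2 | h2
      · rcases mul_eq_zero.1 h2 with h3 | h3
        · rw [C_eq_zero] at h3
          rcases mul_eq_zero.1 h3 with h4 | h4
          · exact absurd h4 hlam
          · exact absurd h4 (Nat.cast_ne_zero.2 (by omega))
        · exact absurd h3 (pow_ne_zero _ h0)
      · exact h2
    rw [Finset.sum_eq_zero (fun i _ => by
      have := hu0 i
      simp only [u] at this
      rw [this, mul_zero])] at heul
    rw [nsmul_eq_mul] at heul
    rcases mul_eq_zero.1 heul.symm with h1 | h1
    · rw [Nat.cast_eq_zero] at h1; omega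
    · exact h0 h1
  obtain ⟨p, hp⟩ : ∃ p, eval p (A.det * v i0) ≠ 0 := by
    by_contra hcon
    push Not at hcon
    exact mul_ne_zero hR hi0 (MvPolynomial.funext fun x => by rw [hcon, map_zero])
  rw [map_mul] at hp
  have hpR := left_ne_zero_of_mul hp
  have hpv := right_ne_zero_of_mul hp
  have hw : 1 ≤ q * s := Nat.mul_pos (by omega) (by omega)
  have hp0 : p ≠ 0 := by
    rintro rfl
    apply hpv
    rw [eval_zero, constantCoeff_eq]
    by_contra hne
    have := hv i0 hne
    simp at this
    omega
  obtain ⟨a, hap, hax⟩ := aux_slice (by omega) v hv hw p ⟨i0, hpv⟩ hp0 hdv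
  obtain ⟨β, hβ, haβ, hβ0⟩ := aux_three (by omega) a p hp0 hap
  obtain ⟨ρ, hρh, hρe⟩ := aux_rho β
  obtain ⟨b', hb'⟩ := aux_vars_pow_le (fun i => ρ (v i)) (by
    intro c hc
    have h1 : ∑ l, c l • β l = 0 := by
      apply hax
      · intro i; rw [← hρe]; exact hc i
      · intro k
        simp only [Finset.sum_apply, Pi.smul_apply, smul_eq_mul, Finset.mul_sum]
        rw [Finset.sum_comm]
        refine Finset.sum_eq_zero fun l _ => ?_
        have := haβ l k
        calc ∑ i, a k i * (c l * β l i) = c l * ∑ i, a k i * β l i := by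
              rw [Finset.mul_sum]; exact Finset.sum_congr rfl fun i _ => by ring
          _ = 0 := by rw [this, mul_zero]
    exact funext (Fintype.linearIndependent_iff.1 hβ c h1))
  refine aux_core (m := m) (A.map ρ) (fun j => ρ (u j)) (fun i => ρ (v i)) (ρ H) ?_ (fun i => hρh _ _ (hu i))
    (fun i => hρh _ _ (hv i)) hw ?_ ?_ hb'
  · intro i j
    rw [ht]
    exact hρh _ _ (hF i).pderiv
  · intro j
    rw [← map_mul, ← hrel, map_sum]
    simp
  · intro hcon
    apply hpR
    have h1 : ρ A.det = 0 := by
      rw [← hcon]; exact AlgHom.map_det ρ A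
    have h2 := hρe (Pi.single 0 1) A.det
    rw [h1, map_zero] at h2
    have h3 : ∑ l, (Pi.single 0 1 : Fin 3 → ℂ) l • β l = p := by
      rw [Finset.sum_eq_single 0] <;> simp +contextual [hβ0, Pi.single_apply]
    rw [h3] at h2
    exact h2.symm

theorem degree_n_sub_k_not_normal (n k : ℕ) (hk : 1 ≤ k) (hkn : k + 3 ≤ n)
    (hnk : (n : ℝ) ≥ 2 * k + 3 / 2 + Real.sqrt (2 * k ^ 2 + 2 * k + 1 / 4))
    (h : MvPolynomial (Fin (n + 1)) ℂ) (hirr : Irreducible h)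
    (hhom : h.IsHomogeneous (n - k)) (hinv : IsTotallyInvariant (n + 1) h) :
    ((n - 1 : ℕ) : WithBot ℕ∞) ≤
      ringKrullDim (MvPolynomial (Fin (n + 1)) ℂ ⧸ jacobianIdeal (n + 1) h) := by
  by_contra hcon
  rw [not_le] at hcon
  obtain ⟨q, hq, F, ⟨hF, hF0⟩, lam, hlam, hinv⟩ := hinv
  have e : n - 1 = (n - 2) + 1 := by omega
  rw [e] at hcon
  have hdim := aux_dim_of _ _ hcon
  exact aux_final_num n k q hkn hq hnk (n - 1) (n - k - 1) (q - 1) (by omega) rfl rfl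
    (aux_main n k q hkn hq h hirr.ne_zero hhom F hF hF0 lam hlam hinv hdim _ _ _ (by omega) rfl rfl)
end

section
/- Let n ≥ 6 and let h ∈ ℂ[X₀,…,Xₙ] be an irreducible homogeneous polynomial of degree n − 1 defining a totally invariant hypersurface X = {h = 0} ⊂ ℙⁿ(ℂ). Then X is not normal: its singular locus has dimension n − 2, i.e. the Jacobian ring J(h) has Krull dimension ≥ n − 1. -/
open MvPolynomial

open MvPolynomial

/-- the polynomial `z ↦ binom(z+N, N)` -/
noncomputable def betaFn (N : ℕ) (z : ℝ) : ℝ := (∏ i ∈ Finset.range N, (z + i + 1)) / (N.factorial : ℝ)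

def bFn (N t : ℕ) : ℕ := (t + N).choose N

lemma bFn_eq_betaFn (N t : ℕ) : (bFn N t : ℝ) = betaFn N t := by
  unfold bFn betaFn
  rw [eq_div_iff (by positivity)]
  have h := Nat.ascFactorial_eq_factorial_mul_choose t N
  rw [Nat.ascFactorial_eq_prod_range] at h
  have h' : ((∏ i ∈ Finset.range N, (t + 1 + i) : ℕ) : ℝ) = ((N.factorial * (t + N).choose N : ℕ) : ℝ) := by
    rw [h]
  push_cast at h'
  rw [mul_comm, ← h']
  exact Finset.prod_congr rfl fun i _ => by ring

lemma prod_expand (N : ℕ) : ∃ s1 s2 : ℝ, ∀ x : ℝ, ∃ R : Polynomial ℝ, ∀ y : ℝ,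
    ∏ i ∈ Finset.range N, (1 + (x + i + 1) * y) =
      1 + (N * x + s1) * y + (N * (N - 1) / 2 * x ^ 2 + (N - 1) * s1 * x + s2) * y ^ 2
        + y ^ 3 * R.eval y := by
  induction N with
  | zero => exact ⟨0, 0, fun x => ⟨0, fun y => by simp⟩⟩
  | succ N ih =>
    obtain ⟨s1, s2, h⟩ := ih
    refine ⟨s1 + N + 1, s2 + s1 * (N + 1), fun x => ?_⟩
    obtain ⟨R, hR⟩ := h x
    refine ⟨R + Polynomial.X * R * Polynomial.C (x + N + 1) +
      Polynomial.C ((N * (N - 1) / 2 * x ^ 2 + (N - 1) * s1 * x + s2) * (x + N + 1)), fun y => ?_⟩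
    rw [Finset.prod_range_succ, hR]
    simp only [Polynomial.eval_add, Polynomial.eval_mul, Polynomial.eval_X, Polynomial.eval_C]
    push_cast
    ring

lemma betaFn_expand (N : ℕ) : ∃ s1 s2 : ℝ, ∀ x : ℝ, ∃ R : Polynomial ℝ, ∀ y : ℝ, y ≠ 0 →
    betaFn N (y⁻¹ + x) * N.factorial * y ^ N =
      1 + (N * x + s1) * y + (N * (N - 1) / 2 * x ^ 2 + (N - 1) * s1 * x + s2) * y ^ 2
        + y ^ 3 * R.eval y := by
  obtain ⟨s1, s2, h⟩ := prod_expand N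
  refine ⟨s1, s2, fun x => ?_⟩
  obtain ⟨R, hR⟩ := h x
  refine ⟨R, fun y hy => ?_⟩
  rw [← hR, betaFn, div_mul_cancel₀ _ (by positivity)]
  rw [show y ^ N = ∏ i ∈ Finset.range N, y by simp, ← Finset.prod_mul_distrib]
  refine Finset.prod_congr rfl fun i _ => ?_
  field_simp
  ring

open Filter Topology in
lemma asym_aux {P : Polynomial ℝ} (h : ∀ᶠ t : ℕ in atTop, P.eval ((t : ℝ)⁻¹) ≤ 0) :
    P.eval 0 ≤ 0 := by
  have h1 : Tendsto (fun t : ℕ => P.eval ((t : ℝ)⁻¹)) atTop (𝓝 (P.eval 0)) :=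
    (P.continuous.tendsto 0).comp tendsto_inv_atTop_nhds_zero_nat
  exact le_of_tendsto h1 h

open Filter Topology in
lemma asym1 {k : ℕ} (N : ℕ) (hN : 2 ≤ N) (c x : Fin k → ℝ) (hc : ∑ j, c j = 0) (K : ℝ)
    (h : ∀ᶠ t : ℕ in atTop, ∑ j, c j * betaFn N (t + x j) ≤ K * (t : ℝ) ^ (N - 2)) :
    ∑ j, c j * x j ≤ 0 := by
  obtain ⟨s1, s2, H⟩ := betaFn_expand N
  choose R hR using H
  let P : Polynomial ℝ := Polynomial.C (N * ∑ j, c j * x j) + Polynomial.X * (∑ j, Polynomial.C (c j) *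
    (Polynomial.C (N * (N - 1) / 2 * (x j) ^ 2 + (N - 1) * s1 * (x j) + s2) + Polynomial.X * R (x j)))
      - Polynomial.C (K * N.factorial) * Polynomial.X
  have key : P.eval 0 ≤ 0 := by
    apply asym_aux
    filter_upwards [h, eventually_gt_atTop 0] with t ht ht0
    have ht0' : (0:ℝ) < t := by exact_mod_cast ht0
    set y : ℝ := (t:ℝ)⁻¹ with hy
    have hy0 : 0 < y := by positivity
    have hty : (t:ℝ) = y⁻¹ := by simp [hy]
    have e1 : y * P.eval y = (∑ j, c j * betaFn N (t + x j) - K * (t : ℝ) ^ (N - 2)) * (N.factorial * y ^ N) := by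
      have e2 : (t : ℝ) ^ (N - 2) * y ^ N = y ^ 2 := by
        obtain ⟨M, rfl⟩ := Nat.exists_eq_add_of_le hN
        rw [hty]; simp only [Nat.add_sub_cancel_left]; rw [pow_add, inv_pow]; field_simp
      have e3 : (∑ j, c j * betaFn N (t + x j)) * (N.factorial * y ^ N) =
         ∑ j, c j * (1 + (N * x j + s1) * y + (N * (N - 1) / 2 * (x j) ^ 2 + (N - 1) * s1 * (x j) + s2) * y ^ 2
        + y ^ 3 * (R (x j)).eval y) := by
        rw [Finset.sum_mul]
        refine Finset.sum_congr rfl fun j _ => ?_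
        rw [← hR (x j) y hy0.ne', hty]; ring
      rw [sub_mul, e3, show K * (t:ℝ)^(N-2) * (N.factorial * y ^ N) = K * N.factorial * ((t : ℝ) ^ (N - 2) * y ^ N) by ring, e2]
      have e4 : ∑ j, c j * (1 + (N * x j + s1) * y + (N * (N - 1) / 2 * (x j) ^ 2 + (N - 1) * s1 * (x j) + s2) * y ^ 2
        + y ^ 3 * (R (x j)).eval y) = (∑ j, c j) * (1 + s1 * y) + y * (N * ∑ j, c j * x j) + y ^ 2 * ∑ j, c j * ((N * (N - 1) / 2 * (x j) ^ 2 + (N - 1) * s1 * (x j) + s2) + y * (R (x j)).eval y) := by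
        simp only [Finset.mul_sum, Finset.sum_mul, ← Finset.sum_add_distrib]
        refine Finset.sum_congr rfl fun j _ => ?_
        ring
      rw [e4, hc]
      simp only [P, Polynomial.eval_add, Polynomial.eval_sub, Polynomial.eval_mul, Polynomial.eval_X, Polynomial.eval_C, Polynomial.eval_finsetSum]
      ring
    have : y * P.eval y ≤ 0 := by
      rw [e1]
      exact mul_nonpos_of_nonpos_of_nonneg (by linarith) (by positivity)
    by_contra hcon
    push Not at hcon
    nlinarith
  have : P.eval 0 = N * ∑ j, c j * x j := by simp [P, -map_sum, -map_mul, -map_natCast, -Polynomial.C_mul, -map_sub, -map_add, -map_div₀, -map_pow]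
  rw [this] at key
  have hN' : (0:ℝ) < N := by exact_mod_cast (by omega : 0 < N)
  by_contra hcon
  push Not at hcon
  nlinarith

open Filter Topology in
lemma asym2 {k : ℕ} (N : ℕ) (hN : 3 ≤ N) (c x : Fin k → ℝ) (hc : ∑ j, c j = 0)
    (hc1 : ∑ j, c j * x j = 0) (K : ℝ)
    (h : ∀ᶠ t : ℕ in atTop, ∑ j, c j * betaFn N (t + x j) ≤ K * (t : ℝ) ^ (N - 3)) :
    ∑ j, c j * x j ^ 2 ≤ 0 := by
  obtain ⟨s1, s2, H⟩ := betaFn_expand N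
  choose R hR using H
  let P : Polynomial ℝ := Polynomial.C (N * (N - 1) / 2 * ∑ j, c j * x j ^ 2) + Polynomial.X * (∑ j, Polynomial.C (c j) *
    R (x j)) - Polynomial.C (K * N.factorial) * Polynomial.X
  have key : P.eval 0 ≤ 0 := by
    apply asym_aux
    filter_upwards [h, eventually_gt_atTop 0] with t ht ht0
    have ht0' : (0:ℝ) < t := by exact_mod_cast ht0
    set y : ℝ := (t:ℝ)⁻¹ with hy
    have hy0 : 0 < y := by positivity
    have hty : (t:ℝ) = y⁻¹ := by simp [hy]
    have e1 : y ^ 2 * P.eval y = (∑ j, c j * betaFn N (t + x j) - K * (t : ℝ) ^ (N - 3)) * (N.factorial * y ^ N) := by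
      have e2 : (t : ℝ) ^ (N - 3) * y ^ N = y ^ 3 := by
        obtain ⟨M, rfl⟩ := Nat.exists_eq_add_of_le hN
        rw [hty]; simp only [Nat.add_sub_cancel_left]; rw [pow_add, inv_pow]; field_simp
      have e3 : (∑ j, c j * betaFn N (t + x j)) * (N.factorial * y ^ N) =
         ∑ j, c j * (1 + (N * x j + s1) * y + (N * (N - 1) / 2 * (x j) ^ 2 + (N - 1) * s1 * (x j) + s2) * y ^ 2
        + y ^ 3 * (R (x j)).eval y) := by
        rw [Finset.sum_mul]
        refine Finset.sum_congr rfl fun j _ => ?_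
        rw [← hR (x j) y hy0.ne', hty]; ring
      rw [sub_mul, e3, show K * (t:ℝ)^(N-3) * (N.factorial * y ^ N) = K * N.factorial * ((t : ℝ) ^ (N - 3) * y ^ N) by ring, e2]
      have e4 : ∑ j, c j * (1 + (N * x j + s1) * y + (N * (N - 1) / 2 * (x j) ^ 2 + (N - 1) * s1 * (x j) + s2) * y ^ 2
        + y ^ 3 * (R (x j)).eval y) = (∑ j, c j) * (1 + s1 * y + s2 * y ^ 2) + (∑ j, c j * x j) * (N * y + (N - 1) * s1 * y ^ 2) + y ^ 2 * (N * (N - 1) / 2 * ∑ j, c j * x j ^ 2) + y ^ 3 * ∑ j, c j * (R (x j)).eval y := by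
        simp only [Finset.mul_sum, Finset.sum_mul, ← Finset.sum_add_distrib]
        refine Finset.sum_congr rfl fun j _ => ?_
        ring
      rw [e4, hc, hc1]
      simp only [P, Polynomial.eval_add, Polynomial.eval_sub, Polynomial.eval_mul, Polynomial.eval_X, Polynomial.eval_C, Polynomial.eval_finsetSum]
      ring
    have : y ^ 2 * P.eval y ≤ 0 := by
      rw [e1]
      exact mul_nonpos_of_nonpos_of_nonneg (by linarith) (by positivity)
    by_contra hcon
    push Not at hcon
    have := mul_pos (pow_pos hy0 2) hcon
    linarith
  have : P.eval 0 = N * (N - 1) / 2 * ∑ j, c j * x j ^ 2 := by simp [P, -map_sum, -map_mul, -map_natCast, -Polynomial.C_mul, -map_sub, -map_add, -map_div₀, -map_pow]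
  rw [this] at key
  have hN' : (3:ℝ) ≤ N := by exact_mod_cast hN
  have hpos : (0:ℝ) < N * (N - 1) / 2 := by
    have : (0:ℝ) < N - 1 := by linarith
    positivity
  by_contra hcon
  push Not at hcon
  have := mul_pos hpos hcon
  linarith

lemma bFn_succ (N t : ℕ) (hN : 0 < N) : bFn N (t + 1) = bFn N t + (t + N).choose (N - 1) := by
  obtain ⟨M, rfl⟩ := Nat.exists_eq_succ_of_ne_zero hN.ne'
  simp only [bFn, Nat.succ_eq_add_one, Nat.add_sub_cancel]
  rw [show t + 1 + (M + 1) = (t + (M+1)) + 1 by ring, Nat.choose_succ_succ]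
  ring

lemma bFn_mono (N : ℕ) : Monotone (bFn N) := fun a b h => Nat.choose_le_choose _ (by omega)

lemma bFn_convex (N : ℕ) (hN : 0 < N) (x d e : ℕ) : bFn N (x + d) + bFn N (x + e) ≤ bFn N (x + d + e) + bFn N x := by
  induction e with
  | zero => simp
  | succ e ih =>
    rw [← add_assoc, ← add_assoc, bFn_succ _ _ hN, bFn_succ N (x+d+e) hN]
    have : (x + e + N).choose (N - 1) ≤ (x + d + e + N).choose (N-1) := Nat.choose_le_choose _ (by omega)
    omega

lemma bFn_incr (N : ℕ) (hN : 0 < N) (t d : ℕ) : bFn N t + d * (t + N).choose (N - 1) ≤ bFn N (t + d) := by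
  induction d with
  | zero => simp
  | succ e ih =>
    rw [← add_assoc, bFn_succ _ _ hN]
    have : (t + N).choose (N - 1) ≤ (t + e + N).choose (N-1) := Nat.choose_le_choose _ (by omega)
    linarith

open MvPolynomial

lemma rank_null {K V W : Type*} [Field K] [AddCommGroup V] [Module K V] [AddCommGroup W] [Module K W]
    (L : V →ₗ[K] W) (U : Submodule K V) [FiniteDimensional K U] :
    Module.finrank K (U.map L) + Module.finrank K (U ⊓ LinearMap.ker L : Submodule K V) =
      Module.finrank K U := by
  have h := LinearMap.finrank_range_add_finrank_ker (L.domRestrict U)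
  have h1 : LinearMap.range (L.domRestrict U) = U.map L := by
    rw [LinearMap.domRestrict, LinearMap.range_comp, Submodule.range_subtype]
  have h2 : (LinearMap.ker (L.domRestrict U)).map U.subtype = U ⊓ LinearMap.ker L := by
    rw [LinearMap.domRestrict, LinearMap.ker_comp, Submodule.map_comap_subtype]
  rw [← h, h1, ← h2, LinearEquiv.finrank_eq (Submodule.equivMapOfInjective U.subtype
    U.injective_subtype (LinearMap.ker (L.domRestrict U)))]

/-- polynomials of degree at most `t` -/
noncomputable abbrev Pd (N t : ℕ) : Submodule ℂ (MvPolynomial (Fin N) ℂ) := restrictTotalDegree (Fin N) ℂ t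

lemma mem_Pd {N t : ℕ} {p : MvPolynomial (Fin N) ℂ} : p ∈ Pd N t ↔ p.totalDegree ≤ t :=
  mem_restrictTotalDegree _ _ _

lemma card_aux (N : ℕ) (hN : 0 < N) (t : ℕ) :
    ((Finset.range (t + 1)).biUnion fun j => (Finset.univ : Finset (Fin N)).finsuppAntidiag j).card = bFn N t := by
  rw [Finset.card_biUnion]
  · simp only [Finset.card_finsuppAntidiag_nat_eq_choose, Finset.card_univ, Fintype.card_fin]
    induction t with
    | zero => simp [bFn]
    | succ t ih =>
      rw [Finset.sum_range_succ, ih, bFn_succ _ _ hN]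
      congr 1
      rw [show N + (t+1) - 1 = t + N by omega]
      apply Nat.choose_symm_of_eq_add
      omega
  · intro i _ j _ hij
    rw [Function.onFun, Finset.disjoint_left]
    intro f hf hf'
    rw [Finset.mem_finsuppAntidiag] at hf hf'
    exact hij (hf.1.symm.trans hf'.1)

lemma finrank_Pd (N : ℕ) (hN : 0 < N) (t : ℕ) : Module.finrank ℂ (Pd N t) = bFn N t := by
  rw [Pd, restrictTotalDegree, Module.finrank_eq_nat_card_basis (basisRestrictSupport ℂ _), ← card_aux N hN t]
  rw [← Nat.card_eq_finsetCard]
  apply Nat.card_congr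
  apply Equiv.setCongr
  ext f
  simp only [Set.mem_ofPred_eq, Finset.coe_biUnion, Set.mem_iUnion, Finset.mem_coe, Finset.mem_range,
    Finset.mem_finsuppAntidiag, Finset.subset_univ, and_true, exists_prop, exists_eq_right']
  rw [Finsupp.sum_fintype _ _ (fun _ => rfl)]
  exact Nat.lt_succ_iff.symm

lemma L0 {N : ℕ} (hN : 0 < N) (f v g : MvPolynomial (Fin N) ℂ) (hv : v ≠ 0)
    (h : ∀ x, g ∣ f * x ↔ v ∣ x) (s : ℕ) :
    Module.finrank ℂ ((Pd N (s + v.totalDegree)).map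
      (((Ideal.span {g}).restrictScalars ℂ).mkQ ∘ₗ LinearMap.mulLeft ℂ f)) + bFn N s = bFn N (s + v.totalDegree) := by
  rw [← finrank_Pd N hN (s + v.totalDegree), ← rank_null (((Ideal.span {g}).restrictScalars ℂ).mkQ ∘ₗ LinearMap.mulLeft ℂ f)]
  congr 1
  rw [← finrank_Pd N hN s]
  have hinj : Function.Injective (LinearMap.mulLeft ℂ v) := fun a b hab => mul_left_cancel₀ hv hab
  rw [LinearEquiv.finrank_eq (Submodule.equivMapOfInjective _ hinj (Pd N s))]
  suffices hs : Submodule.map (LinearMap.mulLeft ℂ v) (Pd N s) = Pd N (s + v.totalDegree) ⊓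
      LinearMap.ker ((Submodule.restrictScalars ℂ (Ideal.span {g})).mkQ ∘ₗ LinearMap.mulLeft ℂ f) by
    rw [hs]
  ext x
  simp only [Submodule.mem_map, Submodule.mem_inf, LinearMap.mem_ker, LinearMap.comp_apply,
    Submodule.mkQ_apply, Submodule.Quotient.mk_eq_zero, Submodule.restrictScalars_mem,
    LinearMap.mulLeft_apply, Ideal.mem_span_singleton, h, mem_Pd]
  constructor
  · rintro ⟨y, hy, rfl⟩
    refine ⟨?_, dvd_mul_right _ _⟩
    refine (totalDegree_mul _ _).trans (by omega)
  · rintro ⟨hd, y, rfl⟩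
    refine ⟨y, ?_, rfl⟩
    by_cases hy : y = 0
    · simp [hy]
    · rw [totalDegree_mul_of_isDomain hv hy] at hd
      omega

/-- vectors of polynomials of degree at most `t` -/
noncomputable def Vd (N t : ℕ) : Submodule ℂ (Fin N → MvPolynomial (Fin N) ℂ) :=
  Submodule.pi Set.univ (fun _ => Pd N t)

lemma mem_Vd {N t : ℕ} {p : Fin N → MvPolynomial (Fin N) ℂ} : p ∈ Vd N t ↔ ∀ i, (p i).totalDegree ≤ t := by
  simp [Vd, Submodule.mem_pi, mem_Pd]

noncomputable def VdEquiv (N t : ℕ) : Vd N t ≃ₗ[ℂ] (Fin N → Pd N t) where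
  toFun x i := ⟨x.1 i, mem_Pd.2 (mem_Vd.1 x.2 i)⟩
  invFun y := ⟨fun i => (y i).1, mem_Vd.2 fun i => mem_Pd.1 (y i).2⟩
  map_add' _ _ := rfl
  map_smul' _ _ := rfl
  left_inv _ := rfl
  right_inv _ := rfl

instance (N t : ℕ) : FiniteDimensional ℂ (Vd N t) := LinearEquiv.finiteDimensional (VdEquiv N t).symm

lemma finrank_Vd (N : ℕ) (hN : 0 < N) (t : ℕ) : Module.finrank ℂ (Vd N t) = N * bFn N t := by
  rw [LinearEquiv.finrank_eq (VdEquiv N t), Module.finrank_pi_fintype]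
  simp [finrank_Pd N hN]

instance fd_inf_Vd (N t : ℕ) (U : Submodule ℂ (Fin N → MvPolynomial (Fin N) ℂ)) :
    FiniteDimensional ℂ (U ⊓ Vd N t : Submodule ℂ _) :=
  Submodule.finiteDimensional_of_le (inf_le_right)

open MvPolynomial

/-- dimension of the degree at most `t` part -/
noncomputable def dm {N : ℕ} (M : Submodule (MvPolynomial (Fin N) ℂ) (Fin N → MvPolynomial (Fin N) ℂ)) (t : ℕ) : ℕ :=
  Module.finrank ℂ (M.restrictScalars ℂ ⊓ Vd N t : Submodule ℂ _)

lemma dm_mono {N : ℕ} {M M' : Submodule (MvPolynomial (Fin N) ℂ) (Fin N → MvPolynomial (Fin N) ℂ)} (h : M ≤ M') (t : ℕ) :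
    dm M t ≤ dm M' t :=
  Submodule.finrank_mono (inf_le_inf_right _ (fun _ hx => h hx))

lemma dm_top {N : ℕ} (hN : 0 < N) (t : ℕ) :
    dm (⊤ : Submodule (MvPolynomial (Fin N) ℂ) (Fin N → MvPolynomial (Fin N) ℂ)) t = N * bFn N t := by
  rw [dm, ← finrank_Vd N hN]
  have : (Submodule.restrictScalars ℂ (⊤ : Submodule (MvPolynomial (Fin N) ℂ) (Fin N → MvPolynomial (Fin N) ℂ)) ⊓ Vd N t) = Vd N t := by
    ext x; simp
  rw [this]

lemma totalDegree_pos_of_prime {N : ℕ} {p : MvPolynomial (Fin N) ℂ} (hp : Prime p) : 0 < p.totalDegree := by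
  rw [Nat.pos_iff_ne_zero]
  intro h
  rw [totalDegree_eq_zero_iff_eq_C] at h
  have h0 : coeff 0 p ≠ 0 := by
    intro h1
    rw [h1, C_0] at h
    exact hp.ne_zero h
  apply hp.not_isUnit
  rw [h]
  exact (isUnit_iff_ne_zero.2 h0).map C

lemma avoid {N : ℕ} (M' : Submodule (MvPolynomial (Fin N) ℂ) (Fin N → MvPolynomial (Fin N) ℂ))
    (φ : (Fin N → MvPolynomial (Fin N) ℂ) →ₗ[MvPolynomial (Fin N) ℂ] MvPolynomial (Fin N) ℂ)
    (u : MvPolynomial (Fin N) ℂ) (hu0 : u ≠ 0) (hu : ∀ m ∈ M', u ∣ φ m) (v : MvPolynomial (Fin N) ℂ) (hv : v ≠ 0)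
    (h : ∀ p, Prime p → p ∣ v → ∃ m ∈ M', ¬ p * u ∣ φ m) :
    ∃ m ∈ M', ∀ p, Prime p → p ∣ v → ¬ p * u ∣ φ m := by
  induction v using UniqueFactorizationMonoid.induction_on_prime with
  | h₁ => exact absurd rfl hv
  | h₂ x hx => exact ⟨0, M'.zero_mem, fun p hp hpx => absurd (isUnit_of_dvd_unit hpx hx) hp.not_isUnit⟩
  | h₃ w p hw hp ih =>
    obtain ⟨m₁, hm₁, h₁⟩ := ih hw (fun r hr hrw => h r hr (hrw.mul_left _))
    obtain ⟨m₂, hm₂, h₂⟩ := h p hp (dvd_mul_right _ _)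
    by_cases hc : p * u ∣ φ m₁
    · refine ⟨m₁ + w • m₂, M'.add_mem hm₁ (M'.smul_mem _ hm₂), ?_⟩
      intro r hr hrv hd
      rw [map_add, map_smul, smul_eq_mul] at hd
      rcases hr.dvd_or_dvd hrv with h3 | h3
      · have hd' : p * u ∣ φ m₁ + w * φ m₂ := by
          refine dvd_trans (mul_dvd_mul_right ?_ u) hd
          exact (hr.irreducible.associated_of_dvd hp.irreducible h3).symm.dvd
        have h4 := (dvd_add_right hc).1 hd'
        obtain ⟨y, hy⟩ := hu m₂ hm₂
        have h5 : p ∣ w * y := by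
          have : u * p ∣ u * (w * y) := by
            rw [mul_comm u p]; convert h4 using 1; rw [hy]; ring
          exact (mul_dvd_mul_iff_left hu0).1 this
        rcases hp.dvd_or_dvd h5 with h6 | h6
        · exact h₁ p hp h6 hc
        · apply h₂
          rw [hy, mul_comm p]
          exact mul_dvd_mul_left _ h6
      · apply h₁ r hr h3
        refine (dvd_add_left ?_).1 hd
        exact mul_dvd_mul h3 (hu m₂ hm₂)
    · refine ⟨m₁, hm₁, ?_⟩
      intro r hr hrv hd
      rcases hr.dvd_or_dvd hrv with h3 | h3
      · apply hc
        refine dvd_trans (mul_dvd_mul_right ?_ u) hd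
        exact (hr.irreducible.associated_of_dvd hp.irreducible h3).symm.dvd
      · exact h₁ r hr h3 hd

lemma gcd_data {N : ℕ} (M' : Submodule (MvPolynomial (Fin N) ℂ) (Fin N → MvPolynomial (Fin N) ℂ))
    (φ : (Fin N → MvPolynomial (Fin N) ℂ) →ₗ[MvPolynomial (Fin N) ℂ] MvPolynomial (Fin N) ℂ)
    (g : MvPolynomial (Fin N) ℂ) (hg : g ≠ 0) :
    ∃ u v, u ≠ 0 ∧ v ≠ 0 ∧ g = u * v ∧ (∀ m ∈ M', u ∣ φ m) ∧ ∃ m ∈ M', ∀ x, g ∣ φ m * x ↔ v ∣ x := by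
  let A : Set ℕ := {k | ∃ u, u ∣ g ∧ (∀ m ∈ M', u ∣ φ m) ∧ u.totalDegree = k}
  have hA : BddAbove A := by
    refine ⟨g.totalDegree, ?_⟩
    rintro k ⟨u, ⟨v, rfl⟩, -, rfl⟩
    rw [totalDegree_mul_of_isDomain (left_ne_zero_of_mul hg) (right_ne_zero_of_mul hg)]
    omega
  have hne : A.Nonempty := ⟨_, 1, one_dvd _, fun _ _ => one_dvd _, rfl⟩
  obtain ⟨u, ⟨v, rfl⟩, hu, hdeg⟩ := Nat.sSup_mem hne hA
  have hu0 := left_ne_zero_of_mul hg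
  have hv0 := right_ne_zero_of_mul hg
  refine ⟨u, v, hu0, hv0, rfl, hu, ?_⟩
  have key : ∀ p, Prime p → p ∣ v → ∃ m ∈ M', ¬ p * u ∣ φ m := by
    intro p hp hpv
    by_contra! hcon
    have : (p * u).totalDegree ≤ sSup A := le_csSup hA ⟨_, by rw [mul_comm]; exact mul_dvd_mul_left _ hpv, hcon, rfl⟩
    rw [totalDegree_mul_of_isDomain hp.ne_zero hu0, ← hdeg] at this
    have := totalDegree_pos_of_prime hp
    omega
  obtain ⟨m, hm, hmp⟩ := avoid M' φ u hu0 hu v hv0 key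
  refine ⟨m, hm, fun x => ?_⟩
  obtain ⟨y, hy⟩ := hu m hm
  rw [hy, mul_assoc, mul_dvd_mul_iff_left hu0]
  refine ⟨fun hd => ?_, fun hd => hd.mul_left _⟩
  refine UniqueFactorizationMonoid.dvd_of_dvd_mul_right_of_no_prime_factors hv0 ?_ hd
  intro p hpv hpy hp
  apply hmp p hp hpv
  rw [hy, mul_comm p]
  exact mul_dvd_mul_left _ hpy

lemma one_step {N : ℕ} (hN : 0 < N) (M' : Submodule (MvPolynomial (Fin N) ℂ) (Fin N → MvPolynomial (Fin N) ℂ))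
    (φ : (Fin N → MvPolynomial (Fin N) ℂ) →ₗ[MvPolynomial (Fin N) ℂ] MvPolynomial (Fin N) ℂ)
    (g : MvPolynomial (Fin N) ℂ) (hg : g ≠ 0) (a : ℕ)
    (hφ : ∀ t, ∀ m ∈ Vd N t, (φ m).totalDegree ≤ t + a + g.totalDegree) :
    ∃ δ τ, (∀ t, dm M' t + bFn N (t + a) ≤ dm (M' ⊓ Submodule.comap φ (Ideal.span {g})) t + bFn N (t + a + δ)) ∧
      ∀ T, τ ≤ T → dm (M' ⊓ Submodule.comap φ (Ideal.span {g})) T + δ * (T - τ + N).choose (N - 1) ≤ dm M' T := by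
  obtain ⟨u, v, hu0, hv0, hguv, hu, m, hm, hmx⟩ := gcd_data M' φ g hg
  have hdeg : g.totalDegree = u.totalDegree + v.totalDegree := by
    rw [hguv, totalDegree_mul_of_isDomain hu0 hv0]
  let Q := ((Ideal.span {g}).restrictScalars ℂ).mkQ
  let L : (Fin N → MvPolynomial (Fin N) ℂ) →ₗ[ℂ] _ := Q ∘ₗ (φ.restrictScalars ℂ)
  have hker : ∀ t, (M'.restrictScalars ℂ ⊓ Vd N t) ⊓ LinearMap.ker L =
      (M' ⊓ Submodule.comap φ (Ideal.span {g})).restrictScalars ℂ ⊓ Vd N t := by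
    intro t
    ext x
    simp only [L, Q, Submodule.mem_inf, Submodule.restrictScalars_mem, LinearMap.mem_ker, LinearMap.comp_apply,
      Submodule.mkQ_apply, Submodule.Quotient.mk_eq_zero, Submodule.mem_comap, LinearMap.coe_restrictScalars]
    tauto
  have hrn : ∀ t, Module.finrank ℂ ((M'.restrictScalars ℂ ⊓ Vd N t).map L) + dm (M' ⊓ Submodule.comap φ (Ideal.span {g})) t = dm M' t := by
    intro t
    have := rank_null L (M'.restrictScalars ℂ ⊓ Vd N t)
    rw [hker] at this
    exact this
  refine ⟨v.totalDegree, (Finset.univ.sup fun i => (m i).totalDegree) + v.totalDegree, ?_, ?_⟩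
  · intro t
    have h1 := L0 hN u v g hv0 (fun x => by rw [hguv, mul_dvd_mul_iff_left hu0]) (t + a)
    have h2 : Module.finrank ℂ ((M'.restrictScalars ℂ ⊓ Vd N t).map L) ≤
      Module.finrank ℂ ((Pd N (t + a + v.totalDegree)).map (Q ∘ₗ LinearMap.mulLeft ℂ u)) := by
      apply Submodule.finrank_mono
      rintro _ ⟨x, ⟨hx1, hx2⟩, rfl⟩
      obtain ⟨y, hy⟩ := hu x hx1
      refine ⟨y, ?_, ?_⟩
      · have := hφ t x hx2
        rw [hy] at this
        refine mem_Pd.2 ?_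
        by_cases hy0 : y = 0
        · simp [hy0]
        · rw [totalDegree_mul_of_isDomain hu0 hy0] at this
          omega
      · simp only [L, LinearMap.comp_apply, LinearMap.mulLeft_apply, LinearMap.coe_restrictScalars, hy]
    have h3 := hrn t
    have h1' : Module.finrank ℂ ((Pd N (t + a + v.totalDegree)).map (Q ∘ₗ LinearMap.mulLeft ℂ u)) + bFn N (t + a) =
       bFn N (t + a + v.totalDegree) := h1
    omega
  · intro T hT
    set τ := (Finset.univ.sup fun i => (m i).totalDegree) + v.totalDegree with hτ
    have h1 : Module.finrank ℂ ((Pd N ((T - τ) + v.totalDegree)).map (Q ∘ₗ LinearMap.mulLeft ℂ (φ m))) + bFn N (T - τ) =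
       bFn N ((T - τ) + v.totalDegree) := L0 hN (φ m) v g hv0 hmx (T - τ)
    have h2 : Module.finrank ℂ ((Pd N ((T - τ) + v.totalDegree)).map (Q ∘ₗ LinearMap.mulLeft ℂ (φ m))) ≤
      Module.finrank ℂ ((M'.restrictScalars ℂ ⊓ Vd N T).map L) := by
      apply Submodule.finrank_mono
      rintro _ ⟨x, hx, rfl⟩
      refine ⟨x • m, ⟨M'.smul_mem _ hm, mem_Vd.2 fun i => ?_⟩, ?_⟩
      · have h3 := mem_Pd.1 hx
        have h4 : (m i).totalDegree ≤ Finset.univ.sup fun i => (m i).totalDegree :=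
          Finset.le_sup (f := fun i => (m i).totalDegree) (Finset.mem_univ i)
        refine (totalDegree_mul _ _).trans ?_
        omega
      · simp only [L, LinearMap.comp_apply, LinearMap.mulLeft_apply, LinearMap.coe_restrictScalars, map_smul,
          smul_eq_mul, mul_comm]
    have h3 := hrn T
    have h4 := bFn_incr N hN (T - τ) v.totalDegree
    omega

lemma all_steps {N : ℕ} (hN : 0 < N) {ι : Type*} [DecidableEq ι] (s : Finset ι)
    (φ : ι → (Fin N → MvPolynomial (Fin N) ℂ) →ₗ[MvPolynomial (Fin N) ℂ] MvPolynomial (Fin N) ℂ)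
    (g : MvPolynomial (Fin N) ℂ) (hg : g ≠ 0) (a : ℕ)
    (hφ : ∀ i, ∀ t, ∀ m ∈ Vd N t, (φ i m).totalDegree ≤ t + a + g.totalDegree) :
    ∃ δ τ, (∀ t, N * bFn N t + bFn N (t + a) ≤ dm (s.inf fun i => Submodule.comap (φ i) (Ideal.span {g})) t + bFn N (t + a + δ)) ∧
      ∀ T, τ ≤ T → dm (s.inf fun i => Submodule.comap (φ i) (Ideal.span {g})) T + δ * (T - τ + N).choose (N - 1) ≤ N * bFn N T := by
  induction s using Finset.induction_on with
  | empty =>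
    refine ⟨0, 0, ?_, ?_⟩
    · intro t; simp [dm_top hN]
    · intro t; simp [dm_top hN]
  | insert i s hi ih =>
    obtain ⟨δ, τ, h1, h2⟩ := ih
    obtain ⟨δ', τ', h3, h4⟩ := one_step hN (s.inf fun i => Submodule.comap (φ i) (Ideal.span {g})) (φ i) g hg a (hφ i)
    rw [Finset.inf_insert, inf_comm]
    refine ⟨δ + δ', max τ τ', ?_, ?_⟩
    · intro t
      have e1 := h1 t
      have e2 := h3 t
      have e3 := bFn_convex N hN (t + a) δ δ'
      rw [← add_assoc]
      omega
    · intro T hT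
      have e1 := h2 T (by omega)
      have e2 := h4 T (by omega)
      have e3 : (T - max τ τ' + N).choose (N - 1) ≤ (T - τ + N).choose (N - 1) := Nat.choose_le_choose _ (by omega)
      have e4 : (T - max τ τ' + N).choose (N - 1) ≤ (T - τ' + N).choose (N - 1) := Nat.choose_le_choose _ (by omega)
      have e5 := Nat.mul_le_mul_left δ e3
      have e6 := Nat.mul_le_mul_left δ' e4
      rw [add_mul]
      omega

open MvPolynomial

/-- truncation in degrees at most `t` -/
noncomputable def trc {N : ℕ} (t : ℕ) : MvPolynomial (Fin N) ℂ →ₗ[ℂ] MvPolynomial (Fin N) ℂ :=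
  ∑ i ∈ Finset.range (t + 1), homogeneousComponent i

lemma trc_homog {N : ℕ} {e : ℕ} {p : MvPolynomial (Fin N) ℂ} (hp : p.IsHomogeneous e) (t : ℕ) :
    trc t p = if e ≤ t then p else 0 := by
  rw [trc, LinearMap.sum_apply]
  have : ∀ i, homogeneousComponent i p = if i = e then p else 0 := fun i =>
    homogeneousComponent_of_mem hp
  simp [this]

lemma trc_deg {N : ℕ} (t : ℕ) (p : MvPolynomial (Fin N) ℂ) : (trc t p).totalDegree ≤ t := by
  rw [trc, LinearMap.sum_apply]
  refine (totalDegree_finsetSum _ _).trans (Finset.sup_le fun i hi => ?_)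
  exact ((homogeneousComponent_isHomogeneous i p).totalDegree_le).trans (by simp at hi; omega)

lemma trc_eq {N : ℕ} (t : ℕ) (p : MvPolynomial (Fin N) ℂ) (h : p.totalDegree ≤ t) : trc t p = p := by
  conv_lhs => rw [← sum_homogeneousComponent p]
  rw [map_sum]
  conv_rhs => rw [← sum_homogeneousComponent p]
  apply Finset.sum_congr rfl
  intro i hi
  rw [trc_homog (homogeneousComponent_isHomogeneous i p), if_pos]
  simp at hi; omega

lemma trc_mul {N : ℕ} {e : ℕ} {p : MvPolynomial (Fin N) ℂ} (hp : p.IsHomogeneous e) (t : ℕ) (s : MvPolynomial (Fin N) ℂ) :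
    trc (t + e) (s * p) = trc t s * p := by
  conv_lhs => rw [← sum_homogeneousComponent s]
  conv_rhs => rw [← sum_homogeneousComponent s]
  rw [Finset.sum_mul, map_sum, map_sum, Finset.sum_mul]
  apply Finset.sum_congr rfl
  intro i hi
  have h1 := homogeneousComponent_isHomogeneous i s
  rw [trc_homog h1, trc_homog (h1.mul hp)]
  by_cases h : i ≤ t
  · rw [if_pos h, if_pos (by omega)]
  · rw [if_neg h, if_neg (by omega), zero_mul]

lemma trc_mul_lt {N : ℕ} {e : ℕ} {p : MvPolynomial (Fin N) ℂ} (hp : p.IsHomogeneous e) (t : ℕ) (ht : t < e) (s : MvPolynomial (Fin N) ℂ) :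
    trc t (s * p) = 0 := by
  conv_lhs => rw [← sum_homogeneousComponent s]
  rw [Finset.sum_mul, map_sum]
  apply Finset.sum_eq_zero
  intro i hi
  have h1 := homogeneousComponent_isHomogeneous i s
  rw [trc_homog (h1.mul hp), if_neg (by omega)]

lemma pow_mem_ideal {N q : ℕ} {F : Fin N → MvPolynomial (Fin N) ℂ} (hF : IsEndo N q F) :
    ∃ K, ∀ i, (X i : MvPolynomial (Fin N) ℂ) ^ K ∈ Ideal.span (Set.range F) := by
  have h1 : ∀ i, (X i : MvPolynomial (Fin N) ℂ) ∈ (Ideal.span (Set.range F)).radical := by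
    intro i
    rw [← vanishingIdeal_zeroLocus_eq_radical (K := ℂ)]
    rw [mem_vanishingIdeal_iff]
    intro x hx
    have : x = 0 := hF.2 x fun i => by
      have := hx (F i) (Ideal.subset_span ⟨i, rfl⟩)
      simpa using this
    simp [this]
  choose k hk using h1
  refine ⟨Finset.univ.sup k, fun i => ?_⟩
  exact Ideal.pow_mem_of_pow_mem _ (hk i) (Finset.le_sup (Finset.mem_univ i))

lemma mono_mem_ideal {N q : ℕ} {F : Fin N → MvPolynomial (Fin N) ℂ} (hF : IsEndo N q F) :
    ∃ K, ∀ m : Fin N →₀ ℕ, K < m.degree → ∀ a, monomial m a ∈ Ideal.span (Set.range F) := by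
  obtain ⟨K, hK⟩ := pow_mem_ideal hF
  refine ⟨N * K, fun m hm a => ?_⟩
  obtain ⟨i, hi⟩ : ∃ i, K ≤ m i := by
    by_contra! hcon
    have : m.degree ≤ ∑ i : Fin N, K := by
      rw [Finsupp.degree_eq_sum]
      exact Finset.sum_le_sum fun i _ => (hcon i).le
    simp at this
    omega
  have : monomial m a = monomial (m - Finsupp.single i K) a * X i ^ K := by
    rw [X_pow_eq_monomial, monomial_mul, mul_one]
    congr 1
    rw [tsub_add_cancel_of_le]
    simpa using hi
  rw [this]
  exact Ideal.mul_mem_left _ _ (hK i)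

lemma ringHom_finite_of {A B : Type*} [CommRing A] [CommRing B] (f : A →+* B) (G : Set B) (hG : G.Finite)
    (h : ∀ b : B, b ∈ AddSubmonoid.closure {x | ∃ a, ∃ g ∈ G, x = f a * g}) : f.Finite := by
  let := f.toAlgebra
  refine ⟨⟨hG.toFinset, ?_⟩⟩
  rw [eq_top_iff]
  intro b _
  rw [Set.Finite.coe_toFinset]
  refine AddSubmonoid.closure_induction (motive := fun b _ => b ∈ Submodule.span A G) ?_ ?_ ?_ (h b)
  · rintro x ⟨a, g, hg, rfl⟩
    exact Submodule.smul_mem _ a (Submodule.subset_span hg)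
  · exact Submodule.zero_mem _
  · intro x y _ _ hx hy
    exact Submodule.add_mem _ hx hy

lemma closure_mul {A B : Type*} [CommRing A] [CommRing B] (f : A →+* B) (G : Set B) (c : A) (b : B)
    (h : b ∈ AddSubmonoid.closure {x | ∃ a, ∃ g ∈ G, x = f a * g}) :
    b * f c ∈ AddSubmonoid.closure {x | ∃ a, ∃ g ∈ G, x = f a * g} := by
  refine AddSubmonoid.closure_induction (motive := fun b _ => b * f c ∈ AddSubmonoid.closure {x | ∃ a, ∃ g ∈ G, x = f a * g}) ?_ ?_ ?_ h
  · rintro x ⟨a, g, hg, rfl⟩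
    exact AddSubmonoid.subset_closure ⟨a * c, g, hg, by rw [map_mul]; ring⟩
  · simp
  · intro x y _ _ hx hy
    rw [add_mul]
    exact AddSubmonoid.add_mem _ hx hy

lemma finite_aeval {N q : ℕ} (hq : 1 ≤ q) {F : Fin N → MvPolynomial (Fin N) ℂ} (hF : IsEndo N q F) :
    (aeval F : MvPolynomial (Fin N) ℂ →ₐ[ℂ] MvPolynomial (Fin N) ℂ).toRingHom.Finite := by
  obtain ⟨K, hK⟩ := mono_mem_ideal hF
  refine ringHom_finite_of _ ((fun m => monomial m (1 : ℂ)) '' {m : Fin N →₀ ℕ | m.degree ≤ K}) ?_ ?_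
  · apply Set.Finite.image
    exact Finsupp.finite_of_degree_le K
  · intro b
    induction hn : b.totalDegree using Nat.strong_induction_on generalizing b with
    | _ n ih =>
    rw [b.as_sum]
    apply AddSubmonoid.sum_mem
    intro m hm
    have hmn : m.degree ≤ n := by rw [← hn]; exact le_totalDegree hm
    by_cases hmK : m.degree ≤ K
    · apply AddSubmonoid.subset_closure
      refine ⟨C (coeff m b), _, ⟨m, hmK, rfl⟩, ?_⟩
      simp [C_mul_monomial]
    · obtain ⟨s, hs⟩ := (Ideal.mem_span_range_iff_exists_fun).1 (hK m (by omega) (coeff m b))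
      have hs' : ∑ i, trc m.degree (s i * F i) = monomial m (coeff m b) := by
        rw [← map_sum, hs, trc_eq]
        exact (totalDegree_monomial_le _ _)
      rw [← hs']
      apply AddSubmonoid.sum_mem
      intro i _
      by_cases hqm : m.degree < q
      · rw [trc_mul_lt (hF.1 i) _ hqm]
        exact AddSubmonoid.zero_mem _
      · obtain ⟨e, he⟩ := Nat.exists_eq_add_of_le (not_lt.1 hqm)
        rw [he, add_comm, trc_mul (hF.1 i)]
        have h1 := trc_deg e (s i)
        have h2 := ih _ (by omega) (trc e (s i)) rfl
        have h3 := closure_mul _ _ (X i) _ h2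
        simpa using h3

open MvPolynomial

lemma deriv_aeval {N : ℕ} {M : Type*} [CommRing M] [Algebra ℂ M] (D : Derivation ℂ M M) (F : Fin N → M)
    (s : MvPolynomial (Fin N) ℂ) : D (aeval F s) = ∑ k, aeval F (pderiv k s) * D (F k) := by
  induction s using MvPolynomial.induction_on with
  | C a => simp
  | add p r hp hr => simp [hp, hr, add_mul, Finset.sum_add_distrib]
  | mul_X p i hp =>
    simp only [map_mul, aeval_X, Derivation.leibniz, hp, smul_eq_mul, pderiv_X, map_add, add_mul, Finset.sum_add_distrib,
      Finset.mul_sum]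
    congr 1
    · rw [Finset.sum_eq_single i]
      · simp
      · intro j _ hj; simp [hj]
      · simp
    · exact Finset.sum_congr rfl fun j _ => by ring

lemma deriv_eval_poly {A : Type*} [CommRing A] [Algebra ℂ A] (D : Derivation ℂ A A) (p : Polynomial A)
    (hp : ∀ i, D (p.coeff i) = 0) (x : A) : D (p.eval x) = p.derivative.eval x * D x := by
  rw [Polynomial.derivative_eval, Polynomial.eval_eq_sum, Polynomial.sum, Polynomial.sum, map_sum, Finset.sum_mul]
  apply Finset.sum_congr rfl
  intro i _
  rw [Derivation.leibniz, hp, Derivation.leibniz_pow]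
  simp only [smul_eq_mul, nsmul_eq_mul]
  ring

lemma deriv_zero_of_integral {A : Type*} [CommRing A] [IsDomain A] [Algebra ℂ A] (D : Derivation ℂ A A) (f : A →+* A)
    (hf : f.IsIntegral) (hD : ∀ s, D (f s) = 0) (x : A) : D x = 0 := by
  have : CharZero A := charZero_of_injective_algebraMap (algebraMap ℂ A).injective
  let T : Set (Polynomial A) := {p | p ≠ 0 ∧ (∀ i, D (p.coeff i) = 0) ∧ p.eval x = 0}
  have hT : T.Nonempty := by
    obtain ⟨p, hp, hpx⟩ := hf x
    refine ⟨p.map f, (hp.map f).ne_zero, fun i => ?_, ?_⟩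
    · rw [Polynomial.coeff_map, hD]
    · rw [Polynomial.eval_map, hpx]
  obtain ⟨p, ⟨hp0, hpD, hpx⟩, hmin⟩ := WellFounded.has_min (measure (fun p : Polynomial A => p.natDegree)).wf T hT
  have hd : p.natDegree ≠ 0 := by
    intro h0
    rw [Polynomial.eq_C_of_natDegree_eq_zero h0, Polynomial.eval_C] at hpx
    apply hp0
    rw [Polynomial.eq_C_of_natDegree_eq_zero h0, hpx, Polynomial.C_0]
  have h1 := deriv_eval_poly D p hpD x
  rw [hpx, map_zero] at h1
  rcases mul_eq_zero.1 h1.symm with h2 | h2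
  · exfalso
    refine hmin p.derivative ⟨?_, ?_, h2⟩ ?_
    · intro h3
      exact hd (Polynomial.derivative_eq_zero.1 h3)
    · intro i
      rw [Polynomial.coeff_derivative, Derivation.leibniz, hpD]
      have : D ((i : A) + 1) = 0 := by
        rw [show ((i : A) + 1) = algebraMap ℂ A (i + 1) by simp]
        exact D.map_algebraMap _
      simp [this]
    · exact Polynomial.natDegree_derivative_lt hd
  · exact h2

/-- transposed Jacobian matrix -/
noncomputable def jacT {N : ℕ} (F : Fin N → MvPolynomial (Fin N) ℂ) : Matrix (Fin N) (Fin N) (MvPolynomial (Fin N) ℂ) :=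
  Matrix.of fun i k => pderiv i (F k)

lemma jacT_det_ne {N q : ℕ} (hq : 1 ≤ q) {F : Fin N → MvPolynomial (Fin N) ℂ} (hF : IsEndo N q F) :
    (jacT F).det ≠ 0 := by
  intro h0
  obtain ⟨v, hv, hv0⟩ := Matrix.exists_vecMul_eq_zero_iff.2 h0
  let D : Derivation ℂ (MvPolynomial (Fin N) ℂ) (MvPolynomial (Fin N) ℂ) := ∑ i, v i • pderiv i
  have hD : ∀ p, D p = ∑ i, v i * pderiv i p := by
    intro p
    simp only [D]
    have : ∀ s : Finset (Fin N), (∑ i ∈ s, v i • pderiv i : Derivation ℂ (MvPolynomial (Fin N) ℂ) (MvPolynomial (Fin N) ℂ)) p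
        = ∑ i ∈ s, v i * pderiv i p := by
      intro s
      induction s using Finset.induction_on with
      | empty => simp
      | insert i s hi ih => rw [Finset.sum_insert hi, Finset.sum_insert hi, ← ih]; rfl
    exact this _
  apply hv
  ext1 i
  have h1 : D (X i) = 0 := by
    apply deriv_zero_of_integral D _ (finite_aeval hq hF).to_isIntegral
    intro s
    change D (aeval F s) = 0
    rw [deriv_aeval]
    apply Finset.sum_eq_zero
    intro k _
    have := congrFun hv0 k
    rw [hD]
    have h2 : ∑ i, v i * pderiv i (F k) = 0 := this
    rw [h2, mul_zero]
  rw [hD, Finset.sum_eq_single i] at h1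
  · simpa using h1
  · intro j _ hj; simp [pderiv_X, hj.symm]
  · simp

lemma eq_C_of_pderiv {N : ℕ} (s : MvPolynomial (Fin N) ℂ) (h : ∀ k, pderiv k s = 0) : s = C (coeff 0 s) := by
  ext m
  rw [coeff_C]
  split_ifs with hm
  · rw [← hm]
  · obtain ⟨k, hk⟩ : ∃ k, m k ≠ 0 := by
      by_contra! hc
      exact hm (by ext k; simp [hc k])
    have h1 := congrArg (coeff (m - Finsupp.single k 1)) (h k)
    rw [coeff_pderiv, tsub_add_cancel_of_le, coeff_zero] at h1
    · rcases mul_eq_zero.1 h1 with h2 | h2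
      · exact h2
      · exfalso
        norm_cast at h2
    · rw [Finsupp.single_le_iff]; omega

lemma pderiv_deg {N : ℕ} (s : MvPolynomial (Fin N) ℂ) (k : Fin N) (hs : s.totalDegree ≠ 0) :
    (pderiv k s).totalDegree < s.totalDegree := by
  rw [totalDegree, Finset.sup_lt_iff (by rw [bot_eq_zero']; omega)]
  intro m hm
  rw [mem_support_iff, coeff_pderiv] at hm
  have h1 : m + Finsupp.single k 1 ∈ s.support := by
    rw [mem_support_iff]
    exact left_ne_zero_of_mul hm
  have h2 := le_totalDegree h1
  rw [Finsupp.sum_add_index' (fun _ => rfl) (fun _ _ _ => rfl), Finsupp.sum_single_index rfl] at h2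
  omega

lemma aeval_inj {N q : ℕ} (hq : 1 ≤ q) {F : Fin N → MvPolynomial (Fin N) ℂ} (hF : IsEndo N q F) 
    (s : MvPolynomial (Fin N) ℂ) (hs : aeval F s = 0) : s = 0 := by
  induction hn : s.totalDegree using Nat.strong_induction_on generalizing s with
  | _ n ih =>
  have h0 : ∀ k, aeval F (pderiv k s) = 0 := by
    have := Matrix.eq_zero_of_mulVec_eq_zero (jacT_det_ne hq hF) (v := fun k => aeval F (pderiv k s)) ?_
    · exact fun k => congrFun this k
    · ext1 i
      have h1 := deriv_aeval (pderiv i) F s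
      rw [hs, map_zero] at h1
      rw [Pi.zero_apply, h1, Matrix.mulVec, dotProduct]
      exact Finset.sum_congr rfl fun k _ => mul_comm _ _
  have hC : s = C (coeff 0 s) := by
    by_cases hd : s.totalDegree = 0
    · exact totalDegree_eq_zero_iff_eq_C.1 hd
    · exact eq_C_of_pderiv s fun k => ih _ (hn ▸ pderiv_deg s k hd) _ (h0 k) rfl
  rw [hC, aeval_C, algebraMap_eq] at hs
  rw [hC, hs]

lemma dvd_of_integral {A : Type*} [CommRing A] [IsDomain A] (f : A →+* A) (hf : f.IsIntegral) (hinj : Function.Injective f)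
    (h b : A) (hh : Prime h) (hd : f h ∣ f b) : h ∣ b := by
  obtain ⟨x, hx⟩ := hd
  obtain ⟨p, hp, hpx⟩ := hf x
  have h1 := Polynomial.scaleRoots_eval₂_mul f (p := p) x h
  rw [hpx, mul_zero, ← hx, Polynomial.eval₂_at_apply] at h1
  have h2 := hinj (h1.trans (map_zero f).symm)
  rw [Polynomial.eval_eq_sum_range, Polynomial.natDegree_scaleRoots, Finset.sum_range_succ] at h2
  have h3 : h ∣ ∑ i ∈ Finset.range p.natDegree, (p.scaleRoots h).coeff i * b ^ i := by
    apply Finset.dvd_sum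
    intro i hi
    rw [Polynomial.coeff_scaleRoots]
    apply Dvd.dvd.mul_right
    apply Dvd.dvd.mul_left
    apply dvd_pow_self
    simp at hi; omega
  have h4 : h ∣ (p.scaleRoots h).coeff p.natDegree * b ^ p.natDegree := (dvd_add_right h3).1 (h2 ▸ dvd_zero h)
  rw [Polynomial.coeff_scaleRoots_natDegree, hp.leadingCoeff, one_mul] at h4
  exact hh.dvd_of_dvd_pow h4

lemma not_dvd_pderiv {N : ℕ} (h : MvPolynomial (Fin N) ℂ) (hp : Prime h) (k : Fin N) (hk : pderiv k h ≠ 0) : ¬ h ∣ pderiv k h := by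
  rintro ⟨x, hx⟩
  have h1 := pderiv_deg h k (totalDegree_pos_of_prime hp).ne'
  rw [hx] at hk h1
  rw [totalDegree_mul_of_isDomain (left_ne_zero_of_mul hk) (right_ne_zero_of_mul hk)] at h1
  omega

lemma exists_pderiv_ne {N : ℕ} (h : MvPolynomial (Fin N) ℂ) (hp : Prime h) : ∃ k, pderiv k h ≠ 0 := by
  by_contra! hc
  have h1 := eq_C_of_pderiv h hc
  have := totalDegree_pos_of_prime hp
  rw [h1, totalDegree_C] at this
  omega

lemma not_dvd_P {N q : ℕ} (hq : 1 ≤ q) {F : Fin N → MvPolynomial (Fin N) ℂ} (hF : IsEndo N q F)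
    (h : MvPolynomial (Fin N) ℂ) (hp : Prime h) {lam : ℂ} (hlam : lam ≠ 0) (hinv : aeval F h = C lam * h ^ q)
    (k : Fin N) (hk : pderiv k h ≠ 0) : ¬ h ∣ aeval F (pderiv k h) := by
  intro hd
  have h1 : aeval F h ∣ aeval F (pderiv k h ^ q) := by
    rw [hinv, map_pow]
    have : IsUnit (C lam : MvPolynomial (Fin N) ℂ) := (isUnit_iff_ne_zero.2 hlam).map C
    exact (this.mul_left_dvd).2 (pow_dvd_pow_of_dvd hd q)
  have h2 := dvd_of_integral (aeval F : MvPolynomial (Fin N) ℂ →ₐ[ℂ] MvPolynomial (Fin N) ℂ).toRingHom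
    (finite_aeval hq hF).to_isIntegral ((injective_iff_map_eq_zero _).2 (aeval_inj hq hF)) h (pderiv k h ^ q) hp h1
  exact not_dvd_pderiv h hp k hk (hp.dvd_of_dvd_pow h2)

open MvPolynomial

lemma det_homog {N q n : ℕ} (B : Matrix (Fin n) (Fin n) (MvPolynomial (Fin N) ℂ)) (hB : ∀ i j, (B i j).IsHomogeneous q) :
    B.det.IsHomogeneous (n * q) := by
  rw [Matrix.det_apply]
  apply IsHomogeneous.sum
  intro σ _
  have h1 : (∏ i, B (σ i) i).IsHomogeneous (∑ i : Fin n, q) := IsHomogeneous.prod _ _ _ fun i _ => hB _ _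
  simp only [Finset.sum_const, Finset.card_univ, Fintype.card_fin, smul_eq_mul] at h1
  rcases Int.units_eq_one_or (Equiv.Perm.sign σ) with h | h
  · rw [h, one_smul]; exact h1
  · rw [h, Units.neg_smul, one_smul]; exact h1.neg

lemma adj_homog {N q n : ℕ} (B : Matrix (Fin (n + 1)) (Fin (n + 1)) (MvPolynomial (Fin N) ℂ)) (hB : ∀ i j, (B i j).IsHomogeneous q)
    (i j : Fin (n + 1)) : (B.adjugate i j).IsHomogeneous (n * q) := by
  rw [Matrix.adjugate_fin_succ_eq_det_submatrix]
  have h1 := det_homog (B.submatrix j.succAbove i.succAbove) (fun a b => hB _ _)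
  have h2 : ((-1 : MvPolynomial (Fin N) ℂ) ^ (j + i : ℕ)).IsHomogeneous 0 := by
    have := (isHomogeneous_C (Fin N) (-1 : ℂ)).pow (j + i : ℕ)
    simpa using this
  simpa using h2.mul h1

/-- the map `(s, c) ↦ A s + c ∇h` -/
noncomputable def Psi {N : ℕ} (F : Fin N → MvPolynomial (Fin N) ℂ) (h : MvPolynomial (Fin N) ℂ) :
    ((Fin N → MvPolynomial (Fin N) ℂ) × MvPolynomial (Fin N) ℂ) →ₗ[MvPolynomial (Fin N) ℂ] (Fin N → MvPolynomial (Fin N) ℂ) :=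
  (jacT F).mulVecLin.coprod (LinearMap.toSpanSingleton _ _ (fun i => pderiv i h))

lemma Psi_apply {N : ℕ} (F : Fin N → MvPolynomial (Fin N) ℂ) (h : MvPolynomial (Fin N) ℂ) (x) :
    Psi F h x = (jacT F).mulVec x.1 + x.2 • (fun i => pderiv i h) := rfl

lemma jacT_P {N q : ℕ} (F : Fin N → MvPolynomial (Fin N) ℂ) (h : MvPolynomial (Fin N) ℂ) {lam : ℂ}
    (hinv : aeval F h = C lam * h ^ (q + 1)) :
    (jacT F).mulVec (fun k => aeval F (pderiv k h)) = (C (lam * (q + 1)) * h ^ q) • (fun i => pderiv i h) := by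
  ext1 i
  have h1 := deriv_aeval (pderiv i) F h
  rw [hinv, Derivation.leibniz, Derivation.leibniz_pow, pderiv_C] at h1
  simp only [Nat.add_sub_cancel, smul_eq_mul, nsmul_eq_mul, mul_zero, add_zero] at h1
  rw [Matrix.mulVec, dotProduct, Pi.smul_apply, smul_eq_mul]
  calc _ = ∑ k, aeval F (pderiv k h) * pderiv i (F k) := Finset.sum_congr rfl fun k _ => mul_comm _ _
    _ = _ := h1.symm
    _ = _ := by simp; ring

lemma C_unit {N : ℕ} {a : ℂ} (ha : a ≠ 0) : IsUnit (C a : MvPolynomial (Fin N) ℂ) := (isUnit_iff_ne_zero.2 ha).map C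

lemma lamq_ne {lam : ℂ} (hlam : lam ≠ 0) (q : ℕ) : lam * (q + 1) ≠ 0 :=
  mul_ne_zero hlam (by exact_mod_cast Nat.succ_ne_zero q)

lemma Psi_ker {N q : ℕ} {F : Fin N → MvPolynomial (Fin N) ℂ} (hF : IsEndo N (q + 1) F)
    (h : MvPolynomial (Fin N) ℂ) (hp : Prime h) {lam : ℂ} (hlam : lam ≠ 0) (hinv : aeval F h = C lam * h ^ (q + 1))
    (x) : Psi F h x = 0 ↔ ∃ e, x = (e • (fun k => aeval F (pderiv k h)), - (e * (C (lam * (q + 1)) * h ^ q))) := by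
  have hJ := jacT_P F h hinv
  have hk0 : (C (lam * (q + 1)) * h ^ q : MvPolynomial (Fin N) ℂ) ≠ 0 :=
    mul_ne_zero (C_unit (lamq_ne hlam q)).ne_zero (pow_ne_zero _ hp.ne_zero)
  constructor
  · intro hx
    rw [Psi_apply] at hx
    have h1 : (jacT F).mulVec ((C (lam * (q + 1)) * h ^ q) • x.1 + x.2 • (fun k => aeval F (pderiv k h))) = 0 := by
      rw [Matrix.mulVec_add, Matrix.mulVec_smul, Matrix.mulVec_smul, hJ, smul_comm x.2, ← smul_add, hx, smul_zero]
    have h2 := Matrix.eq_zero_of_mulVec_eq_zero (jacT_det_ne (by omega) hF) h1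
    obtain ⟨k, hk⟩ := exists_pderiv_ne h hp
    have hnd := not_dvd_P (by omega) hF h hp hlam hinv k hk
    have h3 : h ^ q ∣ x.2 * aeval F (pderiv k h) := by
      have := congrFun h2 k
      simp only [Pi.add_apply, Pi.smul_apply, smul_eq_mul, Pi.zero_apply] at this
      refine ⟨- (C (lam * (q + 1)) * x.1 k), ?_⟩
      linear_combination this
    have h4 : h ^ q ∣ x.2 := hp.pow_dvd_of_dvd_mul_right q hnd h3
    have h5 : C (lam * (q + 1)) * h ^ q ∣ x.2 := (C_unit (lamq_ne hlam q)).mul_left_dvd.2 h4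
    obtain ⟨e, he⟩ := h5
    refine ⟨-e, Prod.ext ?_ ?_⟩
    · ext1 i
      have := congrFun h2 i
      simp only [Pi.add_apply, Pi.smul_apply, smul_eq_mul, Pi.zero_apply] at this ⊢
      apply mul_left_cancel₀ hk0
      rw [he] at this
      linear_combination this
    · rw [he]; ring
  · rintro ⟨e, rfl⟩
    rw [Psi_apply]
    simp only
    rw [Matrix.mulVec_smul, hJ, smul_smul, ← add_smul, add_neg_cancel, zero_smul]

noncomputable def prodSubEquiv {K V W : Type*} [Field K] [AddCommGroup V] [Module K V] [AddCommGroup W] [Module K W]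
    (p : Submodule K V) (r : Submodule K W) : (p.prod r) ≃ₗ[K] (p × r) where
  toFun x := (⟨x.1.1, x.2.1⟩, ⟨x.1.2, x.2.2⟩)
  invFun y := ⟨(y.1.1, y.2.1), ⟨y.1.2, y.2.2⟩⟩
  map_add' _ _ := rfl
  map_smul' _ _ := rfl
  left_inv _ := rfl
  right_inv _ := rfl

lemma dm_imA {N q d : ℕ} (hN : 0 < N) {F : Fin N → MvPolynomial (Fin N) ℂ} (hF : IsEndo N (q + 1) F)
    (h : MvPolynomial (Fin N) ℂ) (hp : Prime h) (hhom : h.IsHomogeneous (d + 1))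
    {lam : ℂ} (hlam : lam ≠ 0) (hinv : aeval F h = C lam * h ^ (q + 1)) (s t : ℕ) (hst : t = s + d * q + d + q) :
    dm (LinearMap.range (Psi F h)) t + bFn N s = N * bFn N (t - q) + bFn N (t - d) := by
  let W : Submodule ℂ ((Fin N → MvPolynomial (Fin N) ℂ) × MvPolynomial (Fin N) ℂ) := (Vd N (t - q)).prod (Pd N (t - d))
  have hA : ∀ i k, (jacT F i k).IsHomogeneous q := fun i k => by
    exact (hF.1 k).pderiv (i := i)
  have hn : ∀ i, (pderiv i h).IsHomogeneous d := fun i => by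
    have := hhom.pderiv (i := i)
    simpa using this
  have hP : ∀ k, (aeval F (pderiv k h)).IsHomogeneous ((q + 1) * d) := fun k => (hn k).aeval F hF.1
  have hfd : FiniteDimensional ℂ W := LinearEquiv.finiteDimensional (prodSubEquiv (Vd N (t - q)) (Pd N (t - d))).symm
  have hfW : Module.finrank ℂ W = N * bFn N (t - q) + bFn N (t - d) := by
    rw [LinearEquiv.finrank_eq (prodSubEquiv (Vd N (t - q)) (Pd N (t - d))), Module.finrank_prod, finrank_Vd N hN, finrank_Pd N hN]
  have hrn := rank_null ((Psi F h).restrictScalars ℂ) W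
  rw [hfW] at hrn
  rw [← hrn]
  congr 1
  · rw [dm]
    suffices hs : (LinearMap.range (Psi F h)).restrictScalars ℂ ⊓ Vd N t = W.map ((Psi F h).restrictScalars ℂ) by rw [hs]
    ext m
    constructor
    · rintro ⟨⟨⟨s', c⟩, hm⟩, hmt⟩
      refine ⟨(fun k => trc (t - q) (s' k), trc (t - d) c), ⟨mem_Vd.2 fun k => trc_deg _ _, mem_Pd.2 (trc_deg _ _)⟩, ?_⟩
      rw [LinearMap.coe_restrictScalars]
      rw [← hm]
      ext1 i
      have h1 := trc_eq t (m i) (mem_Vd.1 hmt i)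
      rw [← hm] at h1
      rw [← h1]
      simp only [Psi_apply, Matrix.mulVec, dotProduct, Pi.add_apply, Pi.smul_apply, smul_eq_mul, map_add, map_sum]
      congr 1
      · apply Finset.sum_congr rfl
        intro k _
        have := trc_mul (hA i k) (t - q) (s' k)
        rw [show t - q + q = t by omega] at this
        rw [mul_comm (jacT F i k) (s' k), this, mul_comm]
      · have := trc_mul (hn i) (t - d) c
        rw [show t - d + d = t by omega] at this
        rw [this]
    · rintro ⟨⟨s', c⟩, ⟨hs, hc⟩, rfl⟩
      refine ⟨⟨_, rfl⟩, mem_Vd.2 fun i => ?_⟩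
      have hs1 := mem_Vd.1 hs
      have hc1 := mem_Pd.1 hc
      simp only at hs1 hc1
      simp only [LinearMap.coe_restrictScalars, Psi_apply, Matrix.mulVec, dotProduct, Pi.add_apply, Pi.smul_apply, smul_eq_mul]
      refine (totalDegree_add _ _).trans (max_le ?_ ?_)
      · refine (totalDegree_finsetSum _ _).trans (Finset.sup_le fun k _ => ?_)
        refine (totalDegree_mul _ _).trans ?_
        have := (hA i k).totalDegree_le
        have := hs1 k
        omega
      · refine (totalDegree_mul _ _).trans ?_
        have := (hn i).totalDegree_le
        omega
  · rw [← finrank_Pd N hN s]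
    let κ : MvPolynomial (Fin N) ℂ := C (lam * (q + 1)) * h ^ q
    have hk0 : κ ≠ 0 :=
      mul_ne_zero (C_unit (lamq_ne hlam q)).ne_zero (pow_ne_zero _ hp.ne_zero)
    have hκd : κ.totalDegree = q * (d + 1) := by
      have : κ.IsHomogeneous (0 + (d + 1) * q) := (isHomogeneous_C _ _).mul (hhom.pow q)
      rw [this.totalDegree hk0]; ring
    let E : MvPolynomial (Fin N) ℂ →ₗ[ℂ] ((Fin N → MvPolynomial (Fin N) ℂ) × MvPolynomial (Fin N) ℂ) :=
      { toFun := fun e => (e • (fun k => aeval F (pderiv k h)), - (e * κ))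
        map_add' := fun x y => by
          refine Prod.ext ?_ ?_
          · simp [add_smul]
          · simp; ring
        map_smul' := fun a x => by
          refine Prod.ext ?_ ?_
          · simp
          · simp }
    have hE : Function.Injective E := by
      intro x y hxy
      have := congrArg Prod.snd hxy
      simp only [E, LinearMap.coe_mk, AddHom.coe_mk, neg_inj] at this
      exact mul_right_cancel₀ hk0 this
    rw [LinearEquiv.finrank_eq (Submodule.equivMapOfInjective E hE (Pd N s))]
    suffices hs : (Pd N s).map E = W ⊓ LinearMap.ker ((Psi F h).restrictScalars ℂ) by rw [hs]
    ext x
    rw [Submodule.mem_inf, LinearMap.mem_ker, LinearMap.coe_restrictScalars, Psi_ker hF h hp hlam hinv]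
    constructor
    · rintro ⟨e, he, rfl⟩
      have he1 := mem_Pd.1 he
      refine ⟨⟨mem_Vd.2 fun k => ?_, mem_Pd.2 ?_⟩, e, rfl⟩
      · refine (totalDegree_mul _ _).trans ?_
        have := (hP k).totalDegree_le
        beta_reduce
        have e1 : (q + 1) * d = d * q + d := by ring
        omega
      · change (-(e * κ)).totalDegree ≤ _
        rw [totalDegree_neg]
        refine (totalDegree_mul _ _).trans ?_
        have e1 : q * (d + 1) = d * q + q := by ring
        omega
    · rintro ⟨⟨_, hx⟩, e, rfl⟩
      refine ⟨e, mem_Pd.2 ?_, rfl⟩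
      have hx1 : (-(e * κ)).totalDegree ≤ t - d := mem_Pd.1 hx
      rw [totalDegree_neg] at hx1
      by_cases he : e = 0
      · simp [he]
      · rw [totalDegree_mul_of_isDomain he hk0] at hx1
        have e1 : q * (d + 1) = d * q + q := by ring
        omega

open MvPolynomial

/-- linear form with weights `w` -/
noncomputable def phi {N : ℕ} (w : Fin N → MvPolynomial (Fin N) ℂ) :
    (Fin N → MvPolynomial (Fin N) ℂ) →ₗ[MvPolynomial (Fin N) ℂ] MvPolynomial (Fin N) ℂ :=
  ∑ i, w i • LinearMap.proj i

lemma phi_apply {N : ℕ} (w m : Fin N → MvPolynomial (Fin N) ℂ) : phi w m = ∑ i, w i * m i := by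
  simp [phi]

/-- weights of the 2x2 minors -/
noncomputable def wv {N : ℕ} (F : Fin N → MvPolynomial (Fin N) ℂ) (h : MvPolynomial (Fin N) ℂ) (p : Fin N × Fin N) (i : Fin N) :
    MvPolynomial (Fin N) ℂ :=
  (jacT F).adjugate p.1 i * aeval F (pderiv p.2 h) - (jacT F).adjugate p.2 i * aeval F (pderiv p.1 h)

lemma phi_wv {N : ℕ} (F : Fin N → MvPolynomial (Fin N) ℂ) (h : MvPolynomial (Fin N) ℂ) (k l : Fin N) (m) :
    phi (wv F h (k, l)) m = (jacT F).adjugate.mulVec m k * aeval F (pderiv l h) - (jacT F).adjugate.mulVec m l * aeval F (pderiv k h) := by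
  rw [phi_apply, Matrix.mulVec, Matrix.mulVec, dotProduct, dotProduct, Finset.sum_mul, Finset.sum_mul, ← Finset.sum_sub_distrib]
  apply Finset.sum_congr rfl
  intro i _
  rw [wv]
  ring

/-- the reflexive hull -/
noncomputable def Mr {N : ℕ} (F : Fin N → MvPolynomial (Fin N) ℂ) (h : MvPolynomial (Fin N) ℂ) :
    Submodule (MvPolynomial (Fin N) ℂ) (Fin N → MvPolynomial (Fin N) ℂ) :=
  (Finset.univ : Finset (Fin N × Fin N)).inf fun p => Submodule.comap (phi (wv F h p)) (Ideal.span {(jacT F).det})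

lemma mem_Mr {N : ℕ} {F : Fin N → MvPolynomial (Fin N) ℂ} {h : MvPolynomial (Fin N) ℂ} {m} :
    m ∈ Mr F h ↔ ∀ p, (jacT F).det ∣ phi (wv F h p) m := by
  rw [Mr, Submodule.mem_finsetInf]
  simp only [Finset.mem_univ, true_imp_iff, Submodule.mem_comap, Ideal.mem_span_singleton]

lemma imA_le_Mr {N q : ℕ} {F : Fin N → MvPolynomial (Fin N) ℂ} 
    (h : MvPolynomial (Fin N) ℂ) (hp : Prime h) {lam : ℂ} (hlam : lam ≠ 0) (hinv : aeval F h = C lam * h ^ (q + 1)) :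
    LinearMap.range (Psi F h) ≤ Mr F h := by
  have hJ := jacT_P F h hinv
  have hk0 : (C (lam * (q + 1)) * h ^ q : MvPolynomial (Fin N) ℂ) ≠ 0 :=
    mul_ne_zero (C_unit (lamq_ne hlam q)).ne_zero (pow_ne_zero _ hp.ne_zero)
  rintro _ ⟨⟨s, c⟩, rfl⟩
  rw [mem_Mr]
  rintro ⟨k, l⟩
  rw [Psi_apply, map_add, map_smul]
  apply dvd_add
  · rw [phi_wv, Matrix.mulVec_mulVec, Matrix.adjugate_mul, Matrix.smul_mulVec, Matrix.one_mulVec]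
    simp only [Pi.smul_apply, smul_eq_mul, mul_assoc]
    rw [← mul_sub]
    exact dvd_mul_right _ _
  · have h1 : (C (lam * (q + 1)) * h ^ q) * phi (wv F h (k, l)) (fun i => pderiv i h) = 0 := by
      rw [← smul_eq_mul, ← map_smul, ← hJ, phi_wv, Matrix.mulVec_mulVec, Matrix.adjugate_mul, Matrix.smul_mulVec, Matrix.one_mulVec]
      simp only [Pi.smul_apply, smul_eq_mul]
      ring
    rw [(mul_eq_zero.1 h1).resolve_left hk0, smul_zero]
    exact dvd_zero _

lemma dvd_of_no_common {A ι : Type*} [CommRing A] [IsDomain A] [UniqueFactorizationMonoid A] (f : ι → A) 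
    (hf : ∀ p, Prime p → ∃ i, ¬ p ∣ f i) (i₀ : ι) (hi₀ : f i₀ ≠ 0) (g : A) :
    ∀ u, (∀ i, g ∣ u * f i) → g ∣ u := by
  induction g using UniqueFactorizationMonoid.induction_on_prime with
  | h₁ => 
    intro u h
    have := zero_dvd_iff.1 (h i₀)
    rw [(mul_eq_zero.1 this).resolve_right hi₀]
  | h₂ x hx => intro u _; exact hx.dvd
  | h₃ w p hw hp ih =>
    intro u h
    obtain ⟨i, hi⟩ := hf p hp
    have h1 : p ∣ u := (hp.dvd_or_dvd ((dvd_mul_right _ _).trans (h i))).resolve_right hi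
    obtain ⟨u', rfl⟩ := h1
    apply mul_dvd_mul_left
    apply ih
    intro i
    have := h i
    rw [mul_assoc] at this
    exact (mul_dvd_mul_iff_left hp.ne_zero).1 this

lemma no_common {N d : ℕ} (h : MvPolynomial (Fin N) ℂ) (hp : Prime h) (hhom : h.IsHomogeneous (d + 1)) (p : MvPolynomial (Fin N) ℂ)
    (hpp : Prime p) : ∃ i, ¬ p ∣ pderiv i h := by
  by_contra! hc
  have h1 := hhom.sum_X_mul_pderiv
  have h2 : p ∣ h := by
    have h3 : p ∣ C ((d : ℂ) + 1) * h := by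
      have : (C ((d : ℂ) + 1) * h) = (d + 1) • h := by simp
      rw [this, ← h1]
      exact Finset.dvd_sum fun i _ => (hc i).mul_left _
    have hu : IsUnit (C ((d : ℂ) + 1) : MvPolynomial (Fin N) ℂ) := C_unit (by exact_mod_cast Nat.succ_ne_zero d)
    exact (hu.dvd_mul_left).1 h3
  obtain ⟨k, hk⟩ := exists_pderiv_ne h hp
  exact not_dvd_pderiv h hp k hk (((hpp.irreducible.associated_of_dvd hp.irreducible h2).symm.dvd).trans (hc k))

lemma P_smul_Mr {N q d : ℕ} {F : Fin N → MvPolynomial (Fin N) ℂ} (hF : IsEndo N (q + 1) F)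
    (h : MvPolynomial (Fin N) ℂ) (hp : Prime h) (hhom : h.IsHomogeneous (d + 1))
    {lam : ℂ} (hinv : aeval F h = C lam * h ^ (q + 1)) (m) (hm : m ∈ Mr F h) (l : Fin N) :
    aeval F (pderiv l h) • m ∈ LinearMap.range (Psi F h) := by
  have hJ := jacT_P F h hinv
  have hD := jacT_det_ne (by omega) hF
  rw [mem_Mr] at hm
  have hm' := fun k => hm (k, l)
  choose ψ hψ using hm'
  set u := (jacT F).adjugate.mulVec m with hu
  set P : Fin N → MvPolynomial (Fin N) ℂ := fun k => aeval F (pderiv k h) with hP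
  set κ : MvPolynomial (Fin N) ℂ := C (lam * (q + 1)) * h ^ q
  set D := (jacT F).det
  have h1 : P l • u = D • ψ + u l • P := by
    ext1 k
    have := hψ k
    rw [phi_wv] at this
    simp only [Pi.smul_apply, Pi.add_apply, smul_eq_mul]
    linear_combination this
  have h2 : D • P l • m = D • (jacT F).mulVec ψ + (u l * κ) • (fun i => pderiv i h) := by
    have h3 : (jacT F).mulVec u = D • m := by
      rw [hu, Matrix.mulVec_mulVec, Matrix.mul_adjugate, Matrix.smul_mulVec, Matrix.one_mulVec]
    have h4 := congrArg (jacT F).mulVec h1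
    rw [Matrix.mulVec_smul, h3, Matrix.mulVec_add, Matrix.mulVec_smul, Matrix.mulVec_smul, hJ, smul_smul (u l)] at h4
    rw [smul_comm, h4]
  obtain ⟨k₀, hk₀⟩ := exists_pderiv_ne h hp
  have h5 : D ∣ u l * κ := by
    refine dvd_of_no_common (fun i => pderiv i h) (no_common h hp hhom) k₀ hk₀ D _ fun i => ?_
    have := congrFun h2 i
    simp only [Pi.smul_apply, Pi.add_apply, smul_eq_mul] at this
    refine ⟨P l * m i - (jacT F).mulVec ψ i, ?_⟩
    linear_combination -this
  obtain ⟨c, hc⟩ := h5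
  refine ⟨(ψ, c), ?_⟩
  rw [Psi_apply]
  rw [hc, mul_smul, ← smul_add] at h2
  exact (smul_right_injective _ hD h2).symm

/-- coordinatewise truncation -/
noncomputable def trv {N : ℕ} (t : ℕ) (m : Fin N → MvPolynomial (Fin N) ℂ) : Fin N → MvPolynomial (Fin N) ℂ := fun i => trc t (m i)

lemma wv_homog {n q d : ℕ} {F : Fin (n + 1) → MvPolynomial (Fin (n + 1)) ℂ} (hF : IsEndo (n + 1) (q + 1) F)
    (h : MvPolynomial (Fin (n + 1)) ℂ) (hhom : h.IsHomogeneous (d + 1)) (p i) :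
    (wv F h p i).IsHomogeneous (n * q + (q + 1) * d) := by
  have hA : ∀ i k, (jacT F i k).IsHomogeneous q := fun i k => (hF.1 k).pderiv (i := i)
  have hn : ∀ i, (pderiv i h).IsHomogeneous d := fun i => hhom.pderiv (i := i)
  have hP : ∀ k, (aeval F (pderiv k h)).IsHomogeneous ((q + 1) * d) := fun k => (hn k).aeval F hF.1
  rw [wv]
  exact ((adj_homog _ hA _ _).mul (hP _)).sub ((adj_homog _ hA _ _).mul (hP _))

lemma jacT_det_homog {N q : ℕ} {F : Fin N → MvPolynomial (Fin N) ℂ} (hF : IsEndo N (q + 1) F) :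
    (jacT F).det.IsHomogeneous (N * q) := det_homog _ fun i k => (hF.1 k).pderiv (i := i)

lemma trv_mem {n q d : ℕ} (hd : 1 ≤ d) {F : Fin (n + 1) → MvPolynomial (Fin (n + 1)) ℂ} (hF : IsEndo (n + 1) (q + 1) F)
    (h : MvPolynomial (Fin (n + 1)) ℂ) (hhom : h.IsHomogeneous (d + 1)) (m) (hm : m ∈ Mr F h) (t : ℕ) :
    trv t m ∈ Mr F h := by
  rw [mem_Mr] at hm ⊢
  intro p
  obtain ⟨y, hy⟩ := hm p
  have h1 : phi (wv F h p) (trv t m) = trc (t + (n * q + (q + 1) * d)) (phi (wv F h p) m) := by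
    rw [phi_apply, phi_apply, map_sum]
    apply Finset.sum_congr rfl
    intro i _
    rw [mul_comm _ (m i), trc_mul (wv_homog hF h hhom p i), mul_comm, trv]
  obtain ⟨a, ha⟩ : ∃ a, n * q + (q + 1) * d = a + (n + 1) * q := by
    refine ⟨(q + 1) * d - q, ?_⟩
    have : q ≤ (q + 1) * d := by nlinarith
    have e : (n + 1) * q = n * q + q := by ring
    omega
  rw [h1, hy, mul_comm _ y, ha, ← add_assoc, trc_mul (jacT_det_homog hF)]
  exact dvd_mul_left _ _

open MvPolynomial

lemma graded_gen {N : ℕ} (M' : Submodule (MvPolynomial (Fin N) ℂ) (Fin N → MvPolynomial (Fin N) ℂ))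
    (htr : ∀ m ∈ M', ∀ t, trv t m ∈ M') :
    ∃ (k : ℕ) (m : Fin k → Fin N → MvPolynomial (Fin N) ℂ), (∀ j, m j ∈ M') ∧
      ∀ t, ∀ x ∈ M', x ∈ Vd N t → ∃ s : Fin k → MvPolynomial (Fin N) ℂ, (∀ j, s j ∈ Pd N t) ∧ x = ∑ j, s j • m j := by
  obtain ⟨r, g, hg⟩ := Submodule.fg_iff_exists_fin_generating_family.1 (IsNoetherian.noetherian M')
  have hgM : ∀ j, g j ∈ M' := fun j => hg ▸ Submodule.subset_span ⟨j, rfl⟩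
  let E := Finset.univ.sup fun p : Fin r × Fin N => (g p.1 p.2).totalDegree
  let hv : ℕ → (Fin N → MvPolynomial (Fin N) ℂ) → (Fin N → MvPolynomial (Fin N) ℂ) := fun e m i => homogeneousComponent e (m i)
  have hvM : ∀ e, ∀ m ∈ M', hv e m ∈ M' := by
    intro e m hm
    cases e with
    | zero =>
      have := htr m hm 0
      convert this using 1
      ext1 i
      simp [hv, trv, trc]
    | succ e =>
      have := M'.sub_mem (htr m hm (e + 1)) (htr m hm e)
      convert this using 1
      ext1 i
      simp only [hv, trv, trc, Pi.sub_apply]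
      rw [Finset.sum_range_succ, LinearMap.add_apply, add_sub_cancel_left]
  let ι := Fin r × Fin (E + 1)
  let eq := Fintype.equivFin ι
  refine ⟨Fintype.card ι, fun j => hv (eq.symm j).2 (g (eq.symm j).1), fun j => hvM _ _ (hgM _), ?_⟩
  intro t x hx hxt
  rw [← hg, Submodule.mem_span_range_iff_exists_fun] at hx
  obtain ⟨s, hs⟩ := hx
  let s' : ι → MvPolynomial (Fin N) ℂ := fun p => if (p.2 : ℕ) ≤ t then trc (t - p.2) (s p.1) else 0
  refine ⟨fun j => s' (eq.symm j), fun j => ?_, ?_⟩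
  · simp only [s']
    split_ifs with hc
    · exact mem_Pd.2 ((trc_deg _ _).trans (by omega))
    · exact Submodule.zero_mem _
  · rw [Equiv.sum_comp eq.symm (fun p => s' p • hv p.2 (g p.1)), Fintype.sum_prod_type]
    ext1 i
    rw [← trc_eq t (x i) (mem_Vd.1 hxt i), ← hs]
    simp only [Finset.sum_apply, Pi.smul_apply, smul_eq_mul, map_sum]
    apply Finset.sum_congr rfl
    intro j _
    have h1 : g j i = ∑ e : Fin (E + 1), hv e (g j) i := by
      have hle : (g j i).totalDegree ≤ E := 
        Finset.le_sup (f := fun p : Fin r × Fin N => (g p.1 p.2).totalDegree) (Finset.mem_univ (j, i))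
      rw [Fin.sum_univ_eq_sum_range (fun e => hv e (g j) i) (E + 1)]
      have := trc_eq E (g j i) hle
      rw [trc, LinearMap.sum_apply] at this
      exact this.symm
    conv_lhs => rw [h1]
    rw [Finset.mul_sum, map_sum]
    apply Finset.sum_congr rfl
    intro e _
    have hh : (hv e (g j) i).IsHomogeneous e := homogeneousComponent_isHomogeneous _ _
    simp only [s']
    split_ifs with hc
    · have := trc_mul hh (t - e) (s j)
      rw [show t - (e : ℕ) + e = t by omega] at this
      exact this
    · rw [trc_mul_lt hh t (by omega), zero_mul]

instance (N t : ℕ) : FiniteDimensional ℂ (Pd N t) := by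
  infer_instance

lemma small_term {N : ℕ} (M' M₀ : Submodule (MvPolynomial (Fin N) ℂ) (Fin N → MvPolynomial (Fin N) ℂ))
    (htr : ∀ m ∈ M', ∀ t, trv t m ∈ M') (I : Ideal (MvPolynomial (Fin N) ℂ)) (hI : ∀ a ∈ I, ∀ m ∈ M', a • m ∈ M₀) :
    ∃ k, ∀ t, dm M' t ≤ dm M₀ t + k * Module.finrank ℂ ((Pd N t).map (I.restrictScalars ℂ).mkQ) := by
  obtain ⟨k, m, hm, hgen⟩ := graded_gen M' htr
  refine ⟨k, fun t => ?_⟩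
  let L : (Fin N → MvPolynomial (Fin N) ℂ) →ₗ[ℂ] _ := (M₀.restrictScalars ℂ).mkQ
  have hrn := rank_null L (M'.restrictScalars ℂ ⊓ Vd N t)
  have h1 : Module.finrank ℂ ((M'.restrictScalars ℂ ⊓ Vd N t) ⊓ LinearMap.ker L : Submodule ℂ _) ≤ dm M₀ t := by
    apply Submodule.finrank_mono
    rintro x ⟨⟨_, hx1⟩, hx2⟩
    refine ⟨?_, hx1⟩
    simpa [L] using hx2
  let θ : Fin k → ((MvPolynomial (Fin N) ℂ ⧸ I.restrictScalars ℂ) →ₗ[ℂ] ((Fin N → MvPolynomial (Fin N) ℂ) ⧸ M₀.restrictScalars ℂ)) :=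
    fun j => (I.restrictScalars ℂ).liftQ (L ∘ₗ (LinearMap.toSpanSingleton (MvPolynomial (Fin N) ℂ) _ (m j)).restrictScalars ℂ) (by
      intro a ha
      simp only [L, LinearMap.mem_ker, LinearMap.comp_apply, LinearMap.coe_restrictScalars, LinearMap.toSpanSingleton_apply,
        Submodule.mkQ_apply, Submodule.Quotient.mk_eq_zero]
      exact hI a ha _ (hm j))
  let Qt := (Pd N t).map (I.restrictScalars ℂ).mkQ
  let Θ : (Fin k → Qt) →ₗ[ℂ] ((Fin N → MvPolynomial (Fin N) ℂ) ⧸ M₀.restrictScalars ℂ) :=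
    ∑ j, (θ j ∘ₗ Qt.subtype) ∘ₗ LinearMap.proj j
  have h2 : (M'.restrictScalars ℂ ⊓ Vd N t).map L ≤ LinearMap.range Θ := by
    rintro _ ⟨x, ⟨hx1, hx2⟩, rfl⟩
    obtain ⟨s, hs, rfl⟩ := hgen t x hx1 hx2
    refine ⟨fun j => ⟨_, Submodule.mem_map_of_mem (hs j)⟩, ?_⟩
    simp only [Θ, LinearMap.sum_apply, map_sum]
    rfl
  have h3 := Submodule.finrank_mono h2
  have h4 := LinearMap.finrank_range_le Θ
  rw [Module.finrank_pi_fintype] at h4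
  simp only [Finset.sum_const, Finset.card_univ, Fintype.card_fin, smul_eq_mul] at h4
  change _ ≤ k * Module.finrank ℂ ((Pd N t).map (I.restrictScalars ℂ).mkQ) at h4
  have h5 : dm M' t = Module.finrank ℂ (M'.restrictScalars ℂ ⊓ Vd N t : Submodule ℂ _) := rfl
  omega

open MvPolynomial

lemma krull_le_of_integral {R S : Type*} [CommRing R] [CommRing S] (f : R →+* S) (hf : f.IsIntegral) (hinj : Function.Injective f) :
    ringKrullDim R ≤ ringKrullDim S := by
  let := f.toAlgebra
  have : Algebra.IsIntegral R S := ⟨hf⟩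
  have hinj' : Function.Injective (algebraMap R S) := hinj
  rw [ringKrullDim, ringKrullDim, Order.krullDim, Order.krullDim]
  apply iSup_le
  intro l
  obtain ⟨P, -, hP, hPc⟩ := Ideal.exists_ideal_over_prime_of_isIntegral l.head.asIdeal (⊥ : Ideal S) (by
    intro x hx
    have : algebraMap R S x = 0 := hx
    rw [(injective_iff_map_eq_zero _).1 hinj' x this]
    exact zero_mem _)
  have : P.LiesOver l.head.asIdeal := ⟨hPc.symm⟩
  obtain ⟨L, hL, -⟩ := Ideal.exists_ltSeries_of_hasGoingUp l P
  rw [← hL]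
  exact le_iSup (fun p : LTSeries (PrimeSpectrum S) => (p.length : WithBot ℕ∞)) L

lemma finrank_Pd_le (e t : ℕ) : Module.finrank ℂ (Pd e t) ≤ bFn e t := by
  rcases Nat.eq_zero_or_pos e with rfl | he
  · have h1 : Module.finrank ℂ (MvPolynomial (Fin 0) ℂ) = 1 := by
      rw [LinearEquiv.finrank_eq (MvPolynomial.isEmptyAlgEquiv ℂ (Fin 0)).toLinearEquiv, Module.finrank_self]
    have : Module.Finite ℂ (MvPolynomial (Fin 0) ℂ) := 
      Module.Finite.equiv (MvPolynomial.isEmptyAlgEquiv ℂ (Fin 0)).toLinearEquiv.symm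
    have h2 := Submodule.finrank_le (Pd 0 t)
    simp [bFn]; omega
  · exact (finrank_Pd e he t).le

lemma finite_gens {B A : Type*} [CommRing B] [CommRing A] (β : B →+* A) (hβ : β.Finite) :
    ∃ (r : ℕ) (g : Fin r → A), ∀ a : A, ∃ b : Fin r → B, a = ∑ k, β (b k) * g k := by
  let := β.toAlgebra
  obtain ⟨r, g, hg⟩ := Submodule.fg_iff_exists_fin_generating_family.1 hβ.fg_top
  refine ⟨r, g, fun a => ?_⟩
  have : a ∈ Submodule.span B (Set.range g) := by rw [hg]; trivial
  obtain ⟨c, hc⟩ := Submodule.mem_span_range_iff_exists_fun _ |>.1 this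
  exact ⟨c, hc.symm⟩

lemma pi_fd (e r s : ℕ) : FiniteDimensional ℂ (Submodule.pi Set.univ fun _ : Fin r => Pd e s) ∧
     Module.finrank ℂ (Submodule.pi Set.univ fun _ : Fin r => Pd e s) ≤ r * bFn e s := by
  let eq : (Submodule.pi Set.univ fun _ : Fin r => Pd e s) ≃ₗ[ℂ] (Fin r → Pd e s) :=
    { toFun := fun x i => ⟨x.1 i, x.2 i trivial⟩
      invFun := fun y => ⟨fun i => (y i).1, fun i _ => (y i).2⟩
      map_add' := fun _ _ => rfl
      map_smul' := fun _ _ => rfl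
      left_inv := fun _ => rfl
      right_inv := fun _ => rfl }
  refine ⟨LinearEquiv.finiteDimensional eq.symm, ?_⟩
  rw [LinearEquiv.finrank_eq eq, Module.finrank_pi_fintype]
  simp only [Finset.sum_const, Finset.card_univ, Fintype.card_fin, smul_eq_mul]
  exact Nat.mul_le_mul_left _ (finrank_Pd_le e s)

lemma fin_bdd {ι : Type*} [Fintype ι] (f : ι → ℕ) : ∃ D, ∀ i, f i ≤ D :=
  ⟨Finset.univ.sup f, fun i => Finset.le_sup (Finset.mem_univ i)⟩

lemma growth_core {N e r : ℕ} {A : Type*} [CommRing A] [Algebra ℂ A] (π : MvPolynomial (Fin N) ℂ →ₐ[ℂ] A)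
    (β : MvPolynomial (Fin e) ℂ →ₐ[ℂ] A) (g : Fin r → A) (b : A → Fin r → MvPolynomial (Fin e) ℂ)
    (hb : ∀ a, a = ∑ k, β (b a k) * g k) :
    ∃ δ, ∃ Θ : (Fin r → MvPolynomial (Fin e) ℂ) →ₗ[ℂ] A, ∀ t, (Pd N t).map π.toLinearMap ≤
      (Submodule.pi Set.univ fun _ : Fin r => Pd e (δ + t * δ)).map Θ := by
  obtain ⟨δ, hδ1, hδ2⟩ : ∃ δ, (∀ k, (b 1 k).totalDegree ≤ δ) ∧ ∀ i j k, (b (π (X i) * g j) k).totalDegree ≤ δ := by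
    obtain ⟨D1, h1⟩ := fin_bdd fun k => (b 1 k).totalDegree
    obtain ⟨D2, h2⟩ := fin_bdd fun p : Fin N × Fin r × Fin r => (b (π (X p.1) * g p.2.1) p.2.2).totalDegree
    exact ⟨D1 + D2, fun k => (h1 k).trans (Nat.le_add_right _ _), fun i j k => (h2 (i, j, k)).trans (Nat.le_add_left _ _)⟩
  obtain ⟨Θ, hΘ⟩ : ∃ Θ : (Fin r → MvPolynomial (Fin e) ℂ) →ₗ[ℂ] A, ∀ c, Θ c = ∑ k, β (c k) * g k :=
    ⟨∑ k, (LinearMap.mulRight ℂ (g k) ∘ₗ β.toLinearMap) ∘ₗ LinearMap.proj k, fun c => by simp⟩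
  refine ⟨δ, Θ, ?_⟩
  obtain ⟨U, hUdef⟩ : ∃ U : ℕ → Submodule ℂ A, ∀ s, U s = (Submodule.pi Set.univ fun _ : Fin r => Pd e s).map Θ := ⟨_, fun _ => rfl⟩
  have hU : ∀ s x, x ∈ U s ↔ ∃ c : Fin r → MvPolynomial (Fin e) ℂ, (∀ k, (c k).totalDegree ≤ s) ∧ ∑ k, β (c k) * g k = x := by
    intro s x
    simp only [hUdef, Submodule.mem_map, Submodule.mem_pi, Set.mem_univ, true_imp_iff, mem_Pd, hΘ]
  have hmono : ∀ s s', s ≤ s' → U s ≤ U s' := by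
    intro s s' hs x hx
    rw [hU] at hx ⊢
    obtain ⟨c, hc, rfl⟩ := hx
    exact ⟨c, fun k => (hc k).trans hs, rfl⟩
  have hstep : ∀ s i x, x ∈ U s → x * π (X i) ∈ U (s + δ) := by
    intro s i x hx
    rw [hU] at hx ⊢
    obtain ⟨c, hc, rfl⟩ := hx
    refine ⟨fun k => ∑ j, c j * b (π (X i) * g j) k, fun k => ?_, ?_⟩
    · refine (totalDegree_finsetSum _ _).trans (Finset.sup_le fun j _ => ?_)
      exact (totalDegree_mul _ _).trans (add_le_add (hc j) (hδ2 i j k))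
    · simp only [map_sum, map_mul, Finset.sum_mul]
      rw [Finset.sum_comm]
      apply Finset.sum_congr rfl
      intro j _
      have := hb (π (X i) * g j)
      calc _ = β (c j) * ∑ k, β (b (π (X i) * g j) k) * g k := by
            rw [Finset.mul_sum]; exact Finset.sum_congr rfl fun k _ => by ring
        _ = _ := by rw [← this]; ring
  have hone : (1 : A) ∈ U δ := (hU _ _).2 ⟨b 1, hδ1, (hb 1).symm⟩
  have hmon : ∀ m : Fin N →₀ ℕ, π (monomial m 1) ∈ U (δ + m.degree * δ) := by
    intro m
    induction hk : m.degree generalizing m with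
    | zero =>
      have : m = 0 := (Finsupp.degree_eq_zero_iff m).1 hk
      subst this
      simpa using hone
    | succ k ih =>
      have hm0 : m ≠ 0 := by rintro rfl; simp at hk
      obtain ⟨i, hi⟩ := Finsupp.ne_iff.1 hm0
      have hle : Finsupp.single i 1 ≤ m := by
        rw [Finsupp.single_le_iff]; exact Nat.one_le_iff_ne_zero.2 hi
      have hdec : m - Finsupp.single i 1 + Finsupp.single i 1 = m := tsub_add_cancel_of_le hle
      have hd : (m - Finsupp.single i 1).degree = k := by
        have := congrArg Finsupp.degree hdec
        rw [map_add, hk, Finsupp.degree_single] at this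
        omega
      have h1 : (monomial m (1:ℂ)) = monomial (m - Finsupp.single i 1) 1 * X i := by
        rw [X, monomial_mul, mul_one, hdec]
      rw [h1, map_mul]
      have := hstep _ i _ (ih _ hd)
      rwa [show δ + (k + 1) * δ = δ + k * δ + δ by ring]
  have hmap : ∀ t, (Pd N t).map π.toLinearMap ≤ U (δ + t * δ) := by
    rintro t _ ⟨p, hp, rfl⟩
    have hp' := mem_Pd.1 hp
    rw [p.as_sum, map_sum]
    apply Submodule.sum_mem
    intro m hm
    have h1 : m.degree ≤ t := (le_totalDegree hm).trans hp'
    have h2 : monomial m (coeff m p) = coeff m p • monomial m (1 : ℂ) := by simp [smul_monomial]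
    rw [h2, map_smul]
    apply Submodule.smul_mem
    exact hmono _ _ (by gcongr) (hmon m)
  intro t
  rw [← hUdef]
  exact hmap t

lemma growth {N e : ℕ} {A : Type*} [CommRing A] [Algebra ℂ A] (π : MvPolynomial (Fin N) ℂ →ₐ[ℂ] A)
    (β : MvPolynomial (Fin e) ℂ →ₐ[ℂ] A) (hβ : β.toRingHom.Finite) :
    ∃ K, ∀ t, 1 ≤ t → Module.finrank ℂ ((Pd N t).map π.toLinearMap) ≤ K * t ^ e := by
  obtain ⟨r, g, hg⟩ := finite_gens β.toRingHom hβ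
  choose b hb using hg
  obtain ⟨δ, Θ, hmap⟩ := growth_core π β g b hb
  refine ⟨r * (2 * δ + e) ^ e, fun t ht => ?_⟩
  obtain ⟨f1, f2⟩ := pi_fd e r (δ + t * δ)
  have h1 := Submodule.finrank_mono (hmap t)
  have h2 := Submodule.finrank_map_le Θ (Submodule.pi Set.univ fun _ : Fin r => Pd e (δ + t * δ))
  refine h1.trans (h2.trans (f2.trans ?_))
  rw [mul_assoc, ← mul_pow]
  apply Nat.mul_le_mul_left
  rw [bFn]
  refine (Nat.choose_le_pow _ _).trans (Nat.pow_le_pow_left ?_ _)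
  nlinarith

open MvPolynomial

lemma jac_le {N q d : ℕ} {F : Fin N → MvPolynomial (Fin N) ℂ}
    (h : MvPolynomial (Fin N) ℂ) (hhom : h.IsHomogeneous (d + 1)) :
    jacobianIdeal N h ≤ (Ideal.span (Set.range fun k => aeval F (pderiv k h))).comap (aeval F : _ →ₐ[ℂ] MvPolynomial (Fin N) ℂ) := by
  have hk : ∀ k, pderiv k h ∈ (Ideal.span (Set.range fun k => aeval F (pderiv k h))).comap (aeval F : _ →ₐ[ℂ] MvPolynomial (Fin N) ℂ) :=
    fun k => Ideal.subset_span ⟨k, rfl⟩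
  generalize (Ideal.span (Set.range fun k => aeval F (pderiv k h))).comap (aeval F : _ →ₐ[ℂ] MvPolynomial (Fin N) ℂ) = J at hk ⊢
  rw [jacobianIdeal, Ideal.span_le]
  rintro x (rfl | ⟨k, rfl⟩)
  · have h1 := hhom.sum_X_mul_pderiv
    have h3 : x = C (((d : ℂ) + 1)⁻¹) * ∑ i, X i * pderiv i x := by
      rw [h1]
      have h4 : (d + 1) • x = C ((d : ℂ) + 1) * x := by simp
      have h5 : ((d : ℂ) + 1) ≠ 0 := by exact_mod_cast Nat.succ_ne_zero d
      rw [h4, ← mul_assoc, ← C_mul, inv_mul_cancel₀ h5, C_1, one_mul]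
    rw [SetLike.mem_coe, h3]
    exact Ideal.mul_mem_left _ _ (Ideal.sum_mem _ fun i _ => Ideal.mul_mem_left _ _ (hk i))
  · exact hk k

lemma noether_dim {A : Type*} [CommRing A] [Algebra ℂ A] [Algebra.FiniteType ℂ A] [Nontrivial A] (k : ℕ)
    (hk : ringKrullDim A < k) : ∃ e, e < k ∧ ∃ β : MvPolynomial (Fin e) ℂ →ₐ[ℂ] A, β.toRingHom.Finite := by
  obtain ⟨e, β, hi, hf⟩ := exists_finite_inj_algHom_of_fg ℂ A
  refine ⟨e, ?_, β, hf⟩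
  have h1 := krull_le_of_integral β.toRingHom (RingHom.Finite.to_isIntegral hf) hi
  rw [MvPolynomial.ringKrullDim_of_isNoetherianRing] at h1
  simp at h1
  have := h1.trans_lt hk
  exact_mod_cast this

lemma growth_I {N q d k : ℕ} {F : Fin N → MvPolynomial (Fin N) ℂ} (hF : IsEndo N (q + 1) F)
    (h : MvPolynomial (Fin N) ℂ) (hhom : h.IsHomogeneous (d + 1))
    (hk : ringKrullDim (MvPolynomial (Fin N) ℂ ⧸ jacobianIdeal N h) < (k + 1 : ℕ)) :
    ∃ K, ∀ t, 1 ≤ t → Module.finrank ℂ ((Pd N t).map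
      ((Ideal.span (Set.range fun k => aeval F (pderiv k h))).restrictScalars ℂ).mkQ) ≤ K * t ^ k := by
  have hle := jac_le (q := q) (F := F) h hhom
  generalize hI : (Ideal.span (Set.range fun k => aeval F (pderiv k h))) = I at *
  generalize hJ : jacobianIdeal N h = J at *
  have hker : LinearMap.ker (Ideal.Quotient.mkₐ ℂ I).toLinearMap = LinearMap.ker (I.restrictScalars ℂ).mkQ := by
    ext x
    simp [Ideal.Quotient.eq_zero_iff_mem]
  have hfr : ∀ t, Module.finrank ℂ ((Pd N t).map (I.restrictScalars ℂ).mkQ) =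
      Module.finrank ℂ ((Pd N t).map (Ideal.Quotient.mkₐ ℂ I).toLinearMap) := by
    intro t
    have h1 := rank_null (I.restrictScalars ℂ).mkQ (Pd N t)
    have h2 := rank_null (Ideal.Quotient.mkₐ ℂ I).toLinearMap (Pd N t)
    rw [hker] at h2
    omega
  simp only [hfr]
  let f : (MvPolynomial (Fin N) ℂ ⧸ J) →ₐ[ℂ] (MvPolynomial (Fin N) ℂ ⧸ I) := Ideal.quotientMapₐ I (aeval F) hle
  have hf : f.toRingHom.Finite := by
    have h1 : ((Ideal.Quotient.mk I).comp (aeval F : _ →ₐ[ℂ] MvPolynomial (Fin N) ℂ).toRingHom).Finite :=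
      (RingHom.Finite.of_surjective _ Ideal.Quotient.mk_surjective).comp (finite_aeval (by omega) hF)
    have h2 : (Ideal.Quotient.mk I).comp (aeval F : _ →ₐ[ℂ] MvPolynomial (Fin N) ℂ).toRingHom = f.toRingHom.comp (Ideal.Quotient.mk J) := by
      apply RingHom.ext; intro x; rfl
    rw [h2] at h1
    exact RingHom.Finite.of_comp_finite h1
  rcases subsingleton_or_nontrivial (MvPolynomial (Fin N) ℂ ⧸ J) with hs | hs
  · have : Subsingleton (MvPolynomial (Fin N) ℂ ⧸ I) := by
      apply subsingleton_of_zero_eq_one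
      rw [← map_one f, Subsingleton.elim (1 : MvPolynomial (Fin N) ℂ ⧸ J) 0, map_zero]
    refine ⟨0, fun t _ => ?_⟩
    rw [Module.finrank_zero_of_subsingleton]
    exact Nat.zero_le _
  · obtain ⟨e, he, β, hβ⟩ := noether_dim (k + 1) hk
    obtain ⟨K, hK⟩ := growth (Ideal.Quotient.mkₐ ℂ I) (f.comp β) (hf.comp hβ)
    refine ⟨K, fun t ht => (hK t ht).trans ?_⟩
    gcongr
    omega

lemma small_final {n q d k : ℕ} (hd : 1 ≤ d) {F : Fin (n + 1) → MvPolynomial (Fin (n + 1)) ℂ} (hF : IsEndo (n + 1) (q + 1) F)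
    (h : MvPolynomial (Fin (n + 1)) ℂ) (hp : Prime h) (hhom : h.IsHomogeneous (d + 1))
    {lam : ℂ} (hinv : aeval F h = C lam * h ^ (q + 1))
    (hk : ringKrullDim (MvPolynomial (Fin (n + 1)) ℂ ⧸ jacobianIdeal (n + 1) h) < (k + 1 : ℕ)) :
    ∃ K, ∀ t, 1 ≤ t → dm (Mr F h) t ≤ dm (LinearMap.range (Psi F h)) t + K * t ^ k := by
  obtain ⟨K, hK⟩ := growth_I hF h hhom hk
  obtain ⟨k', hk'⟩ := small_term (Mr F h) (LinearMap.range (Psi F h)) (fun m hm t => trv_mem hd hF h hhom m hm t)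
    (Ideal.span (Set.range fun k => aeval F (pderiv k h))) (by
      intro a ha m hm
      induction ha using Submodule.span_induction with
      | mem x hx =>
        obtain ⟨l, rfl⟩ := hx
        exact P_smul_Mr hF h hp hhom hinv m hm l
      | zero => rw [zero_smul]; exact Submodule.zero_mem _
      | add x y _ _ hx hy => rw [add_smul]; exact Submodule.add_mem _ hx hy
      | smul c x _ hx => rw [smul_assoc]; exact Submodule.smul_mem _ _ hx)
  refine ⟨k' * K, fun t ht => (hk' t).trans ?_⟩
  rw [mul_assoc]
  exact Nat.add_le_add_left (Nat.mul_le_mul_left _ (hK t ht)) _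

open MvPolynomial

lemma b_sub (N : ℕ) {t u : ℕ} (hu : u ≤ t) : betaFn N ((t : ℝ) + -(u : ℝ)) = bFn N (t - u) := by
  rw [bFn_eq_betaFn, Nat.cast_sub hu, sub_eq_add_neg]

lemma b_add (N t u : ℕ) : betaFn N ((t : ℝ) + (u : ℝ)) = bFn N (t + u) := by
  rw [bFn_eq_betaFn, Nat.cast_add]

lemma phi_deg {d q : ℕ} (hd : 1 ≤ d) {F : Fin (d + 3) → MvPolynomial (Fin (d + 3)) ℂ} (hF : IsEndo (d + 3) (q + 1) F)
    (h : MvPolynomial (Fin (d + 3)) ℂ) (hhom : h.IsHomogeneous (d + 1)) (p) (t : ℕ) (m) (hm : m ∈ Vd (d + 3) t) :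
    (phi (wv F h p) m).totalDegree ≤ t + (q * (d - 1) + d) + (jacT F).det.totalDegree := by
  have h1 : (jacT F).det.totalDegree = (d + 3) * q := (jacT_det_homog hF).totalDegree (jacT_det_ne (by omega) hF)
  rw [h1, phi_apply]
  refine (totalDegree_finsetSum _ _).trans (Finset.sup_le fun i _ => ?_)
  refine (totalDegree_mul _ _).trans ?_
  have h2 := (wv_homog (n := d + 2) hF h hhom p i).totalDegree_le
  have h3 := mem_Vd.1 hm i
  obtain ⟨e, rfl⟩ := Nat.exists_eq_add_of_le hd
  have h4 : (1 + e + 2) * q + (q + 1) * (1 + e) = q * (1 + e - 1) + (1 + e) + (1 + e + 3) * q := by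
    rw [Nat.add_sub_cancel_left]; ring
  omega

theorem core {d q : ℕ} (hd : 4 ≤ d) (hq : 1 ≤ q) {F : Fin (d + 3) → MvPolynomial (Fin (d + 3)) ℂ} (hF : IsEndo (d + 3) (q + 1) F)
    (h : MvPolynomial (Fin (d + 3)) ℂ) (hp : Prime h) (hhom : h.IsHomogeneous (d + 1))
    {lam : ℂ} (hlam : lam ≠ 0) (hinv : aeval F h = C lam * h ^ (q + 1))
    (hk : ringKrullDim (MvPolynomial (Fin (d + 3)) ℂ ⧸ jacobianIdeal (d + 3) h) < (d + 1 : ℕ)) : False := by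
  obtain ⟨K, hK⟩ := small_final (n := d + 2) (by omega) hF h hp hhom hinv hk
  obtain ⟨Δ, τ, hlow, hup⟩ := all_steps (N := d + 3) (by omega) (Finset.univ : Finset (Fin (d + 3) × Fin (d + 3)))
    (fun p => phi (wv F h p)) (jacT F).det (jacT_det_ne (by omega) hF) (q * (d - 1) + d)
    (fun p t m hm => phi_deg (by omega) hF h hhom p t m hm)
  change ∀ t, (d + 3) * bFn (d + 3) t + bFn (d + 3) (t + (q * (d - 1) + d)) ≤ dm (Mr F h) t + bFn (d + 3) (t + (q * (d - 1) + d) + Δ) at hlow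
  change ∀ T, τ ≤ T → dm (Mr F h) T + Δ * (T - τ + (d + 3)).choose (d + 3 - 1) ≤ (d + 3) * bFn (d + 3) T at hup
  have hmono : ∀ t, dm (LinearMap.range (Psi F h)) t ≤ dm (Mr F h) t := fun t => dm_mono (imA_le_Mr h hp hlam hinv) t
  have himg : ∀ t, d * q + d + q ≤ t → dm (LinearMap.range (Psi F h)) t + bFn (d + 3) (t - (d * q + d + q)) = 
      (d + 3) * bFn (d + 3) (t - q) + bFn (d + 3) (t - d) := fun t ht =>
    dm_imA (by omega) hF h hp hhom hlam hinv _ _ (by omega)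
  generalize dm (Mr F h) = m1 at *
  generalize dm (LinearMap.range (Psi F h)) = m0 at *
  have hΔ : Δ ≤ 2 * q := by
    have := asym1 (k := 6) (d + 3) (by omega) ![(d : ℝ) + 3, 1, -1, Δ, -Δ, -((d : ℝ) + 3)]
      ![-(q : ℝ), -(d : ℝ), -((d * q + d + q : ℕ) : ℝ), -(τ : ℝ) + 1, -(τ : ℝ), ((0 : ℕ) : ℝ)]
      (by simp [Fin.sum_univ_succ]) 0 (by
        filter_upwards [Filter.eventually_ge_atTop (d * q + d + q + τ)] with t ht
        simp only [Fin.sum_univ_six]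
        simp only [Matrix.cons_val]
        rw [b_sub _ (by omega : q ≤ t), b_sub _ (by omega : d ≤ t), b_sub _ (by omega : d * q + d + q ≤ t),
          b_sub _ (by omega : τ ≤ t), b_add]
        have e1 : (t : ℝ) + (-(τ : ℝ) + 1) = ((t - τ + 1 : ℕ) : ℝ) := by
          rw [Nat.cast_add, Nat.cast_sub (by omega)]; push_cast; ring
        rw [e1, ← bFn_eq_betaFn, bFn_succ _ _ (by omega)]
        have i1 := hup t (by omega)
        have i2 := hmono t
        have i3 := himg t (by omega)
        have i4 : (d + 3) * bFn (d + 3) (t - q) + bFn (d + 3) (t - d) + Δ * (t - τ + (d + 3)).choose (d + 3 - 1)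
          ≤ (d + 3) * bFn (d + 3) t + bFn (d + 3) (t - (d * q + d + q)) := by omega
        have i5 : (((d + 3) * bFn (d + 3) (t - q) + bFn (d + 3) (t - d) + Δ * (t - τ + (d + 3)).choose (d + 3 - 1) : ℕ) : ℝ)
          ≤ (((d + 3) * bFn (d + 3) t + bFn (d + 3) (t - (d * q + d + q)) : ℕ) : ℝ) := by exact_mod_cast i4
        rw [add_zero]
        push_cast at i5 ⊢
        nlinarith [i5])
    simp only [Fin.sum_univ_six] at this
    simp only [Matrix.cons_val] at this
    push_cast at this
    have h2 : (Δ : ℝ) ≤ 2 * q := by nlinarith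
    exact_mod_cast h2
  have := asym2 (k := 6) (d + 3) (by omega) ![(d : ℝ) + 3, -((d : ℝ) + 3), -1, 1, 1, -1]
      ![((0 : ℕ) : ℝ), -(q : ℝ), -(d : ℝ), -((d * q + d + q : ℕ) : ℝ), ((q * (d - 1) + d : ℕ) : ℝ), ((q * (d - 1) + d + 2 * q : ℕ) : ℝ)]
      (by simp [Fin.sum_univ_succ]) (by
        simp only [Fin.sum_univ_six]
        simp only [Matrix.cons_val]
        push_cast
        ring) K (by
        filter_upwards [Filter.eventually_ge_atTop (d * q + d + q + 1)] with t ht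
        simp only [Fin.sum_univ_six]
        simp only [Matrix.cons_val]
        rw [b_sub _ (by omega : q ≤ t), b_sub _ (by omega : d ≤ t), b_sub _ (by omega : d * q + d + q ≤ t),
          b_add, b_add, b_add, add_zero, ← add_assoc t (q * (d - 1) + d) (2 * q)]
        have i1 := hlow t
        have i2 := hK t (by omega)
        have i3 := himg t (by omega)
        have i6 : bFn (d + 3) (t + (q * (d - 1) + d) + Δ) ≤ bFn (d + 3) (t + (q * (d - 1) + d) + 2 * q) := bFn_mono _ (by omega)
        have i4 : (d + 3) * bFn (d + 3) t + bFn (d + 3) (t + (q * (d - 1) + d)) + bFn (d + 3) (t - (d * q + d + q)) ≤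
          (d + 3) * bFn (d + 3) (t - q) + bFn (d + 3) (t - d) + K * t ^ d + bFn (d + 3) (t + (q * (d - 1) + d) + 2 * q) := by omega
        have i5 : (((d + 3) * bFn (d + 3) t + bFn (d + 3) (t + (q * (d - 1) + d)) + bFn (d + 3) (t - (d * q + d + q)) : ℕ) : ℝ) ≤
          (((d + 3) * bFn (d + 3) (t - q) + bFn (d + 3) (t - d) + K * t ^ d + bFn (d + 3) (t + (q * (d - 1) + d) + 2 * q) : ℕ) : ℝ) := by
          exact_mod_cast i4
        rw [Nat.add_sub_cancel]
        push_cast at i5 ⊢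
        linarith)
  simp only [Fin.sum_univ_six] at this
  simp only [Matrix.cons_val] at this
  obtain ⟨e, rfl⟩ := Nat.exists_eq_add_of_le hd
  rw [show q * (4 + e - 1) = q * (3 + e) by congr 1; omega] at this
  push_cast at this
  have hq' : (1 : ℝ) ≤ q := by exact_mod_cast hq
  have he : (0 : ℝ) ≤ e := by positivity
  have : (q : ℝ) ^ 2 * (((4 : ℝ) + e) ^ 2 - 3 * (4 + e) - 2) + q * (2 * (4 + e) * (3 + e)) ≤ 0 := by
    refine le_of_eq_of_le ?_ this
    ring
  have h2 : (0 : ℝ) < (q : ℝ) ^ 2 * (((4 : ℝ) + e) ^ 2 - 3 * (4 + e) - 2) + q * (2 * (4 + e) * (3 + e)) := by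
    have : ((4 : ℝ) + e) ^ 2 - 3 * (4 + e) - 2 = e ^ 2 + 5 * e + 2 := by ring
    rw [this]
    positivity
  linarith

/-- A totally invariant irreducible hypersurface of `ℙⁿ` (`n ≥ 6`) of degree `n - 1` is not
normal: its singular locus has dimension `n - 2`, i.e. the Jacobian ring has Krull
dimension `≥ n - 1`. -/
theorem degree_n_sub_one_not_normal (n : ℕ) (hn : 6 ≤ n)
    (h : MvPolynomial (Fin (n + 1)) ℂ) (hirr : Irreducible h)
    (hhom : h.IsHomogeneous (n - 1)) (hinv : IsTotallyInvariant (n + 1) h) :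
    ((n - 1 : ℕ) : WithBot ℕ∞) ≤
      ringKrullDim (MvPolynomial (Fin (n + 1)) ℂ ⧸ jacobianIdeal (n + 1) h) := by
  by_contra hc
  rw [not_le] at hc
  obtain ⟨d, rfl⟩ : ∃ d, n = d + 2 := ⟨n - 2, by omega⟩
  obtain ⟨q, hq, F, hF, lam, hlam, hl⟩ := hinv
  obtain ⟨q, rfl⟩ : ∃ q', q = q' + 1 := ⟨q - 1, by omega⟩
  exact core (by omega) (by omega) hF h hirr.prime hhom hlam hl hc
end
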